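/- arXiv:2310.18452 — 2 statements merged into one kernel-verified Lean document; each statement's English description precedes it below -/
import Mathlib

section
/- For every integer k ≥ 2 there exists s₀ = s₀(k) such that for every integer s ≥ s₀ the following holds: every finite graph G with average degree d(G) ≥ s^{5000k⁴} either contains the complete bipartite graph K_{s,s} as a (not necessarily induced) subgraph, or contains an induced subgraph G' ⊆ G which contains no cycle of length 4 (as a subgraph) and has average degree d(G') ≥ k. -/
open Finset

/-- The average degree `2|E|/|V|` of a finite simple graph. -/
noncomputable def avgDeg {V : Type*} [Fintype V] (G : SimpleGraph V) : ℝ :=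
  2 * G.edgeSet.ncard / Fintype.card V

/-- The degree of a vertex. -/
noncomputable def deg {V : Type*} (G : SimpleGraph V) (v : V) : ℕ :=
  (G.neighborSet v).ncard

/-- `G` contains `K_{s,s}` as a (not necessarily induced) subgraph. -/
def HasKssSubgraph {V : Type*} (G : SimpleGraph V) (s : ℕ) : Prop :=
  ∃ f : completeBipartiteGraph (Fin s) (Fin s) →g G, Function.Injective f

/-- `G` contains no cycle of length 4, even as a non-induced subgraph. -/
def C4Free {V : Type*} (G : SimpleGraph V) : Prop :=
  ¬ ∃ a b c d : V, a ≠ b ∧ a ≠ c ∧ a ≠ d ∧ b ≠ c ∧ b ≠ d ∧ c ≠ d ∧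
      G.Adj a b ∧ G.Adj b c ∧ G.Adj c d ∧ G.Adj d a

/-- The balanced subdivision of `K_h` in which every edge of `K_h` is replaced by a
path with exactly `ℓ` edges (intended for `ℓ ≥ 2`): branch vertices are `Fin h`,
and each pair `a < b` gets a path of `ℓ - 1` new internal vertices. -/
def balancedSubdivision (h ℓ : ℕ) :
    SimpleGraph (Fin h ⊕ ({p : Fin h × Fin h // p.1 < p.2} × Fin (ℓ - 1))) :=
  SimpleGraph.fromRel (fun x y =>
    match x, y with
    | Sum.inl u, Sum.inr ⟨⟨⟨a, b⟩, _⟩, i⟩ => (u = a ∧ (i : ℕ) = 0) ∨ (u = b ∧ (i : ℕ) = ℓ - 2)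
    | Sum.inr ⟨e, i⟩, Sum.inr ⟨e', j⟩ => e = e' ∧ (j : ℕ) = (i : ℕ) + 1
    | _, _ => False)

/-- `G` contains an induced proper balanced subdivision of `K_h`. -/
def HasInducedBalancedSubdivision {V : Type*} (G : SimpleGraph V) (h : ℕ) : Prop :=
  ∃ ℓ : ℕ, 2 ≤ ℓ ∧ Nonempty (balancedSubdivision h ℓ ↪g G)

/-- The number of edges of `G` with one endpoint in `A` and the other in `B`
(for disjoint `A`, `B`). -/
noncomputable def crossEdges {V : Type*} (G : SimpleGraph V) (A B : Set V) : ℕ :=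
  Set.ncard {p : V × V | p.1 ∈ A ∧ p.2 ∈ B ∧ G.Adj p.1 p.2}

/-- `G` is `d`-degenerate: every (induced) subgraph has a vertex of degree at most `d`. -/
def Degenerate {V : Type*} (G : SimpleGraph V) (d : ℕ) : Prop :=
  ∀ s : Finset V, s.Nonempty → ∃ v ∈ s, ((s : Set V) ∩ G.neighborSet v).ncard ≤ d

/-- The 1-subdivision of the multihypergraph with hyperedges `edges e`, `e : E`,
on vertex set `V`. -/
def oneSubdivision {E V : Type*} (edges : E → Finset V) : SimpleGraph (E ⊕ V) :=
  SimpleGraph.fromRel (fun x y =>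
    match x, y with
    | Sum.inl a, Sum.inr b => b ∈ edges a
    | _, _ => False)

/-- The 1-subdivision of a simple graph `G`. -/
def graphOneSubdivision {W : Type*} (G : SimpleGraph W) : SimpleGraph (G.edgeSet ⊕ W) :=
  SimpleGraph.fromRel (fun x y =>
    match x, y with
    | Sum.inl e, Sum.inr w => w ∈ (e : Sym2 W)
    | _, _ => False)

/-- `I` is an independent set of `G`. -/
def IndepSet {V : Type*} (G : SimpleGraph V) (I : Set V) : Prop :=
  I.Pairwise fun u v => ¬ G.Adj u v

/-- `G` has a clique on `k` vertices. -/
def HasClique {V : Type*} (G : SimpleGraph V) (k : ℕ) : Prop :=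
  ∃ t : Finset V, G.IsNClique k t


noncomputable section

open scoped Classical

namespace InducedC4Free

/-- The neighbours of `v` in `Y`. -/
def nbr {V : Type*} (G : SimpleGraph V) (v : V) (Y : Finset V) : Finset V :=
  Y.filter fun y => G.Adj v y

/-- The vertices of `Y` outside the closed neighbourhood of `v`. -/
def far {V : Type*} (G : SimpleGraph V) (v : V) (Y : Finset V) : Finset V :=
  Y.filter fun y => y ≠ v ∧ ¬ G.Adj v y

/-- The number of adjacent pairs in `X × Y`. -/
def adjCount {V : Type*} (G : SimpleGraph V) (X Y : Finset V) : ℕ :=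
  ∑ x ∈ X, #(nbr G x Y)

/-- `G` has no (not necessarily induced) `K_{s,s}`. -/
def BicliqueFree {V : Type*} (G : SimpleGraph V) (s : ℕ) : Prop :=
  ∀ A B : Finset V, #A = s → #B = s → ¬ ∀ a ∈ A, ∀ b ∈ B, G.Adj a b

/-- No two distinct vertices of `A` have two distinct common neighbours in `A`. -/
def NoC4On {V : Type*} (G : SimpleGraph V) (A : Finset V) : Prop :=
  ∀ a ∈ A, ∀ b ∈ A, ∀ c ∈ A, ∀ d ∈ A, a ≠ c → b ≠ d →
    G.Adj a b → G.Adj b c → G.Adj c d → ¬ G.Adj d a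

/-- Some nonempty `A` induces a `C₄`-free graph of average degree at least `k`. -/
def HasSparseInduced {V : Type*} (G : SimpleGraph V) (k : ℕ) : Prop :=
  ∃ A : Finset V, A.Nonempty ∧ NoC4On G A ∧ k * #A ≤ adjCount G A A

section Basic

variable {V : Type*} {G : SimpleGraph V} {k s : ℕ}

@[simp] lemma mem_nbr {v y : V} {Y : Finset V} : y ∈ nbr G v Y ↔ y ∈ Y ∧ G.Adj v y := by
  simp [nbr]

@[simp] lemma mem_far {v y : V} {Y : Finset V} :
    y ∈ far G v Y ↔ y ∈ Y ∧ y ≠ v ∧ ¬ G.Adj v y := by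
  simp [far]

lemma nbr_subset (v : V) (Y : Finset V) : nbr G v Y ⊆ Y := filter_subset _ _

lemma far_subset (v : V) (Y : Finset V) : far G v Y ⊆ Y := filter_subset _ _

lemma nbr_mono (v : V) {Y Z : Finset V} (h : Y ⊆ Z) : nbr G v Y ⊆ nbr G v Z :=
  filter_subset_filter _ h

lemma adjCount_eq_card (X Y : Finset V) :
    adjCount G X Y = #((X ×ˢ Y).filter fun x => G.Adj x.1 x.2) := by
  rw [adjCount, card_filter, sum_product]
  refine sum_congr rfl fun x _ => ?_
  rw [nbr, card_filter]

lemma adjCount_comm (X Y : Finset V) : adjCount G X Y = adjCount G Y X := by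
  simp only [adjCount, nbr, card_filter]
  rw [sum_comm]
  simp only [G.adj_comm]

lemma adjCount_mono {X X' Y Y' : Finset V} (hX : X ⊆ X') (hY : Y ⊆ Y') :
    adjCount G X Y ≤ adjCount G X' Y' := by
  unfold adjCount
  calc _ ≤ ∑ x ∈ X, #(nbr G x Y') := sum_le_sum fun x _ => card_le_card (nbr_mono x hY)
    _ ≤ _ := sum_le_sum_of_subset hX

/-- Few vertices are adjacent to almost all of a large set. -/
lemma card_dominating_lt (hK : BicliqueFree G s) {Y : Finset V} (hY : 4 * s ≤ #Y) (Q : Finset V) :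
    #(Q.filter fun v => 2 * s * #(far G v Y) < #Y) < s := by
  by_contra! h
  obtain ⟨A, hA, hAs⟩ := exists_subset_card_eq h
  have h1 : #(A.biUnion fun v => far G v Y) * 2 ≤ #Y := by
    have h2 : #(A.biUnion fun v => far G v Y) ≤ ∑ v ∈ A, #(far G v Y) := card_biUnion_le
    rcases Nat.eq_zero_or_pos s with rfl | hs
    · have : A = ∅ := card_eq_zero.mp hAs
      simp [this]
    · have h3 : ∑ v ∈ A, 2 * s * #(far G v Y) ≤ ∑ v ∈ A, #Y :=
        sum_le_sum fun v hv => (mem_filter.mp (hA hv)).2.le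
      rw [← mul_sum, sum_const, hAs, smul_eq_mul] at h3
      have : s * (2 * ∑ v ∈ A, #(far G v Y)) ≤ s * #Y := by linarith
      have := Nat.le_of_mul_le_mul_left this hs
      omega
  have h4 : s ≤ #((Y \ A.biUnion fun v => far G v Y) \ A) := by
    have h5 := le_card_sdiff (A.biUnion fun v => far G v Y) Y
    have h6 := le_card_sdiff A (Y \ A.biUnion fun v => far G v Y)
    omega
  obtain ⟨B, hB, hBs⟩ := exists_subset_card_eq h4
  refine hK A B hAs hBs fun a ha b hb => ?_
  have hb' := hB hb
  simp only [mem_sdiff, mem_biUnion, mem_far, not_exists, not_and, not_not] at hb'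
  exact hb'.1.2 a ha hb'.1.1 (fun e => hb'.2 (e ▸ ha))

/-- An induced bipartite graph, regular on one side, with codegrees at most one. -/
lemma hasSparseInduced_of_bipartite {A B : Finset V} (hA : A.Nonempty)
    (hcard : #B ≤ #A) (hdisj : Disjoint A B)
    (indA : ∀ a ∈ A, ∀ a' ∈ A, ¬ G.Adj a a') (indB : ∀ b ∈ B, ∀ b' ∈ B, ¬ G.Adj b b')
    (hdeg : ∀ a ∈ A, k ≤ #(nbr G a B))
    (hco : ∀ a ∈ A, ∀ a' ∈ A, a ≠ a' → ∀ b ∈ B, ∀ b' ∈ B, b ≠ b' →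
      G.Adj a b → G.Adj a b' → G.Adj a' b → ¬ G.Adj a' b') :
    HasSparseInduced G k := by
  refine ⟨A ∪ B, hA.mono subset_union_left, ?_, ?_⟩
  · intro a ha b hb c hc d hd hac hbd h1 h2 h3 h4
    rcases mem_union.mp ha with ha | ha
    · have hb : b ∈ B := (mem_union.mp hb).resolve_left fun h => indA _ ha _ h h1
      have hd : d ∈ B := (mem_union.mp hd).resolve_left fun h => indA _ h _ ha h4
      have hc : c ∈ A := (mem_union.mp hc).resolve_right fun h => indB _ hb _ h h2
      exact hco a ha c hc hac b hb d hd hbd h1 h4.symm h2.symm h3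
    · have hb : b ∈ A := (mem_union.mp hb).resolve_right fun h => indB _ ha _ h h1
      have hd : d ∈ A := (mem_union.mp hd).resolve_right fun h => indB _ h _ ha h4
      have hc : c ∈ B := (mem_union.mp hc).resolve_left fun h => indA _ hb _ h h2
      exact hco b hb d hd hbd a ha c hc hac h1.symm h2 h4 h3.symm
  · have h1 : adjCount G A B + adjCount G B A ≤ adjCount G (A ∪ B) (A ∪ B) := by
      have : adjCount G (A ∪ B) (A ∪ B) = adjCount G A (A ∪ B) + adjCount G B (A ∪ B) :=
        sum_union hdisj
      rw [this]
      exact add_le_add (adjCount_mono subset_rfl subset_union_right)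
        (adjCount_mono subset_rfl subset_union_left)
    rw [adjCount_comm B A] at h1
    have h2 : k * #A ≤ adjCount G A B := by
      rw [mul_comm, ← smul_eq_mul]
      exact card_nsmul_le_sum _ _ _ hdeg
    have h3 : k * #(A ∪ B) ≤ k * (#A + #A) :=
      Nat.mul_le_mul_left _ ((card_union_le _ _).trans (by omega))
    linarith

/-- Large sets have a system of distinct, pairwise nonadjacent representatives. -/
lemma exists_independent_transversal [Nonempty V] {ι : Type*} (hK : BicliqueFree G s)
    (hs : 0 < s) {q : ℕ} (hq : 4 * s ≤ q) (I : Finset ι) (hqI : s * #I ≤ q) (Y : ι → Finset V)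
    (hY : ∀ i ∈ I, q * (2 * s) ^ #I ≤ #(Y i)) :
    ∃ y : ι → V, (∀ i ∈ I, y i ∈ Y i) ∧
      ∀ i ∈ I, ∀ j ∈ I, i ≠ j → y i ≠ y j ∧ ¬ G.Adj (y i) (y j) := by
  induction I using Finset.induction_on generalizing Y with
  | empty => exact ⟨fun _ => Classical.arbitrary V, by simp, by simp⟩
  | insert i₀ I hi ih =>
    rw [card_insert_of_notMem hi] at hqI hY
    have hpos : 0 < (2 * s) ^ #I := by positivity
    have hbig : ∀ i ∈ insert i₀ I, q ≤ #(Y i) := fun i h =>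
      (Nat.le_mul_of_pos_right q (by positivity)).trans (hY i h)
    obtain ⟨v, hv, hgood⟩ : ∃ v ∈ Y i₀, ∀ i ∈ I, #(Y i) ≤ 2 * s * #(far G v (Y i)) := by
      by_contra! hcon
      have h1 : Y i₀ ⊆ I.biUnion fun i => (Y i₀).filter fun v => 2 * s * #(far G v (Y i)) < #(Y i) := by
        intro v hv
        obtain ⟨i, hi, h⟩ := hcon v hv
        simp only [mem_biUnion, mem_filter]
        exact ⟨i, hi, hv, h⟩
      have h2 := (card_le_card h1).trans card_biUnion_le
      have h3 : ∑ i ∈ I, #((Y i₀).filter fun v => 2 * s * #(far G v (Y i)) < #(Y i)) ≤ ∑ i ∈ I, s :=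
        sum_le_sum fun i h => (card_dominating_lt hK
          (hq.trans (hbig i (mem_insert_of_mem h))) _).le
      rw [sum_const, smul_eq_mul] at h3
      have h4 := hbig i₀ (mem_insert_self _ _)
      nlinarith
    obtain ⟨y, hy1, hy2⟩ := ih (by nlinarith) (fun i => far G v (Y i)) (by
      intro i h
      have h1 := hY i (mem_insert_of_mem h)
      have h2 := hgood i h
      have h3 : 2 * s * (q * (2 * s) ^ #I) ≤ 2 * s * #(far G v (Y i)) := by
        rw [pow_succ] at h1
        linarith
      exact Nat.le_of_mul_le_mul_left h3 (by positivity))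
    have hne : ∀ i ∈ I, i ≠ i₀ := fun i h e => hi (e ▸ h)
    have hfar : ∀ i ∈ I, y i ≠ v ∧ ¬ G.Adj v (y i) := fun i h => (mem_far.mp (hy1 i h)).2
    refine ⟨Function.update y i₀ v, ?_, ?_⟩
    · intro i h
      rcases mem_insert.mp h with rfl | h
      · simpa using hv
      · rw [Function.update_of_ne (hne i h)]
        exact far_subset _ _ (hy1 i h)
    · intro i hi' j hj' hij
      rcases mem_insert.mp hi' with rfl | h <;> rcases mem_insert.mp hj' with rfl | h'
      · exact (hij rfl).elim
      · rw [Function.update_self, Function.update_of_ne (hne j h')]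
        exact ⟨(hfar j h').1.symm, (hfar j h').2⟩
      · rw [Function.update_self, Function.update_of_ne (hne i h)]
        exact ⟨(hfar i h).1, fun e => (hfar i h).2 e.symm⟩
      · rw [Function.update_of_ne (hne i h), Function.update_of_ne (hne j h')]
        exact hy2 i h j h' hij

end Basic

/-- `k`-element blocks on `P` points, pairwise meeting in at most one point, at least as many
blocks as points. -/
structure IsDesign (k : ℕ) {P L : ℕ} (inc : Fin L → Finset (Fin P)) : Prop where
  card_block : ∀ l, #(inc l) = k
  eq_of_mem : ∀ l l', l ≠ l' → ∀ p ∈ inc l, ∀ q ∈ inc l, p ∈ inc l' → q ∈ inc l' → p = q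
  le_blocks : P ≤ L
  blocks_pos : 0 < L

section Tuple

variable {V : Type*} {G : SimpleGraph V} {k s P L : ℕ} {inc : Fin L → Finset (Fin P)}

lemma IsDesign.hasSparseInduced (hD : IsDesign k inc) (hK : BicliqueFree G s) (hs : 0 < s)
    (π : Fin P → V) (hπ : ∀ p q, p ≠ q → π p ≠ π q ∧ ¬ G.Adj (π p) (π q))
    (Y : Fin L → Finset V) (hY : ∀ l, ∀ y ∈ Y l, ∀ p, y ≠ π p ∧ (G.Adj (π p) y ↔ p ∈ inc l))
    (hcard : ∀ l, 4 * s * L * (2 * s) ^ L ≤ #(Y l)) : HasSparseInduced G k := by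
  have hL := hD.blocks_pos
  have : Nonempty V := by
    have h1 := hcard ⟨0, hL⟩
    have h2 : 0 < 4 * s * L * (2 * s) ^ L := by positivity
    obtain ⟨v, _⟩ := card_pos.mp (h2.trans_le h1)
    exact ⟨v⟩
  obtain ⟨y, hy1, hy2⟩ := exists_independent_transversal (q := 4 * s * L) hK hs
    (Nat.le_mul_of_pos_right _ hL) (univ : Finset (Fin L)) (by simp; nlinarith) Y
    (by simpa using hcard)
  have hyinj : Function.Injective y := fun i j h => by
    by_contra hne
    exact (hy2 i (mem_univ _) j (mem_univ _) hne).1 h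
  have hπinj : Function.Injective π := fun i j h => by
    by_contra hne
    exact (hπ i j hne).1 h
  have hY' := fun l p => hY l (y l) (hy1 l (mem_univ _)) p
  refine hasSparseInduced_of_bipartite (A := univ.image y) (B := univ.image π) ?_ ?_ ?_ ?_ ?_ ?_ ?_
  · exact ⟨y ⟨0, hL⟩, mem_image_of_mem _ (mem_univ _)⟩
  · rw [card_image_of_injective _ hyinj, card_image_of_injective _ hπinj]
    simpa using hD.le_blocks
  · rw [disjoint_left]
    simp only [mem_image, mem_univ, true_and, not_exists, forall_exists_index]
    rintro _ l rfl p h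
    exact (hY' l p).1 h.symm
  · simp only [mem_image, mem_univ, true_and, forall_exists_index]
    rintro _ l rfl _ l' rfl h
    exact (hy2 l (mem_univ _) l' (mem_univ _) (fun e => G.loopless.irrefl _ (e ▸ h))).2 h
  · simp only [mem_image, mem_univ, true_and, forall_exists_index]
    rintro _ l rfl _ l' rfl h
    exact (hπ l l' (fun e => G.loopless.irrefl _ (e ▸ h))).2 h
  · simp only [mem_image, mem_univ, true_and, forall_exists_index]
    rintro _ l rfl
    rw [← hD.card_block l, ← card_image_of_injective _ hπinj]
    refine card_le_card fun v hv => ?_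
    obtain ⟨p, hp, rfl⟩ := mem_image.mp hv
    rw [mem_nbr]
    exact ⟨mem_image_of_mem _ (mem_univ _), ((hY' l p).2.mpr hp).symm⟩
  · simp only [mem_image, mem_univ, true_and, forall_exists_index]
    rintro _ l rfl _ l' rfl hne _ p rfl _ q rfl hpq h1 h2 h3 h4
    refine hpq (congrArg π (hD.eq_of_mem l l' (fun e => hne (congrArg y e)) p ?_ q ?_ ?_ ?_))
    · exact (hY' l p).2.mp h1.symm
    · exact (hY' l q).2.mp h2.symm
    · exact (hY' l' p).2.mp h3.symm
    · exact (hY' l' q).2.mp h4.symm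

/-- A set of tuples with at most `c` completions in one coordinate is small. -/
lemma card_le_of_update {U : Finset V} {c : ℕ} (S : Finset (Fin P → V))
    (hS : ∀ τ ∈ S, ∀ q, τ q ∈ U) (p : Fin P)
    (h : ∀ σ : Fin P → V, #(U.filter fun v => Function.update σ p v ∈ S) ≤ c) :
    #S ≤ c * #U ^ (P - 1) := by
  have h1 : #(S.image fun (τ : Fin P → V) (q : {q : Fin P // q ≠ p}) => τ q) ≤ #U ^ (P - 1) := by
    calc _ ≤ #(Fintype.piFinset fun _ : {q : Fin P // q ≠ p} => U) := by
          refine card_le_card fun σ hσ => ?_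
          obtain ⟨τ, hτ, rfl⟩ := mem_image.mp hσ
          exact Fintype.mem_piFinset.mpr fun q => hS τ hτ q
      _ = _ := by simp [Fintype.card_piFinset]
  have h2 : #S ≤ c * #(S.image fun (τ : Fin P → V) (q : {q : Fin P // q ≠ p}) => τ q) := by
    refine card_le_mul_card_image _ _ fun σ hσ => ?_
    obtain ⟨τ, hτ, rfl⟩ := mem_image.mp hσ
    refine le_trans ?_ (h τ)
    refine card_le_card_of_injOn (fun τ' => τ' p) ?_ ?_
    · intro τ' hτ'
      simp only [coe_filter, Set.mem_ofPred_eq] at hτ'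
      simp only [coe_filter, Set.mem_ofPred_eq]
      refine ⟨hS _ hτ'.1 p, ?_⟩
      have : Function.update τ p (τ' p) = τ' := by
        funext q
        by_cases hq : q = p
        · subst hq; simp
        · rw [Function.update_of_ne hq]
          exact (congrFun hτ'.2 ⟨q, hq⟩).symm
      rw [this]; exact hτ'.1
    · intro τ₁ h₁ τ₂ h₂ he
      simp only [coe_filter, Set.mem_ofPred_eq] at h₁ h₂
      funext q
      by_cases hq : q = p
      · subst hq; exact he
      · exact (congrFun h₁.2 ⟨q, hq⟩).trans (congrFun h₂.2 ⟨q, hq⟩).symm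
  exact h2.trans (Nat.mul_le_mul_left _ h1)

/-- The vertices of `Y` adjacent to all `τ p` with `p ∈ I` and far from all `τ p` with `p ∈ Q`. -/
def pattern (G : SimpleGraph V) (Y : Finset V) (τ : Fin P → V) (I Q : Finset (Fin P)) : Finset V :=
  Y.filter fun y => (∀ p ∈ I, G.Adj (τ p) y) ∧ ∀ p ∈ Q, y ≠ τ p ∧ ¬ G.Adj (τ p) y

lemma pattern_insert (Y : Finset V) (τ : Fin P → V) (I Q : Finset (Fin P)) (p : Fin P) :
    pattern G Y τ I (insert p Q) = far G (τ p) (pattern G Y τ I Q) := by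
  ext y
  simp only [pattern, mem_filter, mem_far, forall_mem_insert]
  tauto

lemma card_bad_pattern_le (hK : BicliqueFree G s) (hs : 0 < s) {U Y : Finset V} {M : ℕ}
    (S : Finset (Fin P → V)) (hS : ∀ τ ∈ S, ∀ q, τ q ∈ U) (I : Finset (Fin P))
    (hI : ∀ τ ∈ S, M ≤ #(pattern G Y τ I ∅)) (Q : Finset (Fin P)) (hIQ : Disjoint I Q)
    (hM : 4 * s * (2 * s) ^ #Q ≤ M) :
    #(S.filter fun τ => (2 * s) ^ #Q * #(pattern G Y τ I Q) < M) ≤ #Q * s * #U ^ (P - 1) := by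
  induction Q using Finset.induction_on with
  | empty =>
    simp only [card_empty, pow_zero, one_mul, zero_mul, nonpos_iff_eq_zero, card_eq_zero]
    refine filter_eq_empty_iff.mpr fun τ hτ => ?_
    simpa using hI τ hτ
  | insert p Q hp ih =>
    have hIQ' : Disjoint I Q := hIQ.mono_right (subset_insert _ _)
    have hpI : p ∉ I := fun h => disjoint_left.mp hIQ h (mem_insert_self _ _)
    rw [card_insert_of_notMem hp] at hM ⊢
    have h2s : 1 ≤ 2 * s := by omega
    have hM' : 4 * s * (2 * s) ^ #Q ≤ M :=
      le_trans (Nat.mul_le_mul_left _ (Nat.pow_le_pow_right h2s (Nat.le_succ _))) hM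
    have ih := ih hIQ' hM'
    set S₁ := S.filter fun τ => (2 * s) ^ #Q * #(pattern G Y τ I Q) < M
    set S₂ := S.filter fun τ => 4 * s ≤ #(pattern G Y τ I Q) ∧
      2 * s * #(far G (τ p) (pattern G Y τ I Q)) < #(pattern G Y τ I Q) with hS₂
    have hsub : (S.filter fun τ => (2 * s) ^ (#Q + 1) * #(pattern G Y τ I (insert p Q)) < M)
        ⊆ S₁ ∪ S₂ := by
      intro τ hτ
      rw [mem_filter] at hτ
      rw [mem_union]
      by_cases h : (2 * s) ^ #Q * #(pattern G Y τ I Q) < M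
      · exact Or.inl (mem_filter.mpr ⟨hτ.1, h⟩)
      · refine Or.inr (mem_filter.mpr ⟨hτ.1, ?_, ?_⟩)
        · push Not at h
          have h3 := hM'.trans h
          rw [mul_comm] at h3
          exact Nat.le_of_mul_le_mul_left h3 (by positivity)
        · push Not at h
          rw [pattern_insert] at hτ
          have h3 := hτ.2.trans_le h
          rw [pow_succ, mul_assoc] at h3
          exact Nat.lt_of_mul_lt_mul_left h3
    have hind : ∀ (σ : Fin P → V) (v : V),
        pattern G Y (Function.update σ p v) I Q = pattern G Y σ I Q := by
      intro σ v
      refine filter_congr fun y _ => ?_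
      have e1 : ∀ q ∈ I, Function.update σ p v q = σ q := fun q hq =>
        Function.update_of_ne (fun e : q = p => hpI (e ▸ hq)) _ _
      have e2 : ∀ q ∈ Q, Function.update σ p v q = σ q := fun q hq =>
        Function.update_of_ne (fun e : q = p => hp (e ▸ hq)) _ _
      constructor
      · rintro ⟨h1, h2⟩
        exact ⟨fun q hq => e1 q hq ▸ h1 q hq, fun q hq => e2 q hq ▸ h2 q hq⟩
      · rintro ⟨h1, h2⟩
        exact ⟨fun q hq => (e1 q hq).symm ▸ h1 q hq, fun q hq => (e2 q hq).symm ▸ h2 q hq⟩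
    have hS₂card : #S₂ ≤ s * #U ^ (P - 1) := by
      refine card_le_of_update S₂ (fun τ hτ => hS τ (mem_filter.mp hτ).1) p fun σ => ?_
      by_cases h : 4 * s ≤ #(pattern G Y σ I Q)
      · refine le_trans (card_le_card ?_) (card_dominating_lt hK h U).le
        intro v hv
        rw [mem_filter] at hv ⊢
        refine ⟨hv.1, ?_⟩
        have := (mem_filter.mp hv.2).2.2
        rwa [hind, Function.update_self] at this
      · rw [card_eq_zero.mpr]
        · exact Nat.zero_le _
        · refine filter_eq_empty_iff.mpr fun v _ hv => h ?_
          have := (mem_filter.mp hv).2.1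
          rwa [hind] at this
    calc _ ≤ #(S₁ ∪ S₂) := card_le_card hsub
      _ ≤ #S₁ + #S₂ := card_union_le _ _
      _ ≤ #Q * s * #U ^ (P - 1) + s * #U ^ (P - 1) := add_le_add ih hS₂card
      _ = _ := by ring

/-- Many independent tuples all of whose blocks have many common neighbours. -/
lemma IsDesign.hasSparseInduced_of_tuples (hD : IsDesign k inc) (hK : BicliqueFree G s)
    (hs : 0 < s) (U Y : Finset V) {M : ℕ} (S : Finset (Fin P → V))
    (hS : ∀ τ ∈ S, ∀ q, τ q ∈ U)
    (hfar : ∀ τ ∈ S, ∀ p q, p ≠ q → τ p ≠ τ q ∧ ¬ G.Adj (τ p) (τ q))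
    (hcn : ∀ τ ∈ S, ∀ l, M ≤ #(pattern G Y τ (inc l) ∅))
    (hM : 4 * s * L * (2 * s) ^ L * (2 * s) ^ P ≤ M)
    (hcard : L * P * s * #U ^ (P - 1) < #S) : HasSparseInduced G k := by
  have hL := hD.blocks_pos
  have hPQ : ∀ l, #(univ \ inc l) ≤ P := fun l => by
    simpa using card_le_univ (univ \ inc l)
  have h2s : 1 ≤ 2 * s := by omega
  have hMl : ∀ l, 4 * s * (2 * s) ^ #(univ \ inc l) ≤ M := fun l => by
    refine le_trans ?_ hM
    calc 4 * s * (2 * s) ^ #(univ \ inc l) ≤ 4 * s * (2 * s) ^ P :=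
          Nat.mul_le_mul_left _ (Nat.pow_le_pow_right h2s (hPQ l))
      _ ≤ 4 * s * (2 * s) ^ P * (L * (2 * s) ^ L) := Nat.le_mul_of_pos_right _ (by positivity)
      _ = _ := by ring
  obtain ⟨τ, hτ, hgood⟩ : ∃ τ ∈ S, ∀ l,
      M ≤ (2 * s) ^ #(univ \ inc l) * #(pattern G Y τ (inc l) (univ \ inc l)) := by
    by_contra! hcon
    have h1 : S ⊆ (univ : Finset (Fin L)).biUnion fun l => S.filter fun τ =>
        (2 * s) ^ #(univ \ inc l) * #(pattern G Y τ (inc l) (univ \ inc l)) < M := by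
      intro τ hτ
      obtain ⟨l, hl⟩ := hcon τ hτ
      simp only [mem_biUnion, mem_univ, true_and, mem_filter]
      exact ⟨l, hτ, hl⟩
    have h2 := (card_le_card h1).trans card_biUnion_le
    have h3 : ∑ l : Fin L, #(S.filter fun τ =>
        (2 * s) ^ #(univ \ inc l) * #(pattern G Y τ (inc l) (univ \ inc l)) < M)
        ≤ ∑ _l : Fin L, P * s * #U ^ (P - 1) := by
      refine sum_le_sum fun l _ => (card_bad_pattern_le hK hs S hS (inc l)
        (fun τ hτ => hcn τ hτ l) _ disjoint_sdiff (hMl l)).trans ?_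
      exact Nat.mul_le_mul_right _ (Nat.mul_le_mul_right _ (hPQ l))
    rw [sum_const, card_univ, Fintype.card_fin, smul_eq_mul] at h3
    have : L * (P * s * #U ^ (P - 1)) = L * P * s * #U ^ (P - 1) := by ring
    omega
  refine hD.hasSparseInduced hK hs τ (hfar τ hτ)
    (fun l => pattern G Y τ (inc l) (univ \ inc l)) ?_ ?_
  · intro l y hy p
    simp only [pattern, mem_filter, mem_sdiff, mem_univ, true_and] at hy
    by_cases hp : p ∈ inc l
    · have := hy.2.1 p hp
      exact ⟨this.ne', by simp [this, hp]⟩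
    · have := hy.2.2 p hp
      exact ⟨this.1, by simp [this.2, hp]⟩
  · intro l
    have h1 := hM.trans ((hgood l).trans (Nat.mul_le_mul_right _
      (Nat.pow_le_pow_right h2s (hPQ l))))
    rw [mul_comm ((2 * s) ^ P)] at h1
    exact Nat.le_of_mul_le_mul_right h1 (by positivity)

/-- Independent tuples are abundant. -/
lemma card_independent_tuples (hK : BicliqueFree G s) (hs : 0 < s) (m : ℕ) (U : Finset V)
    (hU : (4 * s) ^ (m + 1) ≤ #U) :
    #U ^ m ≤ (4 * s) ^ (m ^ 2) * #((Fintype.piFinset fun _ : Fin m => U).filter fun τ =>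
      ∀ p q, p ≠ q → τ p ≠ τ q ∧ ¬ G.Adj (τ p) (τ q)) := by
  induction m generalizing U with
  | zero =>
    simp [filter_true_of_mem]
  | succ m ih =>
    set F : Finset V → Finset (Fin m → V) := fun U => (Fintype.piFinset fun _ : Fin m => U).filter
      fun τ => ∀ p q, p ≠ q → τ p ≠ τ q ∧ ¬ G.Adj (τ p) (τ q) with hF
    set W := U.filter fun v => #U ≤ 2 * s * #(far G v U) with hW
    have h4 : 1 ≤ 4 * s := by omega
    have hU4 : 4 * s ≤ #U := le_trans (by
      calc 4 * s = (4 * s) ^ 1 := (pow_one _).symm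
        _ ≤ _ := Nat.pow_le_pow_right h4 (by omega)) hU
    have hWc : #U ≤ 2 * #W := by
      have h1 := card_dominating_lt hK hU4 U
      have h2 := card_filter_add_card_filter_not (s := U) (fun v => 2 * s * #(far G v U) < #U)
      simp only [not_lt] at h2
      rw [hW]
      omega
    have hstep : ∀ v ∈ W, #U ^ m ≤ (2 * s) ^ m * ((4 * s) ^ (m ^ 2) * #(F (far G v U))) := by
      intro v hv
      have h1 := (mem_filter.mp hv).2
      have h2 : (4 * s) ^ (m + 1) ≤ #(far G v U) := by
        have h3 : 2 * s * (4 * s) ^ (m + 1) ≤ 2 * s * #(far G v U) := by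
          refine le_trans ?_ (hU.trans h1)
          rw [pow_succ (4 * s) (m + 1)]
          nlinarith [Nat.zero_le ((4 * s) ^ (m + 1))]
        exact Nat.le_of_mul_le_mul_left h3 (by positivity)
      calc #U ^ m ≤ (2 * s * #(far G v U)) ^ m := Nat.pow_le_pow_left h1 m
        _ = (2 * s) ^ m * #(far G v U) ^ m := mul_pow _ _ _
        _ ≤ _ := Nat.mul_le_mul_left _ (ih _ h2)
    have hcount : ∑ v ∈ W, #(F (far G v U)) ≤
        #((Fintype.piFinset fun _ : Fin (m + 1) => U).filter fun τ =>
          ∀ p q, p ≠ q → τ p ≠ τ q ∧ ¬ G.Adj (τ p) (τ q)) := by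
      rw [← card_sigma]
      refine card_le_card_of_injOn (fun x => (Fin.cons x.1 x.2 : Fin (m + 1) → V)) ?_ ?_
      · rintro ⟨v, τ⟩ hx
        simp only [mem_coe, mem_sigma, hF, mem_filter, Fintype.mem_piFinset, mem_far] at hx
        obtain ⟨hv, hτ, hτ'⟩ := hx
        simp only [coe_filter, Set.mem_ofPred_eq, Fintype.mem_piFinset]
        constructor
        · intro p
          refine Fin.cases ?_ (fun i => ?_) p
          · simpa using (mem_filter.mp hv).1
          · simpa using (hτ i).1
        · intro p q
          refine Fin.cases ?_ (fun i => ?_) p <;> refine Fin.cases ?_ (fun j => ?_) q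
          · simp
          · intro _
            simpa using ⟨(hτ j).2.1.symm, (hτ j).2.2⟩
          · intro _
            simpa [G.adj_comm] using (hτ i).2
          · intro h
            simpa using hτ' i j (by simpa using h)
      · rintro ⟨v, τ⟩ _ ⟨v', τ'⟩ _ h
        obtain ⟨rfl, rfl⟩ := Fin.cons_injective2 h
        rfl
    calc #U ^ (m + 1) = #U * #U ^ m := by ring
      _ ≤ 2 * #W * #U ^ m := Nat.mul_le_mul_right _ hWc
      _ = 2 * ∑ v ∈ W, #U ^ m := by rw [sum_const, smul_eq_mul]; ring
      _ ≤ 2 * ∑ v ∈ W, (2 * s) ^ m * ((4 * s) ^ (m ^ 2) * #(F (far G v U))) :=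
          Nat.mul_le_mul_left _ (sum_le_sum hstep)
      _ = 2 * (2 * s) ^ m * (4 * s) ^ (m ^ 2) * ∑ v ∈ W, #(F (far G v U)) := by
          rw [← mul_sum, ← mul_sum]; ring
      _ ≤ (4 * s) * (4 * s) ^ m * (4 * s) ^ (m ^ 2) * ∑ v ∈ W, #(F (far G v U)) := by
          gcongr <;> omega
      _ ≤ (4 * s) ^ ((m + 1) ^ 2) * ∑ v ∈ W, #(F (far G v U)) := by
          gcongr
          rw [← pow_succ', ← pow_add]
          exact Nat.pow_le_pow_right h4 (by nlinarith)
      _ ≤ _ := Nat.mul_le_mul_left _ hcount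

end Tuple

/-- Lines `y = a x + b` over `ZMod p`, restricted to `k` columns. -/
lemma exists_design (k : ℕ) (hk : 2 ≤ k) :
    ∃ (P L : ℕ) (inc : Fin L → Finset (Fin P)), IsDesign k inc ∧ 2 ≤ P ∧
      P ≤ 2 * k ^ 2 ∧ L ≤ 4 * k ^ 2 := by
  obtain ⟨p, hp, hkp, hp2⟩ := Nat.exists_prime_lt_and_le_two_mul k (by omega)
  have : Fact p.Prime := ⟨hp⟩
  let ePt := Fintype.equivFin (Fin k × ZMod p)
  let eLn := Fintype.equivFin (ZMod p × ZMod p)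
  have hcP : Fintype.card (Fin k × ZMod p) = k * p := by simp [ZMod.card]
  have hcL : Fintype.card (ZMod p × ZMod p) = p * p := by simp [ZMod.card]
  refine ⟨Fintype.card (Fin k × ZMod p), Fintype.card (ZMod p × ZMod p),
    fun l => univ.image fun i : Fin k =>
      ePt (i, (eLn.symm l).1 * ((i : ℕ) : ZMod p) + (eLn.symm l).2), ⟨?_, ?_, ?_, ?_⟩, ?_, ?_, ?_⟩
  · intro l
    rw [card_image_of_injective]
    · simp
    · intro i j h
      exact (Prod.mk.inj (ePt.injective h)).1
  · intro l l' hne x hx y hy hx' hy'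
    simp only [mem_image, mem_univ, true_and] at hx hy hx' hy'
    obtain ⟨i, rfl⟩ := hx
    obtain ⟨j, rfl⟩ := hy
    obtain ⟨i', hi'⟩ := hx'
    obtain ⟨j', hj'⟩ := hy'
    obtain ⟨rfl, h1⟩ := Prod.mk.inj (ePt.injective hi')
    obtain ⟨rfl, h2⟩ := Prod.mk.inj (ePt.injective hj')
    by_cases hij : i' = j'
    · rw [hij]
    exfalso
    refine hne (eLn.symm.injective ?_)
    have hij' : ((i' : ℕ) : ZMod p) - ((j' : ℕ) : ZMod p) ≠ 0 := by
      intro h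
      rw [sub_eq_zero, ZMod.natCast_eq_natCast_iff'] at h
      rw [Nat.mod_eq_of_lt (by omega), Nat.mod_eq_of_lt (by omega)] at h
      exact hij (Fin.ext h)
    have h3 : (eLn.symm l).1 = (eLn.symm l').1 := by
      have : ((eLn.symm l).1 - (eLn.symm l').1) * (((i' : ℕ) : ZMod p) - ((j' : ℕ) : ZMod p)) = 0 := by
        linear_combination h2 - h1
      rcases mul_eq_zero.mp this with h | h
      · exact sub_eq_zero.mp h
      · exact (hij' h).elim
    refine Prod.ext h3 ?_
    rw [h3] at h1
    exact (add_left_cancel h1).symm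
  · rw [hcP, hcL]
    exact Nat.mul_le_mul_right _ hkp.le
  · rw [hcL]
    exact Nat.mul_pos hp.pos hp.pos
  · rw [hcP]; nlinarith [hp.two_le]
  · rw [hcP]; nlinarith
  · rw [hcL]; nlinarith

section Dense

variable {V : Type*} {G : SimpleGraph V} {k s P L : ℕ} {inc : Fin L → Finset (Fin P)}

/-- Dependent random choice. -/
lemma exists_rich_subset {X Y : Finset V} (hX : X.Nonempty) (hY : Y.Nonempty) (t : ℕ)
    {α β : ℝ} (hα : 0 < α) (hβ : 0 < β) (hd : α * #X * #Y ≤ adjCount G X Y)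
    (inc : Fin L → Finset (Fin P)) :
    ∃ U ⊆ X, α ^ (t + 1) / 2 * #X ≤ #U ∧
      (#((Fintype.piFinset fun _ : Fin P => U).filter fun τ =>
        ∃ l, (#(pattern G Y τ (inc l) ∅) : ℝ) < β * #Y) : ℝ) * (α ^ (t + 1) * #X) ≤
        #U * (2 * β ^ (t + 1) * #X ^ P) := by
  set x : ℝ := (#X : ℝ) with hx
  set y : ℝ := (#Y : ℝ) with hy
  have hxpos : 0 < x := by rw [hx]; exact_mod_cast hX.card_pos
  have hypos : 0 < y := by rw [hy]; exact_mod_cast hY.card_pos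
  let Ω := Fintype.piFinset fun _ : Fin (t + 1) => Y
  let U : (Fin (t + 1) → V) → Finset V := fun T => X.filter fun v => ∀ i, G.Adj v (T i)
  let B := (Fintype.piFinset fun _ : Fin P => X).filter fun τ =>
    ∃ l, (#(pattern G Y τ (inc l) ∅) : ℝ) < β * y
  let bad : (Fin (t + 1) → V) → ℕ := fun T => #(B.filter fun τ => ∀ p i, G.Adj (τ p) (T i))
  have hΩ : (#Ω : ℝ) = y ^ (t + 1) := by
    simp [Ω, Fintype.card_piFinset, hy]
  have hΩne : Ω.Nonempty := by
    rw [← card_pos]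
    have : (0 : ℝ) < #Ω := by rw [hΩ]; positivity
    exact_mod_cast this
  have h1 : x * (α * y) ^ (t + 1) ≤ ∑ T ∈ Ω, (#(U T) : ℝ) := by
    have e1 : ∑ T ∈ Ω, (#(U T) : ℝ) = ∑ v ∈ X, (#(nbr G v Y) : ℝ) ^ (t + 1) := by
      have : ∑ T ∈ Ω, #(U T) = ∑ v ∈ X, #(nbr G v Y) ^ (t + 1) := by
        simp only [U, card_filter]
        rw [sum_comm]
        refine sum_congr rfl fun v _ => ?_
        rw [← card_filter]
        have : Ω.filter (fun T => ∀ i, G.Adj v (T i)) =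
            Fintype.piFinset fun _ : Fin (t + 1) => nbr G v Y := by
          ext T
          simp [Ω, Fintype.mem_piFinset, forall_and]
        rw [this]
        simp [Fintype.card_piFinset]
      exact_mod_cast this
    rw [e1]
    have e2 := pow_sum_div_card_le_sum_pow (s := X) (f := fun v => (#(nbr G v Y) : ℝ))
      (fun v _ => by positivity) t
    refine le_trans ?_ e2
    rw [le_div_iff₀ (by positivity)]
    have e3 : (α * x * y) ^ (t + 1) ≤ (∑ v ∈ X, (#(nbr G v Y) : ℝ)) ^ (t + 1) := by
      refine pow_le_pow_left₀ (by positivity) ?_ _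
      calc _ ≤ (adjCount G X Y : ℝ) := hd
        _ = _ := by simp [adjCount]
    calc x * (α * y) ^ (t + 1) * x ^ t = (α * x * y) ^ (t + 1) := by ring
      _ ≤ _ := e3
  have h2 : ∑ T ∈ Ω, (bad T : ℝ) ≤ x ^ P * (β * y) ^ (t + 1) := by
    have e1 : ∑ T ∈ Ω, (bad T : ℝ) =
        ∑ τ ∈ B, (#(Ω.filter fun T => ∀ p i, G.Adj (τ p) (T i)) : ℝ) := by
      have : ∑ T ∈ Ω, bad T = ∑ τ ∈ B, #(Ω.filter fun T => ∀ p i, G.Adj (τ p) (T i)) := by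
        simp only [bad, card_filter]
        rw [sum_comm]
      exact_mod_cast this
    rw [e1]
    have e2 : ∀ τ ∈ B, (#(Ω.filter fun T => ∀ p i, G.Adj (τ p) (T i)) : ℝ) ≤
        (β * y) ^ (t + 1) := by
      intro τ hτ
      obtain ⟨l, hl⟩ := (mem_filter.mp hτ).2
      have : #(Ω.filter fun T => ∀ p i, G.Adj (τ p) (T i)) ≤
          #(Fintype.piFinset fun _ : Fin (t + 1) => pattern G Y τ (inc l) ∅) := by
        refine card_le_card fun T hT => ?_
        simp only [Ω, mem_filter, Fintype.mem_piFinset] at hT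
        simp only [Fintype.mem_piFinset, pattern, mem_filter]
        exact fun i => ⟨hT.1 i, fun p _ => hT.2 p i, by simp⟩
      calc _ ≤ (#(Fintype.piFinset fun _ : Fin (t + 1) => pattern G Y τ (inc l) ∅) : ℝ) := by
            exact_mod_cast this
        _ = (#(pattern G Y τ (inc l) ∅) : ℝ) ^ (t + 1) := by simp [Fintype.card_piFinset]
        _ ≤ _ := pow_le_pow_left₀ (by positivity) hl.le _
    calc _ ≤ ∑ τ ∈ B, (β * y) ^ (t + 1) := sum_le_sum e2
      _ = #B * (β * y) ^ (t + 1) := by rw [sum_const, nsmul_eq_mul]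
      _ ≤ _ := by
        gcongr
        calc (#B : ℝ) ≤ (#(Fintype.piFinset fun _ : Fin P => X) : ℝ) := by
              exact_mod_cast card_filter_le _ _
          _ = x ^ P := by simp [Fintype.card_piFinset, hx]
  set c : ℝ := α ^ (t + 1) * x / (2 * β ^ (t + 1) * x ^ P) with hc
  have hcpos : 0 < c := by positivity
  obtain ⟨T, hT, hT'⟩ : ∃ T ∈ Ω, α ^ (t + 1) / 2 * x ≤ (#(U T) : ℝ) - c * bad T := by
    refine exists_le_of_sum_le hΩne ?_
    rw [sum_const, nsmul_eq_mul, hΩ, sum_sub_distrib, ← mul_sum]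
    have e1 : c * ∑ T ∈ Ω, (bad T : ℝ) ≤ c * (x ^ P * (β * y) ^ (t + 1)) :=
      mul_le_mul_of_nonneg_left h2 hcpos.le
    have e2 : c * (x ^ P * (β * y) ^ (t + 1)) = x * (α * y) ^ (t + 1) / 2 := by
      rw [hc, mul_pow, mul_pow]
      field_simp
    have e3 : y ^ (t + 1) * (α ^ (t + 1) / 2 * x) = x * (α * y) ^ (t + 1) / 2 := by
      rw [mul_pow]; ring
    linarith
  refine ⟨U T, filter_subset _ _, ?_, ?_⟩
  · have : 0 ≤ c * bad T := by positivity
    linarith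
  · have e0 : ((Fintype.piFinset fun _ : Fin P => U T).filter fun τ =>
        ∃ l, (#(pattern G Y τ (inc l) ∅) : ℝ) < β * y) =
        B.filter fun τ => ∀ p i, G.Adj (τ p) (T i) := by
      ext τ
      simp only [B, U, mem_filter, Fintype.mem_piFinset, forall_and]
      tauto
    rw [e0]
    have e1 : c * bad T ≤ #(U T) := by
      have : 0 ≤ α ^ (t + 1) / 2 * x := by positivity
      linarith
    rw [hc, div_mul_eq_mul_div, div_le_iff₀ (by positivity)] at e1
    linarith

/-- The exponent in the local sparsity bound. -/
def localExp (a P L : ℕ) : ℕ := a * (P ^ 2 + 2) + P ^ 2 + P + L + 3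

/-- How large `s` has to be in the local sparsity bound. -/
def localConst (P L : ℕ) : ℕ := 2 ^ (P + L + 4) * 4 ^ (P ^ 2 + P) * L * P

set_option maxHeartbeats 1000000 in
/-- A dense pair of large sets yields an induced copy of the incidence graph of a design. -/
lemma IsDesign.hasSparseInduced_of_dense (hD : IsDesign k inc) (hP : 2 ≤ P)
    (hK : BicliqueFree G s) (a : ℕ) (hs : localConst P L ≤ s) {X Y : Finset V}
    (hX : s ^ localExp a P L ≤ #X) (hY : s ^ localExp a P L ≤ #Y)
    (hd : #X * #Y ≤ s ^ a * adjCount G X Y) : HasSparseInduced G k := by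
  have hL := hD.blocks_pos
  have hC : 0 < localConst P L := by unfold localConst; positivity
  have hs0 : 0 < s := hC.trans_le hs
  have hs1 : (1 : ℝ) ≤ s := by exact_mod_cast hs0
  have hsC : (2 : ℝ) ^ (P + L + 4) * 4 ^ (P ^ 2 + P) * L * P ≤ s := by
    have : ((localConst P L : ℕ) : ℝ) ≤ s := by exact_mod_cast hs
    simpa [localConst] using this
  have hL1 : (1 : ℝ) ≤ L := by exact_mod_cast hL
  have hP1 : (1 : ℝ) ≤ P := by exact_mod_cast (by omega : 1 ≤ P)
  have hsmall : (2 : ℝ) ^ P * (4 * 4 ^ (P ^ 2)) ≤ s ∧ (4 : ℝ) ^ (P + 1) ≤ s ∧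
      (4 * L * 2 ^ (L + P) : ℝ) ≤ s ∧ (2 * L * P * 4 ^ (P ^ 2) : ℝ) ≤ s := by
    have hpow : ∀ (b : ℝ) (n : ℕ), 1 ≤ b → 1 ≤ b ^ n := fun b n h => one_le_pow₀ h
    have a1 := hpow 2 P (by norm_num)
    have a2 := hpow 2 L (by norm_num)
    have a3 := hpow 4 (P ^ 2) (by norm_num)
    have a4 := hpow 4 P (by norm_num)
    have hsC' : (4 * L * 2 ^ P * 2 ^ L * 4 ^ (P ^ 2) * (4 * 4 ^ P)) * P ≤ (s : ℝ) := by
      refine le_trans (le_of_eq ?_) hsC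
      rw [pow_add, pow_add, pow_add]; ring
    refine ⟨le_trans ?_ hsC', le_trans ?_ hsC', le_trans ?_ hsC', le_trans ?_ hsC'⟩
    · calc (2 : ℝ) ^ P * (4 * 4 ^ (P ^ 2)) = (4 * 1 * 2 ^ P * 1 * 4 ^ (P ^ 2) * (1 * 1)) * 1 := by
            ring
        _ ≤ _ := by gcongr; norm_num
    · calc (4 : ℝ) ^ (P + 1) = (1 * 1 * 1 * 1 * 1 * (4 * 4 ^ P)) * 1 := by ring
        _ ≤ _ := by gcongr; norm_num
    · calc (4 * L * 2 ^ (L + P) : ℝ) = (4 * L * 2 ^ P * 2 ^ L * 1 * (1 * 1)) * 1 := by ring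
        _ ≤ _ := by gcongr; norm_num
    · calc (2 * L * P * 4 ^ (P ^ 2) : ℝ) = (2 * L * 1 * 1 * 4 ^ (P ^ 2) * (1 * 1)) * P := by ring
        _ ≤ _ := by gcongr <;> norm_num
  have hXpos : 0 < #X := (by positivity : 0 < s ^ localExp a P L).trans_le hX
  have hYpos : 0 < #Y := (by positivity : 0 < s ^ localExp a P L).trans_le hY
  have hspos : (0 : ℝ) < s := by linarith
  have hPp : ∀ z : ℝ, z * z ^ (P - 1) = z ^ P := fun z => mul_pow_sub_one (by omega) z
  set α : ℝ := ((s : ℝ) ^ a)⁻¹ with hα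
  have hαpos : 0 < α := by positivity
  set β : ℝ := α ^ P / s with hβ
  have hβpos : 0 < β := by positivity
  obtain ⟨U, hUX, hU1, hU2⟩ := exists_rich_subset (G := G) (card_pos.mp hXpos) (card_pos.mp hYpos)
    (P ^ 2 + 1) hαpos hβpos (by
      rw [hα, mul_assoc, inv_mul_le_iff₀ (by positivity)]
      exact_mod_cast hd) inc
  set x : ℝ := (#X : ℝ) with hx
  set y : ℝ := (#Y : ℝ) with hy
  set u : ℝ := (#U : ℝ) with hu
  have hxpos : 0 < x := by rw [hx]; exact_mod_cast hXpos
  have hxs : (s : ℝ) ^ localExp a P L ≤ x := by rw [hx]; exact_mod_cast hX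
  have hys : (s : ℝ) ^ localExp a P L ≤ y := by rw [hy]; exact_mod_cast hY
  have hus : (s : ℝ) ^ (P ^ 2 + 2) ≤ u := by
    have e1 : α ^ (P ^ 2 + 1 + 1) * (s : ℝ) ^ (a * (P ^ 2 + 2)) = 1 := by
      rw [hα, inv_pow, ← pow_mul]
      exact inv_mul_cancel₀ (by positivity)
    have e2 : (s : ℝ) ^ localExp a P L = s ^ (a * (P ^ 2 + 2)) * s ^ (P ^ 2 + P + L + 3) := by
      rw [← pow_add]; congr 1; unfold localExp; ring
    have e3 : (s : ℝ) ^ (P ^ 2 + P + L + 3) / 2 ≤ u := by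
      refine le_trans ?_ hU1
      calc (s : ℝ) ^ (P ^ 2 + P + L + 3) / 2
          = α ^ (P ^ 2 + 1 + 1) / 2 * s ^ localExp a P L := by
            rw [e2]
            linear_combination (-(s : ℝ) ^ (P ^ 2 + P + L + 3) / 2) * e1
        _ ≤ _ := by gcongr
    have e4 : (s : ℝ) ^ (P ^ 2 + 3) ≤ s ^ (P ^ 2 + P + L + 3) :=
      pow_le_pow_right₀ hs1 (by omega)
    have e5 : (s : ℝ) ^ (P ^ 2 + 3) = s ^ (P ^ 2 + 2) * s := by ring
    have e6 : (0 : ℝ) < s ^ (P ^ 2 + 2) := by positivity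
    have e7 : (2 : ℝ) ≤ s := by
      have : (4 : ℝ) ^ 1 ≤ 4 ^ (P + 1) := pow_le_pow_right₀ (by norm_num) (by omega)
      linarith [hsmall.2.1]
    nlinarith
  have hupos : 0 < u := lt_of_lt_of_le (by positivity) hus
  set bad := (Fintype.piFinset fun _ : Fin P => U).filter fun τ =>
        ∃ l, (#(pattern G Y τ (inc l) ∅) : ℝ) < β * y with hbad
  set F := (Fintype.piFinset fun _ : Fin P => U).filter fun τ =>
      ∀ p q, p ≠ q → τ p ≠ τ q ∧ ¬ G.Adj (τ p) (τ q) with hF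
  have hbadle : (#bad : ℝ) ≤ u ^ P / (4 * (4 * s) ^ (P ^ 2)) := by
    have ew : α ^ (P ^ 2 + 1 + 1) * x ≤ 2 * u := by linarith
    set w := α ^ (P ^ 2 + 1 + 1) * x with hw
    have hwpos : 0 < w := by positivity
    have e1 : β ^ (P ^ 2 + 1 + 1) * x ^ P = w ^ P / s ^ (P ^ 2 + 2) := by
      rw [hβ, hw, div_pow, mul_pow, ← pow_mul, ← pow_mul, mul_comm P, div_mul_eq_mul_div]
    have e2 : (#bad : ℝ) * w ≤ u * 2 * (w ^ (P - 1) / s ^ (P ^ 2 + 2)) * w := by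
      calc (#bad : ℝ) * w ≤ u * 2 * (β ^ (P ^ 2 + 1 + 1) * x ^ P) := by linarith
        _ = u * 2 * (w ^ (P - 1) / s ^ (P ^ 2 + 2)) * w := by
          rw [e1, ← hPp w]
          ring
    have e3 := le_of_mul_le_mul_right e2 hwpos
    refine e3.trans ?_
    calc u * 2 * (w ^ (P - 1) / s ^ (P ^ 2 + 2)) ≤ u * 2 * ((2 * u) ^ (P - 1) / s ^ (P ^ 2 + 2)) := by
          gcongr
      _ = u ^ P * 2 ^ P / s ^ (P ^ 2 + 2) := by
          rw [← mul_pow, ← hPp (u * 2)]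
          ring
      _ ≤ _ := by
          rw [div_le_div_iff₀ (by positivity) (by positivity)]
          have e4 : (2 : ℝ) ^ P * (4 * 4 ^ (P ^ 2)) ≤ s ^ 2 := by
            calc _ ≤ (s : ℝ) := hsmall.1
              _ ≤ s ^ 2 := by nlinarith
          calc u ^ P * 2 ^ P * (4 * (4 * s) ^ (P ^ 2))
              = u ^ P * s ^ (P ^ 2) * (2 ^ P * (4 * 4 ^ (P ^ 2))) := by rw [mul_pow]; ring
            _ ≤ u ^ P * s ^ (P ^ 2) * s ^ 2 := by gcongr
            _ = _ := by ring
  have hFge : u ^ P ≤ (4 * s : ℝ) ^ (P ^ 2) * #F := by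
    have e1 : (4 * s) ^ (P + 1) ≤ #U := by
      rw [← Nat.cast_le (α := ℝ)]
      push_cast
      refine le_trans ?_ hus
      calc (4 * s : ℝ) ^ (P + 1) = 4 ^ (P + 1) * s ^ (P + 1) := mul_pow _ _ _
        _ ≤ s * s ^ (P + 1) := by gcongr; exact hsmall.2.1
        _ = s ^ (P + 2) := by ring
        _ ≤ _ := pow_le_pow_right₀ hs1 (by nlinarith)
    have e2 := card_independent_tuples hK hs0 P U e1
    rw [← hF] at e2
    rw [hu]
    exact_mod_cast e2
  refine hD.hasSparseInduced_of_tuples hK hs0 U Y (M := ⌈β * y⌉₊) (F \ bad) ?_ ?_ ?_ ?_ ?_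
  · intro τ hτ
    exact Fintype.mem_piFinset.mp (mem_filter.mp (mem_sdiff.mp hτ).1).1
  · intro τ hτ
    exact (mem_filter.mp (mem_sdiff.mp hτ).1).2
  · intro τ hτ l
    rw [mem_sdiff] at hτ
    by_contra hlt
    refine hτ.2 (mem_filter.mpr ⟨(mem_filter.mp hτ.1).1, l, ?_⟩)
    exact Nat.lt_ceil.mp (not_le.mp hlt)
  · rw [← Nat.cast_le (α := ℝ)]
    refine le_trans ?_ (Nat.le_ceil _)
    push_cast
    have e1 : α ^ P * (s : ℝ) ^ (a * P) = 1 := by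
      rw [hα, inv_pow, ← pow_mul]
      exact inv_mul_cancel₀ (by positivity)
    have e2 : (s : ℝ) ^ (a * P + (L + P + 3)) ≤ y := by
      refine le_trans (pow_le_pow_right₀ hs1 ?_) hys
      unfold localExp
      have : a * P ≤ a * (P ^ 2 + 2) := Nat.mul_le_mul_left _ (by nlinarith)
      have : 0 ≤ P ^ 2 := Nat.zero_le _
      omega
    calc (4 * s * L * (2 * s) ^ L * (2 * s) ^ P : ℝ) = 4 * L * 2 ^ (L + P) * s ^ (L + P + 1) := by
          rw [mul_pow, mul_pow, pow_add, pow_add, pow_add]; ring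
      _ ≤ s * s ^ (L + P + 1) := by gcongr; exact hsmall.2.2.1
      _ = β * s ^ (a * P + (L + P + 3)) := by
          rw [hβ, pow_add _ (a * P), div_mul_eq_mul_div, ← mul_assoc, e1, one_mul,
            eq_div_iff hspos.ne']
          ring
      _ ≤ β * y := by gcongr
  · have e1 : (#F : ℝ) - #bad ≤ #(F \ bad) := by
      have := le_card_sdiff bad F
      rw [tsub_le_iff_right] at this
      rw [sub_le_iff_le_add]
      exact_mod_cast this
    rw [← Nat.cast_lt (α := ℝ)]
    refine lt_of_lt_of_le ?_ e1
    push_cast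
    set R : ℝ := (4 * s : ℝ) ^ (P ^ 2) with hR
    have hRpos : 0 < R := by positivity
    have e2 : u ^ P / R ≤ #F := by
      rw [div_le_iff₀ hRpos]; linarith
    have e3 : (#bad : ℝ) ≤ u ^ P / R / 4 := by
      refine hbadle.trans (le_of_eq ?_)
      field_simp
    have e4 : (L * P * s : ℝ) * u ^ (P - 1) ≤ u ^ P / R / 2 := by
      rw [div_div, le_div_iff₀ (by positivity)]
      have e5 : (L * P * s : ℝ) * (R * 2) ≤ u := by
        refine le_trans ?_ hus
        calc (L * P * s : ℝ) * (R * 2) = (2 * L * P * 4 ^ (P ^ 2)) * s ^ (P ^ 2 + 1) := by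
              rw [hR, mul_pow]; ring
          _ ≤ s * s ^ (P ^ 2 + 1) := by gcongr; exact hsmall.2.2.2
          _ = _ := by ring
      calc (L * P * s : ℝ) * u ^ (P - 1) * (R * 2) = (L * P * s : ℝ) * (R * 2) * u ^ (P - 1) := by
            ring
        _ ≤ u * u ^ (P - 1) := by gcongr
        _ = u ^ P := by
          exact hPp u
    have e6 : 0 < u ^ P / R := by positivity
    linarith

end Dense

section Turan

variable {V : Type*}

/-- The Caro–Wei bound. -/
lemma exists_independent_sum_le (H : SimpleGraph V) (A : Finset V) :
    ∃ I ⊆ A, (∀ a ∈ I, ∀ b ∈ I, ¬ H.Adj a b) ∧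
      ∑ a ∈ A, (1 / ((#(nbr H a A) : ℝ) + 1)) ≤ #I := by
  induction A using Finset.strongInduction with
  | H A ih =>
    rcases A.eq_empty_or_nonempty with rfl | hA
    · exact ⟨∅, by simp, by simp, by simp⟩
    obtain ⟨v, hv, hmin⟩ := exists_min_image A (fun a => #(nbr H a A)) hA
    have hvf : v ∉ far H v A := by simp
    have hss : far H v A ⊂ A := (ssubset_iff_of_subset (far_subset _ _)).mpr ⟨v, hv, hvf⟩
    obtain ⟨I, hI, hind, hsum⟩ := ih _ hss
    have hvI : v ∉ I := fun h => hvf (hI h)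
    have hIf : ∀ a ∈ I, ¬ H.Adj v a := fun a ha => (mem_far.mp (hI ha)).2.2
    refine ⟨insert v I, insert_subset hv (hI.trans (far_subset _ _)), ?_, ?_⟩
    · intro a ha b hb
      rcases mem_insert.mp ha with rfl | ha' <;> rcases mem_insert.mp hb with rfl | hb'
      · exact H.loopless.irrefl _
      · exact hIf b hb'
      · exact fun h => hIf a ha' h.symm
      · exact hind a ha' b hb'
    · rw [card_insert_of_notMem hvI, ← sum_sdiff (far_subset (G := H) v A)]
      push_cast
      rw [add_comm]
      refine add_le_add (le_trans (sum_le_sum fun a _ => ?_) hsum) ?_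
      · have : #(nbr H a (far H v A)) ≤ #(nbr H a A) := card_le_card (nbr_mono a (far_subset _ _))
        have : (#(nbr H a (far H v A)) : ℝ) ≤ #(nbr H a A) := by exact_mod_cast this
        gcongr
      · have h1 : ∀ a ∈ A \ far H v A,
            (1 / ((#(nbr H a A) : ℝ) + 1)) ≤ 1 / ((#(nbr H v A) : ℝ) + 1) := fun a ha => by
          have : (#(nbr H v A) : ℝ) ≤ #(nbr H a A) := by exact_mod_cast hmin a (mem_sdiff.mp ha).1
          gcongr
        refine (sum_le_sum h1).trans ?_
        rw [sum_const, nsmul_eq_mul, mul_one_div, div_le_one (by positivity)]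
        have h2 : A \ far H v A ⊆ insert v (nbr H v A) := by
          intro a ha
          simp only [mem_sdiff, mem_far, not_and, not_not] at ha
          simp only [mem_insert, mem_nbr]
          by_cases h : a = v
          · exact Or.inl h
          · exact Or.inr ⟨ha.1, ha.2 ha.1 h⟩
        have h3 := (card_le_card h2).trans (card_insert_le _ _)
        exact_mod_cast h3

/-- Turán's bound for independent sets. -/
lemma exists_independent_card (H : SimpleGraph V) (A : Finset V) :
    ∃ I ⊆ A, (∀ a ∈ I, ∀ b ∈ I, ¬ H.Adj a b) ∧ #A ^ 2 ≤ #I * (adjCount H A A + #A) := by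
  obtain ⟨I, hI, hind, hsum⟩ := exists_independent_sum_le H A
  refine ⟨I, hI, hind, ?_⟩
  have h1 : (∑ a ∈ A, (1 : ℝ)) ^ 2 ≤
      (∑ a ∈ A, (1 / ((#(nbr H a A) : ℝ) + 1))) * ∑ a ∈ A, ((#(nbr H a A) : ℝ) + 1) := by
    refine sum_sq_le_sum_mul_sum_of_sq_le_mul _ (fun a _ => by positivity)
      (fun a _ => by positivity) fun a _ => le_of_eq ?_
    field_simp
  have h2 : ∑ a ∈ A, ((#(nbr H a A) : ℝ) + 1) = adjCount H A A + #A := by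
    simp [adjCount, sum_add_distrib]
  rw [h2] at h1
  have h3 : (#A : ℝ) ^ 2 ≤ #I * (adjCount H A A + #A) := by
    calc (#A : ℝ) ^ 2 = (∑ a ∈ A, (1 : ℝ)) ^ 2 := by simp
      _ ≤ _ := h1
      _ ≤ _ := by gcongr
  exact_mod_cast h3

/-- An ordering of a sparse graph with few later neighbours. -/
lemma exists_degeneracy_order (G : SimpleGraph V) {D : ℕ}
    (hD : ∀ S : Finset V, adjCount G S S ≤ D * #S) (B : Finset V) :
    ∃ f : V → ℕ, Set.InjOn f B ∧ ∀ v ∈ B, #(B.filter fun u => G.Adj v u ∧ f v < f u) ≤ D := by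
  induction B using Finset.strongInduction with
  | H B ih =>
    rcases B.eq_empty_or_nonempty with rfl | hB
    · exact ⟨fun _ => 0, by simp, by simp⟩
    obtain ⟨v, hv, hdeg⟩ : ∃ v ∈ B, #(nbr G v B) ≤ D := by
      refine exists_le_of_sum_le hB ?_
      rw [sum_const, smul_eq_mul, mul_comm]
      exact hD B
    obtain ⟨f, hf, hf'⟩ := ih (B.erase v) (erase_ssubset hv)
    refine ⟨fun u => if u = v then 0 else f u + 1, ?_, ?_⟩
    · intro a ha b hb h
      by_cases hav : a = v <;> by_cases hbv : b = v
      · rw [hav, hbv]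
      · simp [hav, hbv] at h
      · simp [hav, hbv] at h
      · simp only [hav, hbv, if_false, add_left_inj] at h
        exact hf (by simp [hav]; exact ha) (by simp [hbv]; exact hb) h
    · intro u hu
      by_cases huv : u = v
      · subst huv
        refine le_trans (card_le_card ?_) hdeg
        intro w hw
        rw [mem_filter] at hw
        exact mem_nbr.mpr ⟨hw.1, hw.2.1⟩
      · refine le_trans (card_le_card ?_) (hf' u (mem_erase.mpr ⟨huv, hu⟩))
        intro w hw
        rw [mem_filter] at hw ⊢
        by_cases hwv : w = v
        · simp [hwv] at hw
        · simp only [huv, hwv, if_false, add_lt_add_iff_right] at hw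
          exact ⟨mem_erase.mpr ⟨hwv, hw.1⟩, hw.2⟩

end Turan

section Sampling

variable {V : Type*}

/-- The probability that the random subset of `W` with marginals `p` equals `S`. -/
def sampleWeight (W : Finset V) (p : V → ℝ) (S : Finset V) : ℝ :=
  (∏ v ∈ S, p v) * ∏ v ∈ W \ S, (1 - p v)

lemma sampleWeight_nonneg {W : Finset V} {p : V → ℝ} (h0 : ∀ v ∈ W, 0 ≤ p v)
    (h1 : ∀ v ∈ W, p v ≤ 1) {S : Finset V} (hS : S ⊆ W) : 0 ≤ sampleWeight W p S :=
  mul_nonneg (prod_nonneg fun v hv => h0 v (hS hv))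
    (prod_nonneg fun v hv => sub_nonneg.mpr (h1 v (mem_sdiff.mp hv).1))

lemma sum_sampleWeight_superset {W T : Finset V} (p : V → ℝ) (hT : T ⊆ W) :
    ∑ S ∈ W.powerset, sampleWeight W p S * (if T ⊆ S then 1 else 0) = ∏ v ∈ T, p v := by
  have h := prod_add p (fun v => if v ∈ T then 0 else 1 - p v) W
  have h1 : ∏ v ∈ W, (p v + if v ∈ T then 0 else 1 - p v) = ∏ v ∈ T, p v := by
    rw [← prod_sdiff hT]
    rw [prod_eq_one fun v hv => by rw [if_neg (mem_sdiff.mp hv).2]; ring, one_mul]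
    exact prod_congr rfl fun v hv => by rw [if_pos hv, add_zero]
  rw [← h1, h]
  refine sum_congr rfl fun S hS => ?_
  rw [mem_powerset] at hS
  by_cases hTS : T ⊆ S
  · rw [if_pos hTS, mul_one, sampleWeight]
    congr 1
    refine prod_congr rfl fun v hv => ?_
    rw [if_neg fun h => (mem_sdiff.mp hv).2 (hTS h)]
  · rw [if_neg hTS, mul_zero]
    obtain ⟨v, hv, hvS⟩ := not_subset.mp hTS
    rw [prod_eq_zero (i := v) (mem_sdiff.mpr ⟨hT hv, hvS⟩) (by simp [hv]), mul_zero]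

lemma sum_sampleWeight (W : Finset V) (p : V → ℝ) :
    ∑ S ∈ W.powerset, sampleWeight W p S = 1 := by
  simpa using sum_sampleWeight_superset p (empty_subset W)

/-- Expected number of members of a family of sets contained in the random set. -/
lemma sum_sampleWeight_card {ι : Type*} {W : Finset V} (p : V → ℝ) (I : Finset ι)
    (T : ι → Finset V) (hT : ∀ i ∈ I, T i ⊆ W) :
    ∑ S ∈ W.powerset, sampleWeight W p S * (#(I.filter fun i => T i ⊆ S) : ℝ) =
      ∑ i ∈ I, ∏ v ∈ T i, p v := by
  have : ∀ S, (#(I.filter fun i => T i ⊆ S) : ℝ) = ∑ i ∈ I, if T i ⊆ S then (1 : ℝ) else 0 := by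
    intro S; simp
  simp only [this, mul_sum]
  rw [sum_comm]
  exact sum_congr rfl fun i hi => sum_sampleWeight_superset p (hT i hi)

/-- The first moment method. -/
lemma exists_pos_of_expect_pos {W : Finset V} {p : V → ℝ} (h0 : ∀ v ∈ W, 0 ≤ p v)
    (h1 : ∀ v ∈ W, p v ≤ 1) (F : Finset V → ℝ)
    (hF : 0 < ∑ S ∈ W.powerset, sampleWeight W p S * F S) : ∃ S ⊆ W, 0 < F S := by
  by_contra! h
  refine hF.not_ge (sum_nonpos fun S hS => ?_)
  rw [mem_powerset] at hS
  exact mul_nonpos_of_nonneg_of_nonpos (sampleWeight_nonneg h0 h1 hS) (h S hS)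

/-- Four vertices forming a cycle of length four. -/
def IsC4 (G : SimpleGraph V) (a b c d : V) : Prop :=
  a ≠ c ∧ b ≠ d ∧ G.Adj a b ∧ G.Adj b c ∧ G.Adj c d ∧ G.Adj d a

/-- Deleting all vertices on 4-cycles of `S`. -/
lemma hasSparseInduced_of_few_cycles {G : SimpleGraph V} {k : ℕ} (S : Finset V)
    (h : k * #S + 2 * ∑ v ∈ S.filter (fun a => ∃ b ∈ S, ∃ c ∈ S, ∃ d ∈ S, IsC4 G a b c d),
      #(nbr G v S) < adjCount G S S) : HasSparseInduced G k := by
  set R := S.filter (fun a => ∃ b ∈ S, ∃ c ∈ S, ∃ d ∈ S, IsC4 G a b c d) with hR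
  have hRS : R ⊆ S := filter_subset _ _
  have h1 : adjCount G S S ≤ adjCount G (S \ R) (S \ R) + 2 * ∑ v ∈ R, #(nbr G v S) := by
    have e1 : adjCount G S S = adjCount G (S \ R) S + adjCount G R S := (sum_sdiff hRS).symm
    have e2 : adjCount G (S \ R) S ≤ adjCount G (S \ R) (S \ R) + adjCount G S R := by
      rw [adjCount_comm (S \ R) S, adjCount_comm S R, ]
      have : adjCount G S (S \ R) = adjCount G (S \ R) (S \ R) + adjCount G R (S \ R) :=
        (sum_sdiff hRS).symm
      have := adjCount_mono (G := G) (subset_refl R) (sdiff_subset (s := S) (t := R))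
      omega
    rw [adjCount_comm S R] at e2
    have e3 : adjCount G R S = ∑ v ∈ R, #(nbr G v S) := rfl
    omega
  refine ⟨S \ R, ?_, ?_, ?_⟩
  · rw [nonempty_iff_ne_empty]
    intro h0
    have : adjCount G (S \ R) (S \ R) = 0 := by rw [h0]; rfl
    omega
  · intro a ha b hb c hc d hd hac hbd h1 h2 h3 h4
    rw [mem_sdiff] at ha hb hc hd
    exact ha.2 (mem_filter.mpr ⟨ha.1, b, hb.1, c, hc.1, d, hd.1, hac, hbd, h1, h2, h3, h4⟩)
  · have : k * #(S \ R) ≤ k * #S := Nat.mul_le_mul_left _ (card_le_card sdiff_subset)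
    omega

lemma sum_insert_prod_le {N T : Finset V} {p : V → ℝ} {Θ : ℝ} (hN : ∀ v ∈ N, 0 ≤ p v)
    (hT : ∀ v ∈ T, 0 ≤ p v) (hΘ : ∑ w ∈ N, p w ≤ Θ) :
    ∑ w ∈ N, ∏ v ∈ insert w T, p v ≤ (Θ + #T) * ∏ v ∈ T, p v := by
  have hpos : 0 ≤ ∏ v ∈ T, p v := prod_nonneg hT
  have h1 : ∀ w ∈ N, ∏ v ∈ insert w T, p v ≤
      p w * ∏ v ∈ T, p v + if w ∈ T then ∏ v ∈ T, p v else 0 := by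
    intro w hw
    by_cases h : w ∈ T
    · rw [insert_eq_of_mem h, if_pos h]
      have := mul_nonneg (hN w hw) hpos
      linarith
    · rw [prod_insert h, if_neg h, add_zero]
  refine (sum_le_sum h1).trans ?_
  rw [sum_add_distrib, ← sum_mul, add_mul]
  refine add_le_add (mul_le_mul_of_nonneg_right hΘ hpos) ?_
  rw [← sum_filter, sum_const, nsmul_eq_mul]
  refine mul_le_mul_of_nonneg_right ?_ hpos
  have : #(N.filter fun w => w ∈ T) ≤ #T := card_le_card fun w hw => (mem_filter.mp hw).2
  exact_mod_cast this

/-- The set of vertices of a quadruple. -/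
def quadSet (q : V × V × V × V) : Finset V := {q.1, q.2.1, q.2.2.1, q.2.2.2}

lemma sum_cycles_le {G : SimpleGraph V} {W : Finset V} {p : V → ℝ} {ε : ℝ}
    (h0 : ∀ v ∈ W, 0 ≤ p v)
    (hε : ∀ u ∈ W, ∀ v ∈ nbr G u W,
      ∑ x ∈ nbr G u W, ∑ y ∈ nbr G v W, (if G.Adj x y then p x * p y else 0) ≤ ε) :
    ∑ q ∈ (W ×ˢ W ×ˢ W ×ˢ W).filter (fun q => IsC4 G q.1 q.2.1 q.2.2.1 q.2.2.2),
      ∏ v ∈ quadSet q, p v ≤ ε * ∑ u ∈ W, ∑ v ∈ nbr G u W, p u * p v := by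
  have h1 : ∀ q ∈ (W ×ˢ W ×ˢ W ×ˢ W).filter (fun q => IsC4 G q.1 q.2.1 q.2.2.1 q.2.2.2),
      ∏ v ∈ quadSet q, p v = p q.1 * p q.2.1 * (p q.2.2.2 * p q.2.2.1) := by
    rintro ⟨a, b, c, d⟩ hq
    obtain ⟨hac, hbd, h1, h2, h3, h4⟩ := (mem_filter.mp hq).2
    simp only at hac hbd h1 h2 h3 h4
    simp only [quadSet]
    rw [prod_insert (by simp [hac, h1.ne, h4.ne']), prod_insert (by simp [hbd, h2.ne]),
      prod_pair h3.ne]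
    ring
  rw [sum_congr rfl h1, sum_filter]
  simp only [sum_product]
  rw [mul_sum]
  refine sum_le_sum fun a ha => ?_
  rw [mul_sum, nbr, sum_filter]
  refine sum_le_sum fun b hb => ?_
  by_cases hab : G.Adj a b
  · rw [if_pos hab]
    have h2 := hε a ha b (mem_nbr.mpr ⟨hb, hab⟩)
    refine le_trans ?_ (mul_le_mul_of_nonneg_right h2 (mul_nonneg (h0 a ha) (h0 b hb)))
    rw [sum_mul, sum_comm, nbr, sum_filter]
    refine sum_le_sum fun d hd => ?_
    by_cases had : G.Adj a d
    · rw [if_pos had, sum_mul, nbr, sum_filter]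
      refine sum_le_sum fun c hc => ?_
      have hpos := mul_nonneg (mul_nonneg (h0 d hd) (h0 c hc)) (mul_nonneg (h0 a ha) (h0 b hb))
      by_cases hq : IsC4 G a b c d
      · rw [if_pos hq, if_pos hq.2.2.2.1, if_pos hq.2.2.2.2.1.symm]
        exact le_of_eq (by ring)
      · rw [if_neg hq]
        split_ifs <;> simp [hpos]
    · rw [if_neg had]
      refine (sum_eq_zero fun c _ => ?_).le
      rw [if_neg fun hq => had hq.2.2.2.2.2.symm]
  · rw [if_neg hab]
    refine (sum_eq_zero fun c _ => sum_eq_zero fun d _ => ?_).le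
    rw [if_neg fun hq => hab hq.2.2.1]

/-- Random sampling with deletion of 4-cycles. -/
lemma hasSparseInduced_of_sampling {G : SimpleGraph V} {k : ℕ} {W : Finset V} {p : V → ℝ}
    {Θ ε : ℝ} (h0 : ∀ v ∈ W, 0 ≤ p v) (h1 : ∀ v ∈ W, p v ≤ 1)
    (hΘ : ∀ v ∈ W, ∑ u ∈ nbr G v W, p u ≤ Θ) (hΘ0 : 0 ≤ Θ)
    (hε : ∀ u ∈ W, ∀ v ∈ nbr G u W,
      ∑ x ∈ nbr G u W, ∑ y ∈ nbr G v W, (if G.Adj x y then p x * p y else 0) ≤ ε)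
    (hsmall : 8 * (Θ + 4) * ε ≤ 1)
    (hdense : 2 * k * ∑ v ∈ W, p v ≤ ∑ u ∈ W, ∑ v ∈ nbr G u W, p u * p v)
    (hpos : 0 < ∑ u ∈ W, ∑ v ∈ nbr G u W, p u * p v) : HasSparseInduced G k := by
  set E := ∑ u ∈ W, ∑ v ∈ nbr G u W, p u * p v with hE
  set Q := (W ×ˢ W ×ˢ W ×ˢ W).filter (fun q => IsC4 G q.1 q.2.1 q.2.2.1 q.2.2.2) with hQ
  let J := Q.sigma fun q => nbr G q.1 W
  let T : (Σ _ : V × V × V × V, V) → Finset V := fun j => insert j.2 (quadSet j.1)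
  let edges := (W ×ˢ W).filter fun x => G.Adj x.1 x.2
  have hquad : ∀ q ∈ Q, quadSet q ⊆ W := by
    rintro ⟨a, b, c, d⟩ hq
    simp only [hQ, mem_filter, mem_product] at hq
    simp only [quadSet, insert_subset_iff, singleton_subset_iff]
    exact hq.1
  have hT : ∀ j ∈ J, T j ⊆ W := by
    rintro ⟨q, w⟩ hj
    obtain ⟨hq, hw⟩ := mem_sigma.mp hj
    exact insert_subset (nbr_subset _ _ hw) (hquad q hq)
  have hbad : ∑ S ∈ W.powerset, sampleWeight W p S * (#(J.filter fun j => T j ⊆ S) : ℝ) ≤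
      (Θ + 4) * (ε * E) := by
    rw [sum_sampleWeight_card p J T hT, sum_sigma]
    calc _ ≤ ∑ q ∈ Q, (Θ + 4) * ∏ v ∈ quadSet q, p v := by
          refine sum_le_sum fun q hq => ?_
          have hq1 : q.1 ∈ W := (mem_product.mp (mem_filter.mp hq).1).1
          have hnn : ∀ v ∈ quadSet q, 0 ≤ p v := fun v hv => h0 v (hquad q hq hv)
          refine (sum_insert_prod_le (fun v hv => h0 v (nbr_subset _ _ hv)) hnn
            (hΘ q.1 hq1)).trans ?_
          refine mul_le_mul_of_nonneg_right ?_ (prod_nonneg hnn)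
          have : #(quadSet q) ≤ 4 := card_le_four
          have : (#(quadSet q) : ℝ) ≤ 4 := by exact_mod_cast this
          linarith
      _ = (Θ + 4) * ∑ q ∈ Q, ∏ v ∈ quadSet q, p v := by rw [mul_sum]
      _ ≤ _ := mul_le_mul_of_nonneg_left (sum_cycles_le h0 hε) (by linarith)
  have hedge : ∑ S ∈ W.powerset, sampleWeight W p S *
      (#(edges.filter fun e => ({e.1, e.2} : Finset V) ⊆ S) : ℝ) = E := by
    rw [sum_sampleWeight_card p edges (fun e => {e.1, e.2})]
    · rw [sum_filter, sum_product, hE]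
      refine sum_congr rfl fun u _ => ?_
      rw [nbr, sum_filter]
      refine sum_congr rfl fun v _ => ?_
      by_cases h : G.Adj u v
      · simp only [h, if_true, prod_pair h.ne]
      · simp only [h, if_false]
    · intro e he
      have := mem_product.mp (mem_filter.mp he).1
      simp only [insert_subset_iff, singleton_subset_iff]
      exact this
  have hvert : ∑ S ∈ W.powerset, sampleWeight W p S *
      (#(W.filter fun v => ({v} : Finset V) ⊆ S) : ℝ) = ∑ v ∈ W, p v := by
    rw [sum_sampleWeight_card p W (fun v => {v}) (by simp)]
    simp
  obtain ⟨S, hSW, hS⟩ := exists_pos_of_expect_pos h0 h1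
    (fun S => (#(edges.filter fun e => ({e.1, e.2} : Finset V) ⊆ S) : ℝ) -
      k * (#(W.filter fun v => ({v} : Finset V) ⊆ S) : ℝ) -
      2 * (#(J.filter fun j => T j ⊆ S) : ℝ)) (by
    have : ∑ S ∈ W.powerset, sampleWeight W p S *
        ((#(edges.filter fun e => ({e.1, e.2} : Finset V) ⊆ S) : ℝ) -
        k * (#(W.filter fun v => ({v} : Finset V) ⊆ S) : ℝ) -
        2 * (#(J.filter fun j => T j ⊆ S) : ℝ)) = E - k * ∑ v ∈ W, p v -
        2 * ∑ S ∈ W.powerset, sampleWeight W p S * (#(J.filter fun j => T j ⊆ S) : ℝ) := by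
      rw [← hedge, ← hvert, mul_sum, mul_sum, ← sum_sub_distrib, ← sum_sub_distrib]
      exact sum_congr rfl fun S _ => by ring
    rw [this]
    have e1 : 8 * (Θ + 4) * ε * E ≤ 1 * E := mul_le_mul_of_nonneg_right hsmall hpos.le
    linarith)
  have hc1 : #(edges.filter fun e => ({e.1, e.2} : Finset V) ⊆ S) = adjCount G S S := by
    rw [adjCount_eq_card]
    congr 1
    ext ⟨u, v⟩
    simp only [edges, mem_filter, mem_product, insert_subset_iff, singleton_subset_iff]
    constructor
    · tauto
    · rintro ⟨⟨hu, hv⟩, h⟩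
      exact ⟨⟨⟨hSW hu, hSW hv⟩, h⟩, hu, hv⟩
  have hc2 : W.filter (fun v => ({v} : Finset V) ⊆ S) = S := by
    ext v
    simp only [mem_filter, singleton_subset_iff]
    exact ⟨fun h => h.2, fun h => ⟨hSW h, h⟩⟩
  have hc3 : ∑ v ∈ S.filter (fun a => ∃ b ∈ S, ∃ c ∈ S, ∃ d ∈ S, IsC4 G a b c d),
      #(nbr G v S) ≤ #(J.filter fun j => T j ⊆ S) := by
    rw [← card_sigma]
    refine card_le_card_of_surjOn (fun j => ⟨j.1.1, j.2⟩) ?_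
    rintro ⟨a, w⟩ h
    simp only [mem_coe, mem_sigma, mem_filter, mem_nbr] at h
    obtain ⟨⟨ha, b, hb, c, hc, d, hd, hq⟩, hw, haw⟩ := h
    refine ⟨⟨(a, b, c, d), w⟩, ?_, rfl⟩
    simp only [J, T, hQ, quadSet, mem_coe, mem_sigma, mem_filter, mem_product, mem_nbr,
      insert_subset_iff, singleton_subset_iff]
    exact ⟨⟨⟨⟨hSW ha, hSW hb, hSW hc, hSW hd⟩, hq⟩, hSW hw, haw⟩, hw, ha, hb, hc, hd⟩
  refine hasSparseInduced_of_few_cycles S ?_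
  rw [hc1, hc2] at hS
  have : (k * #S + 2 * #(J.filter fun j => T j ⊆ S) : ℝ) < adjCount G S S := by linarith
  have : k * #S + 2 * #(J.filter fun j => T j ⊆ S) < adjCount G S S := by exact_mod_cast this
  omega

end Sampling

section Balanced

variable {V : Type*} {G : SimpleGraph V} {k : ℕ}

/-- Vertices of large internal degree carry few edges. -/
lemma adjCount_high_le {X Y : Finset V} {D Δ Λ : ℝ} (hD : 0 < D) (hΛ : 0 < Λ) (hΔ : 0 ≤ Δ)
    (hsp : (adjCount G X X : ℝ) ≤ D * #X) (hdeg : ∀ x ∈ X, (#(nbr G x Y) : ℝ) ≤ Δ)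
    (hX : #X * Δ ≤ Λ * adjCount G X Y) :
    (adjCount G (X.filter fun x => 4 * Λ * D < #(nbr G x X)) Y : ℝ) ≤ adjCount G X Y / 4 := by
  set Z := X.filter fun x => 4 * Λ * D < #(nbr G x X) with hZ
  have h1 : #Z * (4 * Λ * D) ≤ (adjCount G X X : ℝ) := by
    calc (#Z : ℝ) * (4 * Λ * D) = ∑ x ∈ Z, 4 * Λ * D := by rw [sum_const, nsmul_eq_mul]
      _ ≤ ∑ x ∈ Z, (#(nbr G x X) : ℝ) := sum_le_sum fun x hx => (mem_filter.mp hx).2.le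
      _ ≤ ∑ x ∈ X, (#(nbr G x X) : ℝ) :=
        sum_le_sum_of_subset_of_nonneg (filter_subset _ _) fun _ _ _ => by positivity
      _ = _ := by simp [adjCount]
  have h2 : (#Z : ℝ) * (4 * Λ) ≤ #X := by
    have : (#Z * (4 * Λ)) * D ≤ #X * D := by linarith
    exact le_of_mul_le_mul_right this hD
  have h3 : (adjCount G Z Y : ℝ) ≤ #Z * Δ := by
    calc (adjCount G Z Y : ℝ) = ∑ x ∈ Z, (#(nbr G x Y) : ℝ) := by simp [adjCount]
      _ ≤ ∑ x ∈ Z, Δ := sum_le_sum fun x hx => hdeg x (mem_filter.mp hx).1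
      _ = _ := by rw [sum_const, nsmul_eq_mul]
  have h4 : (4 * Λ) * (#Z * Δ) ≤ (4 * Λ) * (adjCount G X Y / 4) := by
    calc (4 * Λ) * (#Z * Δ) = #Z * (4 * Λ) * Δ := by ring
      _ ≤ #X * Δ := mul_le_mul_of_nonneg_right h2 hΔ
      _ ≤ _ := by linarith
  exact h3.trans (le_of_mul_le_mul_left h4 (by positivity))

lemma sum_union_le_add {A B : Finset V} {f : V → ℝ} (h : ∀ v ∈ A ∪ B, 0 ≤ f v) :
    ∑ v ∈ A ∪ B, f v ≤ ∑ v ∈ A, f v + ∑ v ∈ B, f v := by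
  rw [← sum_union_inter]
  have : 0 ≤ ∑ v ∈ A ∩ B, f v :=
    sum_nonneg fun v hv => h v (mem_union_left _ (mem_inter.mp hv).1)
  linarith

lemma nbr_union (v : V) (A B : Finset V) : nbr G v (A ∪ B) = nbr G v A ∪ nbr G v B :=
  filter_union _ _ _

lemma sum_sum_adj_const {A B : Finset V} {p : V → ℝ} {c c' : ℝ} (hA : ∀ v ∈ A, p v = c)
    (hB : ∀ v ∈ B, p v = c') :
    ∑ x ∈ A, ∑ y ∈ B, (if G.Adj x y then p x * p y else 0) = c * c' * adjCount G A B := by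
  have : ∀ x ∈ A, ∑ y ∈ B, (if G.Adj x y then p x * p y else 0) = c * c' * #(nbr G x B) := by
    intro x hx
    rw [← sum_filter, ← nbr]
    rw [sum_congr rfl fun y hy => by rw [hA x hx, hB y (nbr_subset _ _ hy)]]
    rw [sum_const, nsmul_eq_mul]
    ring
  rw [sum_congr rfl this, ← mul_sum]
  simp [adjCount]

lemma weighted_adjCount_le {α Θ pm : ℝ} {m : ℕ} (hα : 0 ≤ α) (hΘ : 0 ≤ Θ) (hpm : 0 ≤ pm)
    (hLS : ∀ A B : Finset V, m ≤ #A → m ≤ #B → (adjCount G A B : ℝ) ≤ α * #A * #B)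
    {A B : Finset V} {c c' : ℝ} (hc : 0 ≤ c) (hc' : 0 ≤ c') (hcm : c ≤ pm) (hcm' : c' ≤ pm)
    (hA : #A * c ≤ Θ) (hB : #B * c' ≤ Θ) :
    c * c' * adjCount G A B ≤ α * Θ ^ 2 + pm * m * Θ := by
  have htriv : (adjCount G A B : ℝ) ≤ #A * #B := by
    have : adjCount G A B ≤ #A * #B := by
      rw [adjCount_eq_card, ← card_product]
      exact card_filter_le _ _
    exact_mod_cast this
  have hpos1 : 0 ≤ α * Θ ^ 2 := by positivity
  have hpos2 : 0 ≤ pm * m * Θ := by positivity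
  by_cases h1 : m ≤ #A
  · by_cases h2 : m ≤ #B
    · have : c * c' * adjCount G A B ≤ α * Θ ^ 2 := by
        calc c * c' * adjCount G A B ≤ c * c' * (α * #A * #B) := by
              gcongr; exact hLS A B h1 h2
          _ = α * ((#A * c) * (#B * c')) := by ring
          _ ≤ α * (Θ * Θ) := by gcongr
          _ = _ := by ring
      linarith
    · have h2' : (#B : ℝ) ≤ m := by exact_mod_cast (not_le.mp h2).le
      have : c * c' * adjCount G A B ≤ pm * m * Θ := by
        calc c * c' * adjCount G A B ≤ c * c' * (#A * #B) := by gcongr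
          _ = c' * #B * (#A * c) := by ring
          _ ≤ pm * m * Θ := by gcongr
      linarith
  · have h1' : (#A : ℝ) ≤ m := by exact_mod_cast (not_le.mp h1).le
    have : c * c' * adjCount G A B ≤ pm * m * Θ := by
      calc c * c' * adjCount G A B ≤ c * c' * (#A * #B) := by gcongr
        _ = c * #A * (#B * c') := by ring
        _ ≤ pm * m * Θ := by gcongr
    linarith

/-- The balanced case: two vertex classes of controlled degrees spanning many edges. -/
lemma hasSparseInduced_of_balanced {X Y : Finset V} {D Λ κ ΔX ΔY α Θ : ℝ} {m : ℕ} {p : V → ℝ}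
    (hD : 0 < D) (hΛ : 1 ≤ Λ) (hκ : 0 < κ) (hΔX : 0 < ΔX) (hΔY : 0 < ΔY) (hα : 0 ≤ α)
    (hk : 0 < k) (hΘ : Θ = (1 + 4 * Λ * κ) * (8 * k * Λ))
    (hsp : ∀ S : Finset V, (adjCount G S S : ℝ) ≤ D * #S)
    (hLS : ∀ A B : Finset V, m ≤ #A → m ≤ #B → (adjCount G A B : ℝ) ≤ α * #A * #B)
    (hdegX : ∀ x ∈ X, ∀ Z : Finset V, (#(nbr G x Z) : ℝ) ≤ ΔX)
    (hdegY : ∀ y ∈ Y, ∀ Z : Finset V, (#(nbr G y Z) : ℝ) ≤ ΔY)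
    (hX : #X * ΔX ≤ Λ * adjCount G X Y) (hY : #Y * ΔY ≤ Λ * adjCount G X Y)
    (he : 0 < adjCount G X Y) (hκX : D ≤ κ * ΔX) (hκY : D ≤ κ * ΔY)
    (hpX : ∀ x ∈ X, p x = 8 * k * Λ / ΔY) (hpY : ∀ y ∈ Y, p y = 8 * k * Λ / ΔX)
    (hpm : 8 * k * Λ * κ / D ≤ 1)
    (hsmall : 8 * (Θ + 4) * (4 * (α * Θ ^ 2 + 8 * k * Λ * κ / D * m * Θ)) ≤ 1) :
    HasSparseInduced G k := by
  have hk' : (0 : ℝ) < k := by exact_mod_cast hk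
  have hΛ0 : 0 < Λ := by linarith
  set lam : ℝ := 8 * k * Λ with hlam
  have hlam0 : 0 < lam := by positivity
  set X' := X.filter fun x => ¬ 4 * Λ * D < #(nbr G x X) with hX'
  set Y' := Y.filter fun y => ¬ 4 * Λ * D < #(nbr G y Y) with hY'
  set e : ℝ := (adjCount G X Y : ℝ) with he'
  have he0 : 0 < e := by rw [he']; exact_mod_cast he
  have hX'X : X' ⊆ X := filter_subset _ _
  have hY'Y : Y' ⊆ Y := filter_subset _ _
  have hmain : e / 2 ≤ adjCount G X' Y' := by
    have h1 := adjCount_high_le (Y := Y) hD hΛ0 hΔX.le (hsp X) (fun x hx => hdegX x hx Y) hX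
    have h2 := adjCount_high_le (Y := X) hD hΛ0 hΔY.le (hsp Y) (fun y hy => hdegY y hy X)
      (by rw [adjCount_comm Y X]; exact hY)
    rw [adjCount_comm Y X] at h2
    have h3 : adjCount G X Y = adjCount G (X.filter fun x => 4 * Λ * D < #(nbr G x X)) Y +
        adjCount G X' Y := (sum_filter_add_sum_filter_not _ _ _).symm
    have h4 : adjCount G Y X' = adjCount G (Y.filter fun y => 4 * Λ * D < #(nbr G y Y)) X' +
        adjCount G Y' X' := (sum_filter_add_sum_filter_not _ _ _).symm
    have h5 := adjCount_mono (G := G)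
      (subset_refl (Y.filter fun y => 4 * Λ * D < #(nbr G y Y))) hX'X
    rw [adjCount_comm Y X', adjCount_comm Y' X'] at h4
    have h3' : e = (adjCount G (X.filter fun x => 4 * Λ * D < #(nbr G x X)) Y : ℝ) +
        adjCount G X' Y := by rw [he']; exact_mod_cast h3
    have h4' : (adjCount G X' Y : ℝ) ≤ adjCount G (Y.filter fun y => 4 * Λ * D < #(nbr G y Y)) X +
        adjCount G X' Y' := by
      have : adjCount G X' Y ≤ adjCount G (Y.filter fun y => 4 * Λ * D < #(nbr G y Y)) X +
        adjCount G X' Y' := by omega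
      exact_mod_cast this
    linarith
  have hcX : lam / ΔY ≤ lam * κ / D := by
    rw [div_le_div_iff₀ hΔY hD]
    nlinarith
  have hcY : lam / ΔX ≤ lam * κ / D := by
    rw [div_le_div_iff₀ hΔX hD]
    nlinarith
  have hp0 : ∀ v ∈ X' ∪ Y', 0 ≤ p v := by
    intro v hv
    rcases mem_union.mp hv with h | h
    · rw [hpX v (hX'X h)]; positivity
    · rw [hpY v (hY'Y h)]; positivity
  have hΘlam : lam + 4 * Λ * κ * lam = Θ := by rw [hΘ]; ring
  have hinX : 4 * Λ * D * (lam / ΔY) ≤ 4 * Λ * κ * lam := by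
    rw [mul_div_assoc', div_le_iff₀ hΔY]
    calc 4 * Λ * D * lam ≤ 4 * Λ * (κ * ΔY) * lam := by gcongr
      _ = _ := by ring
  have hinY : 4 * Λ * D * (lam / ΔX) ≤ 4 * Λ * κ * lam := by
    rw [mul_div_assoc', div_le_iff₀ hΔX]
    calc 4 * Λ * D * lam ≤ 4 * Λ * (κ * ΔX) * lam := by gcongr
      _ = _ := by ring
  have hlamΘ : lam ≤ Θ := by
    have : 0 ≤ 4 * Λ * κ * lam := by positivity
    linarith
  have hwX : ∀ v ∈ X' ∪ Y', #(nbr G v X') * (lam / ΔY) + #(nbr G v Y') * (lam / ΔX) ≤ Θ := by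
    intro v hv
    rcases mem_union.mp hv with h | h
    · have h1 : (#(nbr G v X') : ℝ) ≤ 4 * Λ * D :=
        le_trans (by exact_mod_cast card_le_card (nbr_mono v hX'X)) (not_lt.mp (mem_filter.mp h).2)
      have h2 := hdegX v (hX'X h) Y'
      have h3 : (#(nbr G v X') : ℝ) * (lam / ΔY) ≤ 4 * Λ * D * (lam / ΔY) := by gcongr
      have h4 : (#(nbr G v Y') : ℝ) * (lam / ΔX) ≤ ΔX * (lam / ΔX) := by gcongr
      rw [mul_div_cancel₀ _ hΔX.ne'] at h4
      linarith
    · have h1 : (#(nbr G v Y') : ℝ) ≤ 4 * Λ * D :=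
        le_trans (by exact_mod_cast card_le_card (nbr_mono v hY'Y)) (not_lt.mp (mem_filter.mp h).2)
      have h2 := hdegY v (hY'Y h) X'
      have h3 : (#(nbr G v Y') : ℝ) * (lam / ΔX) ≤ 4 * Λ * D * (lam / ΔX) := by gcongr
      have h4 : (#(nbr G v X') : ℝ) * (lam / ΔY) ≤ ΔY * (lam / ΔY) := by gcongr
      rw [mul_div_cancel₀ _ hΔY.ne'] at h4
      linarith
  have hwX1 : ∀ v ∈ X' ∪ Y', #(nbr G v X') * (lam / ΔY) ≤ Θ := fun v hv => by
    have : 0 ≤ (#(nbr G v Y') : ℝ) * (lam / ΔX) := by positivity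
    linarith [hwX v hv]
  have hwY1 : ∀ v ∈ X' ∪ Y', #(nbr G v Y') * (lam / ΔX) ≤ Θ := fun v hv => by
    have : 0 ≤ (#(nbr G v X') : ℝ) * (lam / ΔY) := by positivity
    linarith [hwX v hv]
  have hpX' : ∀ v, ∀ x ∈ nbr G v X', p x = lam / ΔY := fun v x hx => hpX x (hX'X (nbr_subset _ _ hx))
  have hpY' : ∀ v, ∀ x ∈ nbr G v Y', p x = lam / ΔX := fun v x hx => hpY x (hY'Y (nbr_subset _ _ hx))
  have hE : e / 2 * (lam / ΔY * (lam / ΔX)) ≤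
      ∑ u ∈ X' ∪ Y', ∑ v ∈ nbr G u (X' ∪ Y'), p u * p v := by
    calc e / 2 * (lam / ΔY * (lam / ΔX)) ≤ adjCount G X' Y' * (lam / ΔY * (lam / ΔX)) := by gcongr
      _ = ∑ u ∈ X', ∑ v ∈ nbr G u Y', p u * p v := by
        rw [adjCount]
        push_cast
        rw [sum_mul]
        refine sum_congr rfl fun u hu => ?_
        rw [sum_congr rfl fun v hv => by rw [hpX u (hX'X hu), hpY' u v hv]]
        rw [sum_const, nsmul_eq_mul]
      _ ≤ ∑ u ∈ X', ∑ v ∈ nbr G u (X' ∪ Y'), p u * p v := by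
        refine sum_le_sum fun u hu => sum_le_sum_of_subset_of_nonneg
          (nbr_mono u subset_union_right) fun v hv _ => mul_nonneg (hp0 u (mem_union_left _ hu))
            (hp0 v (nbr_subset _ _ hv))
      _ ≤ _ := sum_le_sum_of_subset_of_nonneg subset_union_left fun u hu _ =>
          sum_nonneg fun v hv => mul_nonneg (hp0 u hu) (hp0 v (nbr_subset _ _ hv))
  refine hasSparseInduced_of_sampling (W := X' ∪ Y') (p := p) (Θ := Θ)
    (ε := 4 * (α * Θ ^ 2 + lam * κ / D * m * Θ)) hp0 ?_ ?_ ?_ ?_ hsmall ?_ ?_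
  · intro v hv
    rcases mem_union.mp hv with h | h
    · rw [hpX v (hX'X h)]; linarith
    · rw [hpY v (hY'Y h)]; linarith
  · intro v hv
    rw [nbr_union]
    refine (sum_union_le_add fun u hu => ?_).trans ?_
    · rw [← nbr_union] at hu
      exact hp0 u (nbr_subset _ _ hu)
    · rw [sum_congr rfl (hpX' v), sum_congr rfl (hpY' v)]
      simpa using hwX v hv
  · linarith
  · intro u hu v hv
    have hv' := nbr_subset _ _ hv
    have hterm : ∀ x ∈ X' ∪ Y', ∀ y ∈ X' ∪ Y', 0 ≤ if G.Adj x y then p x * p y else 0 := by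
      intro x hx y hy
      split_ifs
      · exact mul_nonneg (hp0 x hx) (hp0 y hy)
      · exact le_rfl
    have hinner : ∀ A ⊆ X' ∪ Y',
        ∑ x ∈ A, ∑ y ∈ nbr G v (X' ∪ Y'), (if G.Adj x y then p x * p y else 0) ≤
        ∑ x ∈ A, ∑ y ∈ nbr G v X', (if G.Adj x y then p x * p y else 0) +
        ∑ x ∈ A, ∑ y ∈ nbr G v Y', (if G.Adj x y then p x * p y else 0) := by
      intro A hA
      rw [← sum_add_distrib]
      refine sum_le_sum fun x hx => ?_
      rw [nbr_union]
      refine sum_union_le_add fun y hy => hterm x (hA hx) y ?_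
      rw [← nbr_union] at hy
      exact nbr_subset _ _ hy
    have houter : ∑ x ∈ nbr G u (X' ∪ Y'), ∑ y ∈ nbr G v (X' ∪ Y'),
          (if G.Adj x y then p x * p y else 0) ≤
        ∑ x ∈ nbr G u X', ∑ y ∈ nbr G v (X' ∪ Y'), (if G.Adj x y then p x * p y else 0) +
        ∑ x ∈ nbr G u Y', ∑ y ∈ nbr G v (X' ∪ Y'), (if G.Adj x y then p x * p y else 0) := by
      rw [nbr_union u]
      refine sum_union_le_add fun x hx => sum_nonneg fun y hy => hterm x ?_ y (nbr_subset _ _ hy)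
      rw [← nbr_union] at hx
      exact nbr_subset _ _ hx
    have i1 := hinner (nbr G u X') ((nbr_subset _ _).trans subset_union_left)
    have i2 := hinner (nbr G u Y') ((nbr_subset _ _).trans subset_union_right)
    rw [sum_sum_adj_const (hpX' u) (hpX' v), sum_sum_adj_const (hpX' u) (hpY' v)] at i1
    rw [sum_sum_adj_const (hpY' u) (hpX' v), sum_sum_adj_const (hpY' u) (hpY' v)] at i2
    have hΘ0 : 0 ≤ Θ := by linarith
    have hpm0 : 0 ≤ lam * κ / D := by positivity
    have hcX0 : 0 ≤ lam / ΔY := by positivity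
    have hcY0 : 0 ≤ lam / ΔX := by positivity
    have j1 := weighted_adjCount_le hα hΘ0 hpm0 hLS hcX0 hcX0 hcX hcX (hwX1 u hu) (hwX1 v hv')
    have j2 := weighted_adjCount_le hα hΘ0 hpm0 hLS hcX0 hcY0 hcX hcY (hwX1 u hu) (hwY1 v hv')
    have j3 := weighted_adjCount_le hα hΘ0 hpm0 hLS hcY0 hcX0 hcY hcX (hwY1 u hu) (hwX1 v hv')
    have j4 := weighted_adjCount_le hα hΘ0 hpm0 hLS hcY0 hcY0 hcY hcY (hwY1 u hu) (hwY1 v hv')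
    linarith
  · refine le_trans ?_ hE
    have h1 : ∑ v ∈ X' ∪ Y', p v ≤ #X * (lam / ΔY) + #Y * (lam / ΔX) := by
      refine (sum_union_le_add hp0).trans (add_le_add ?_ ?_)
      · rw [sum_congr rfl fun v hv => hpX v (hX'X hv), sum_const, nsmul_eq_mul]
        have : (#X' : ℝ) ≤ #X := by exact_mod_cast card_le_card hX'X
        gcongr
      · rw [sum_congr rfl fun v hv => hpY v (hY'Y hv), sum_const, nsmul_eq_mul]
        have : (#Y' : ℝ) ≤ #Y := by exact_mod_cast card_le_card hY'Y
        gcongr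
    have h2 : #X * (lam / ΔY) + #Y * (lam / ΔX) ≤ 2 * Λ * e * (lam / (ΔX * ΔY)) := by
      have e1 : (#X : ℝ) * (lam / ΔY) = #X * ΔX * (lam / (ΔX * ΔY)) := by field_simp
      have e2 : (#Y : ℝ) * (lam / ΔX) = #Y * ΔY * (lam / (ΔX * ΔY)) := by field_simp
      have e3 : 0 ≤ lam / (ΔX * ΔY) := by positivity
      rw [e1, e2]
      have := mul_le_mul_of_nonneg_right hX e3
      have := mul_le_mul_of_nonneg_right hY e3
      linarith
    calc 2 * (k : ℝ) * ∑ v ∈ X' ∪ Y', p v ≤ 2 * k * (2 * Λ * e * (lam / (ΔX * ΔY))) := by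
          gcongr; linarith
      _ = e / 2 * (8 * k * Λ) * (lam / (ΔX * ΔY)) := by ring
      _ = e / 2 * (lam / ΔY * (lam / ΔX)) := by rw [← hlam]; field_simp
  · exact lt_of_lt_of_le (by positivity) hE

end Balanced

section Levels

variable {V : Type*} [Fintype V] {G : SimpleGraph V} {k s : ℕ}

/-- The vertices whose degree lies in `[s ^ i, s ^ (i + 1))`. -/
def level (G : SimpleGraph V) (s i : ℕ) : Finset V :=
  univ.filter fun v => s ^ i ≤ #(nbr G v univ) ∧ #(nbr G v univ) < s ^ (i + 1)

/-- The vertices of degree less than `Δ`. -/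
def lowDegree (G : SimpleGraph V) (Δ : ℕ) : Finset V :=
  univ.filter fun v => #(nbr G v univ) < Δ

lemma exists_level_of_low (hs : 2 ≤ s) {N : ℕ} {x y : V} (hx : x ∈ lowDegree G (s ^ N))
    (hxy : G.Adj x y) : ∃ i < N, x ∈ level G s i := by
  have hpos : #(nbr G x univ) ≠ 0 :=
    (card_pos.mpr ⟨y, mem_nbr.mpr ⟨mem_univ _, hxy⟩⟩).ne'
  refine ⟨Nat.log s #(nbr G x univ), ?_, ?_⟩
  · exact Nat.log_lt_of_lt_pow hpos (by simpa [lowDegree] using hx)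
  · simp only [level, mem_filter, mem_univ, true_and]
    exact ⟨Nat.pow_log_le_self _ hpos, Nat.lt_pow_succ_log_self hs _⟩

lemma exists_dense_levels (hs : 2 ≤ s) {N : ℕ} (hN : 0 < N) :
    ∃ i j, adjCount G (lowDegree G (s ^ N)) (lowDegree G (s ^ N))
      ≤ N ^ 2 * adjCount G (level G s i) (level G s j) := by
  by_contra! h
  set A := lowDegree G (s ^ N) with hA
  have h1 : adjCount G A A ≤
      ∑ q ∈ range N ×ˢ range N, adjCount G (level G s q.1) (level G s q.2) := by
    rw [adjCount_eq_card]
    simp only [adjCount_eq_card]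
    refine le_trans (card_le_card ?_) card_biUnion_le
    rintro ⟨x, y⟩ hxy
    simp only [mem_filter, mem_product] at hxy
    obtain ⟨i, hi, hxi⟩ := exists_level_of_low hs hxy.1.1 hxy.2
    obtain ⟨j, hj, hyj⟩ := exists_level_of_low hs hxy.1.2 hxy.2.symm
    simp only [mem_biUnion, mem_filter, mem_product, mem_range]
    exact ⟨(i, j), ⟨hi, hj⟩, ⟨hxi, hyj⟩, hxy.2⟩
  have h2 : N ^ 2 * ∑ q ∈ range N ×ˢ range N, adjCount G (level G s q.1) (level G s q.2)
      < ∑ q ∈ range N ×ˢ range N, adjCount G A A := by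
    rw [mul_sum]
    refine sum_lt_sum_of_nonempty ⟨(0, 0), by simp [hN]⟩ fun q _ => h q.1 q.2
  rw [sum_const, card_product, card_range, smul_eq_mul] at h2
  nlinarith [Nat.mul_le_mul_left (N ^ 2) h1]

lemma card_level_mul_le {D i : ℕ} (hsp : ∀ S : Finset V, adjCount G S S ≤ D * #S) :
    #(level G s i) * s ^ i ≤ D * Fintype.card V := by
  calc #(level G s i) * s ^ i ≤ ∑ v ∈ level G s i, #(nbr G v univ) := by
        rw [← smul_eq_mul, ← sum_const]
        exact sum_le_sum fun v hv => (mem_filter.mp hv).2.1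
    _ ≤ adjCount G univ univ := sum_le_sum_of_subset (subset_univ _)
    _ ≤ _ := hsp univ

lemma adjCount_level_le (i : ℕ) (Z : Finset V) :
    adjCount G (level G s i) Z ≤ #(level G s i) * s ^ (i + 1) := by
  rw [← smul_eq_mul, ← sum_const]
  exact sum_le_sum fun v hv =>
    (card_le_card (nbr_mono v (subset_univ _))).trans (mem_filter.mp hv).2.2.le

/-- How large `s` has to be in `hasSparseInduced_of_lowDegree`. -/
def levelConst (k N : ℕ) : ℕ := 128 * (40 * k * (4 * N ^ 2) ^ 3) ^ 3

lemma hasSparseInduced_of_lowDegree {N m D : ℕ} [Nonempty V] (hk : 0 < k) (hN : 0 < N) (hm : 0 < m)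
    (hs : levelConst k N ≤ s) (hsp : ∀ S : Finset V, adjCount G S S ≤ D * #S)
    (hLS : ∀ A B : Finset V, m ≤ #A → m ≤ #B → s ^ 7 * adjCount G A B ≤ #A * #B)
    (hD : s ^ 6 * m ≤ D)
    (hlow : D * Fintype.card V ≤
      4 * adjCount G (lowDegree G (s ^ N)) (lowDegree G (s ^ N))) :
    HasSparseInduced G k := by
  set κ : ℝ := 4 * N ^ 2 with hκ
  set C : ℝ := 40 * k * κ ^ 3 with hC
  have hkr : (1 : ℝ) ≤ k := by exact_mod_cast hk
  have hNr : (1 : ℝ) ≤ N := by exact_mod_cast hN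
  have hκ4 : 4 ≤ κ := by nlinarith
  have hCκ : 8 * k * κ ^ 2 ≤ C := by
    rw [hC]
    have : κ ^ 2 ≤ κ ^ 3 := pow_le_pow_right₀ (by linarith) (by norm_num)
    nlinarith [sq_nonneg κ, mul_le_mul_of_nonneg_left this (by linarith : (0 : ℝ) ≤ k)]
  have hC1 : 1 ≤ C := by nlinarith [one_le_pow₀ (n := 2) (show (1 : ℝ) ≤ κ by linarith)]
  have hsr : 128 * C ^ 3 ≤ (s : ℝ) := by
    have := (Nat.cast_le (α := ℝ)).mpr hs
    simpa [levelConst, hC, hκ] using this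
  have hsC : C ≤ (s : ℝ) := by
    have : C ≤ C ^ 3 := le_self_pow₀ hC1 (by norm_num)
    linarith
  have hs128 : (128 : ℝ) ≤ s := by nlinarith [one_le_pow₀ (n := 3) hC1]
  have hs2 : 2 ≤ s := by
    have : (2 : ℝ) ≤ s := by linarith
    exact_mod_cast this
  have hmr : (1 : ℝ) ≤ m := by exact_mod_cast hm
  have hDr : (s : ℝ) ^ 6 * m ≤ D := by exact_mod_cast hD
  have hDpos : (0 : ℝ) < D := lt_of_lt_of_le (by positivity) hDr
  have hnpos : (0 : ℝ) < Fintype.card V := by exact_mod_cast Fintype.card_pos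
  obtain ⟨i, j, hij⟩ := exists_dense_levels (G := G) hs2 hN
  set e : ℝ := (adjCount G (level G s i) (level G s j) : ℝ) with he
  have hen : (D : ℝ) * Fintype.card V ≤ κ * e := by
    have h1 : ((D * Fintype.card V : ℕ) : ℝ) ≤
        ((4 * (N ^ 2 * adjCount G (level G s i) (level G s j)) : ℕ) : ℝ) := by
      exact_mod_cast hlow.trans (Nat.mul_le_mul_left 4 hij)
    push_cast at h1
    rw [hκ, he]; linarith
  have hepos : 0 < e := by
    have : 0 < κ * e := lt_of_lt_of_le (by positivity) hen
    exact pos_of_mul_pos_right this (by linarith)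
  have hcard : ∀ i, (#(level G s i) : ℝ) * s ^ (i + 1) ≤ κ * s * e := fun i => by
    have h1 : (#(level G s i) : ℝ) * s ^ i ≤ D * Fintype.card V := by
      exact_mod_cast card_level_mul_le (s := s) (i := i) hsp
    calc (#(level G s i) : ℝ) * s ^ (i + 1) = s * (#(level G s i) * s ^ i) := by ring
      _ ≤ s * (κ * e) := mul_le_mul_of_nonneg_left (h1.trans hen) (by positivity)
      _ = _ := by ring
  have hΔ : ∀ i, e ≤ #(level G s i) * (s : ℝ) ^ (i + 1) → (D : ℝ) ≤ κ * s ^ (i + 1) := fun i h => by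
    have h1 : (#(level G s i) : ℝ) ≤ Fintype.card V := by exact_mod_cast card_le_univ _
    have h2 : (D : ℝ) * Fintype.card V ≤ κ * s ^ (i + 1) * Fintype.card V := by
      calc (D : ℝ) * Fintype.card V ≤ κ * e := hen
        _ ≤ κ * (Fintype.card V * s ^ (i + 1)) := by gcongr; exact h.trans (by gcongr)
        _ = _ := by ring
    exact le_of_mul_le_mul_right h2 hnpos
  have hdeg : ∀ i, ∀ x ∈ level G s i, ∀ Z : Finset V, (#(nbr G x Z) : ℝ) ≤ s ^ (i + 1) :=
    fun i x hx Z => by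
      exact_mod_cast (card_le_card (nbr_mono x (subset_univ _))).trans (mem_filter.mp hx).2.2.le
  have hsame : ∀ v, v ∈ level G s i → v ∈ level G s j → i = j := fun v hi hj => by
    simp only [level, mem_filter, mem_univ, true_and] at hi hj
    have h1 := (Nat.pow_lt_pow_iff_right hs2).mp (hi.1.trans_lt hj.2)
    have h2 := (Nat.pow_lt_pow_iff_right hs2).mp (hj.1.trans_lt hi.2)
    omega
  have hΘle : (1 + 4 * (κ * s) * κ) * (8 * k * (κ * s)) ≤ C * s ^ 2 := by
    have : (1 : ℝ) ≤ κ * s * κ := by nlinarith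
    calc (1 + 4 * (κ * s) * κ) * (8 * k * (κ * s)) ≤
        (5 * (κ * s * κ)) * (8 * k * (κ * s)) := by gcongr; linarith
      _ = _ := by rw [hC]; ring
  set Θ : ℝ := (1 + 4 * (κ * s) * κ) * (8 * k * (κ * s)) with hΘ
  have hΘ0 : 0 ≤ Θ := by positivity
  have hpm : 8 * k * (κ * s) * κ / D * m ≤ C / s ^ 5 := by
    rw [div_mul_eq_mul_div, div_le_div_iff₀ hDpos (by positivity)]
    calc 8 * k * (κ * s) * κ * m * (s : ℝ) ^ 5 = 8 * k * κ ^ 2 * (s ^ 6 * m) := by ring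
      _ ≤ C * D := by gcongr
  refine hasSparseInduced_of_balanced (X := level G s i) (Y := level G s j) (D := D) (Λ := κ * s)
    (κ := κ) (ΔX := s ^ (i + 1)) (ΔY := s ^ (j + 1)) (α := 1 / s ^ 7) (m := m)
    (p := fun v => if v ∈ level G s i then 8 * k * (κ * s) / s ^ (j + 1)
      else 8 * k * (κ * s) / s ^ (i + 1)) hDpos (by nlinarith) (by linarith) (by positivity)
    (by positivity) (by positivity) hk hΘ (fun S => by exact_mod_cast hsp S) ?_ (hdeg i) (hdeg j)
    (hcard i) (hcard j) (Nat.cast_pos.mp hepos) (hΔ i ?_) (hΔ j ?_) (fun x hx => if_pos hx) ?_ ?_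
    ?_
  · intro A B hA hB
    have h1 : (s : ℝ) ^ 7 * adjCount G A B ≤ #A * #B := by exact_mod_cast hLS A B hA hB
    rw [mul_assoc, one_div_mul_eq_div, le_div_iff₀ (by positivity)]
    linarith
  · rw [he]; exact_mod_cast adjCount_level_le (s := s) i _
  · rw [he, adjCount_comm]; exact_mod_cast adjCount_level_le (s := s) j _
  · intro y hy
    split_ifs with h
    · rw [hsame y h hy]
    · rfl
  · refine le_trans (le_mul_of_one_le_right (by positivity) hmr) (hpm.trans ?_)
    rw [div_le_one (by positivity)]
    exact hsC.trans (le_self_pow₀ (by linarith) (by norm_num))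
  · have hs0 : (0 : ℝ) < s := by linarith
    have h4 : Θ + 4 ≤ 2 * (C * s ^ 2) := by
      nlinarith [mul_le_mul hC1 hs128 (by norm_num) (by linarith)]
    calc 8 * (Θ + 4) * (4 * (1 / s ^ 7 * Θ ^ 2 + 8 * k * (κ * s) * κ / D * m * Θ))
        ≤ 8 * (2 * (C * s ^ 2)) *
          (4 * (1 / s ^ 7 * (C * s ^ 2) ^ 2 + C / s ^ 5 * (C * s ^ 2))) := by gcongr
      _ = (64 * C ^ 3 + 64 * C ^ 3) / s := by field_simp; ring
      _ ≤ 1 := by rw [div_le_one hs0]; linarith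

end Levels

section Star

variable {V : Type*} {G : SimpleGraph V} {k d : ℕ}

/-- A random subset of `W` contains `R a` and avoids `Q a` for a decent proportion of all `a`. -/
lemma exists_sample {W E : Finset V} {R Q : V → Finset V} {N : ℕ} (hE : E.Nonempty) (hN : 0 < N)
    (hR : ∀ a ∈ E, R a ⊆ W) (hk : ∀ a ∈ E, #(R a) = k) (hQ : ∀ a ∈ E, Q a ⊆ W)
    (hQN : ∀ a ∈ E, #(Q a) ≤ N) (hRQ : ∀ a ∈ E, Disjoint (R a) (Q a)) :
    ∃ S ⊆ W, #E ≤ 4 * (2 * N) ^ k * #(E.filter fun a => R a ⊆ S ∧ Disjoint (Q a) S) := by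
  set p : ℝ := 1 / (2 * N) with hp
  have hNr : (1 : ℝ) ≤ N := by exact_mod_cast hN
  have hp0 : 0 < p := by positivity
  have hp1 : p ≤ 1 := by
    rw [hp, div_le_one (by positivity)]; linarith
  set X : V → Finset V → ℝ := fun a S =>
    (if R a ⊆ S then 1 else 0) - ∑ u ∈ Q a, if insert u (R a) ⊆ S then 1 else 0 with hX
  have hXexp : ∀ a ∈ E, p ^ k / 2 ≤ ∑ S ∈ W.powerset, sampleWeight W (fun _ => p) S * X a S := by
    intro a ha
    simp only [hX, mul_sub, mul_sum, sum_sub_distrib]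
    rw [sum_comm, sum_sampleWeight_superset _ (hR a ha), prod_const, hk a ha]
    have h1 : ∀ u ∈ Q a, ∑ S ∈ W.powerset, sampleWeight W (fun _ => p) S *
        (if insert u (R a) ⊆ S then 1 else 0) = p ^ (k + 1) := fun u hu => by
      rw [sum_sampleWeight_superset _ (insert_subset (hQ a ha hu) (hR a ha)), prod_const,
        card_insert_of_notMem fun h => disjoint_left.mp (hRQ a ha) h hu, hk a ha]
    rw [sum_congr rfl h1, sum_const, nsmul_eq_mul]
    have h2 : (#(Q a) : ℝ) ≤ N := by exact_mod_cast hQN a ha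
    have h3 : (#(Q a) : ℝ) * p ^ (k + 1) ≤ N * p ^ (k + 1) := by gcongr
    have h4 : (N : ℝ) * p ^ (k + 1) = p ^ k / 2 := by
      rw [pow_succ, hp]; field_simp
    linarith
  have hEr : (0 : ℝ) < #E := by exact_mod_cast hE.card_pos
  obtain ⟨S, hS, hpos⟩ := exists_pos_of_expect_pos (W := W) (p := fun _ => p) (fun _ _ => hp0.le)
    (fun _ _ => hp1) (fun S => ∑ a ∈ E, X a S - #E * p ^ k / 4) (by
      simp only [mul_sub, sum_sub_distrib, mul_sum]
      rw [sum_comm, ← sum_mul, sum_sampleWeight, one_mul, sub_pos]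
      have h1 := sum_le_sum hXexp
      rw [sum_const, nsmul_eq_mul] at h1
      have : 0 < (#E : ℝ) * p ^ k := by positivity
      linarith)
  refine ⟨S, hS, ?_⟩
  have h1 : ∑ a ∈ E, X a S ≤ #(E.filter fun a => R a ⊆ S ∧ Disjoint (Q a) S) := by
    rw [card_filter]
    push_cast
    refine sum_le_sum fun a ha => ?_
    have h0 : (0 : ℝ) ≤ ∑ u ∈ Q a, if insert u (R a) ⊆ S then 1 else 0 :=
      sum_nonneg fun u _ => by split_ifs <;> norm_num
    by_cases hRS : R a ⊆ S
    · by_cases hd : Disjoint (Q a) S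
      · simp only [hX, hRS, hd, and_self, if_true]; linarith
      · obtain ⟨u, hu, huS⟩ := not_disjoint_iff.mp hd
        have h5 : (1 : ℝ) ≤ ∑ u ∈ Q a, if insert u (R a) ⊆ S then 1 else 0 := by
          calc (1 : ℝ) = if insert u (R a) ⊆ S then 1 else 0 := by
                rw [if_pos (insert_subset huS hRS)]
            _ ≤ _ := single_le_sum (f := fun u => if insert u (R a) ⊆ S then (1 : ℝ) else 0)
                (fun u _ => by split_ifs <;> norm_num) hu
        simp only [hX, hRS, hd, and_false, if_true, if_false]; linarith
    · simp only [hX, hRS, false_and, if_false]; linarith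
  have h2 : (#E : ℝ) * p ^ k / 4 ≤ #(E.filter fun a => R a ⊆ S ∧ Disjoint (Q a) S) := by linarith
  have h3 : p ^ k * (2 * N) ^ k = 1 := by
    rw [← mul_pow, hp, one_div_mul_cancel (by positivity), one_pow]
  have h4 : (#E : ℝ) ≤ 4 * (2 * N) ^ k * #(E.filter fun a => R a ⊆ S ∧ Disjoint (Q a) S) := by
    calc (#E : ℝ) = 4 * (2 * N) ^ k * (#E * p ^ k / 4) := by
          linear_combination (-(#E : ℝ)) * h3
      _ ≤ _ := by gcongr
  exact_mod_cast h4

/-- Distinct vertices that are adjacent or whose associated sets meet in two points. -/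
def conflictGraph (G : SimpleGraph V) (R : V → Finset V) : SimpleGraph V where
  Adj a a' := a ≠ a' ∧ (G.Adj a a' ∨ 1 < #(R a ∩ R a'))
  symm := ⟨fun a a' h => ⟨h.1.symm, h.2.imp (fun h => h.symm) fun h => by rwa [inter_comm]⟩⟩
  loopless := ⟨fun _ h => h.1 rfl⟩

lemma adjCount_conflictGraph_le {E : Finset V} {R : V → Finset V} {t : ℕ}
    (hsp : ∀ S : Finset V, adjCount G S S ≤ d * #S) (hk : ∀ a ∈ E, #(R a) = k)
    (ht : ∀ a ∈ E, ∀ b ∈ R a, ∀ b' ∈ R a, b ≠ b' →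
      #(E.filter fun a' => b ∈ R a' ∧ b' ∈ R a') ≤ t) {F : Finset V} (hF : F ⊆ E) :
    adjCount (conflictGraph G R) F F ≤ (d + k ^ 2 * t) * #F := by
  have h1 : ∀ a ∈ F, #(nbr (conflictGraph G R) a F) ≤ #(nbr G a F) + k ^ 2 * t := by
    intro a ha
    have h2 : nbr (conflictGraph G R) a F ⊆ nbr G a F ∪
        (R a).offDiag.biUnion fun q => E.filter fun a' => q.1 ∈ R a' ∧ q.2 ∈ R a' := by
      intro a' ha'
      obtain ⟨ha'F, -, h | h⟩ := mem_nbr.mp ha'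
      · exact mem_union_left _ (mem_nbr.mpr ⟨ha'F, h⟩)
      · obtain ⟨b, hb, b', hb', hne⟩ := one_lt_card.mp h
        rw [mem_inter] at hb hb'
        refine mem_union_right _ (mem_biUnion.mpr ⟨(b, b'), mem_offDiag.mpr ⟨hb.1, hb'.1, hne⟩, ?_⟩)
        exact mem_filter.mpr ⟨hF ha'F, hb.2, hb'.2⟩
    refine (card_le_card h2).trans ((card_union_le _ _).trans (Nat.add_le_add_left ?_ _))
    refine (card_biUnion_le_card_mul _ _ t fun q hq => ?_).trans (Nat.mul_le_mul_right _ ?_)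
    · rw [mem_offDiag] at hq
      exact ht a (hF ha) _ hq.1 _ hq.2.1 hq.2.2
    · rw [offDiag_card, hk a (hF ha), sq]; exact Nat.sub_le _ _
  calc adjCount (conflictGraph G R) F F ≤ ∑ a ∈ F, (#(nbr G a F) + k ^ 2 * t) := sum_le_sum h1
    _ = adjCount G F F + #F * (k ^ 2 * t) := by rw [sum_add_distrib, sum_const, smul_eq_mul, adjCount]
    _ ≤ d * #F + #F * (k ^ 2 * t) := Nat.add_le_add_right (hsp F) _
    _ = _ := by ring

lemma hasSparseInduced_of_stars {E B L : Finset V} {R : V → Finset V} {t : ℕ} (hd : 0 < d)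
    (hEB : Disjoint E B) (hE : E.Nonempty) (hL : L ⊆ B)
    (hsp : ∀ S : Finset V, adjCount G S S ≤ d * #S) (hdeg : ∀ a ∈ E, #(nbr G a B) ≤ d)
    (hR : ∀ a ∈ E, R a ⊆ nbr G a L) (hk : ∀ a ∈ E, #(R a) = k)
    (hind : ∀ a ∈ E, ∀ b ∈ R a, ∀ b' ∈ R a, ¬ G.Adj b b')
    (ht : ∀ a ∈ E, ∀ b ∈ R a, ∀ b' ∈ R a, b ≠ b' →
      #(E.filter fun a' => G.Adj a' b ∧ G.Adj a' b') ≤ t)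
    (hcard : #L * (4 * (2 * ((k + 1) * d)) ^ k * (d + k ^ 2 * t + 1)) ≤ #E) :
    HasSparseInduced G k := by
  obtain ⟨f, hfinj, hf⟩ := exists_degeneracy_order G hsp B
  have hRB : ∀ a ∈ E, R a ⊆ nbr G a B := fun a ha => (hR a ha).trans (nbr_mono a hL)
  set Q : V → Finset V := fun a => (nbr G a B \ R a) ∪
    (R a).biUnion fun b => B.filter fun u => G.Adj b u ∧ f b < f u with hQ
  obtain ⟨S, hSB, hS⟩ := exists_sample (W := B) (R := R) (Q := Q) (k := k) (N := (k + 1) * d) hE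
    (by positivity) (fun a ha => (hRB a ha).trans (nbr_subset _ _)) hk
    (fun a _ => union_subset (sdiff_subset.trans (nbr_subset _ _))
      (biUnion_subset.mpr fun b _ => filter_subset _ _)) (fun a ha => by
        refine (card_union_le _ _).trans ?_
        have h1 : #(nbr G a B \ R a) ≤ d := (card_le_card sdiff_subset).trans (hdeg a ha)
        have h2 := card_biUnion_le_card_mul (R a)
          (fun b => B.filter fun u => G.Adj b u ∧ f b < f u) d
          fun b hb => hf b (nbr_subset _ _ (hRB a ha hb))
        rw [hk a ha] at h2
        linarith) (fun a ha => by
        rw [disjoint_left]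
        intro b hb hbQ
        rcases mem_union.mp hbQ with h | h
        · exact (mem_sdiff.mp h).2 hb
        · obtain ⟨b', hb', h⟩ := mem_biUnion.mp h
          exact hind a ha b' hb' b hb (mem_filter.mp h).2.1)
  set F := E.filter fun a => R a ⊆ S ∧ Disjoint (Q a) S with hF
  have hFE : F ⊆ E := filter_subset _ _
  obtain ⟨I, hIF, hI, hIcard⟩ := exists_independent_card (conflictGraph G R) F
  have hconf := adjCount_conflictGraph_le (k := k) (t := t) hsp hk (fun a ha b hb b' hb' hne =>
    (card_le_card fun a' ha' => by
      rw [mem_filter] at ha' ⊢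
      exact ⟨ha'.1, (mem_nbr.mp (hR a' ha'.1 ha'.2.1)).2,
        (mem_nbr.mp (hR a' ha'.1 ha'.2.2)).2⟩).trans (ht a ha b hb b' hb' hne)) hFE
  have hFpos : 0 < #F := by
    rcases Nat.eq_zero_or_pos #F with h | h
    · rw [h, mul_zero] at hS
      exact absurd hE.card_pos (by omega)
    · exact h
  have hFI : #F ≤ #I * (d + k ^ 2 * t + 1) := by
    refine Nat.le_of_mul_le_mul_right ?_ hFpos
    calc #F * #F = #F ^ 2 := (sq _).symm
      _ ≤ #I * ((d + k ^ 2 * t) * #F + #F) := hIcard.trans (Nat.mul_le_mul_left _ (by omega))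
      _ = _ := by ring
  have hIpos : 0 < #I := by
    rcases Nat.eq_zero_or_pos #I with h | h
    · rw [h, zero_mul] at hFI; omega
    · exact h
  have hmemF : ∀ a ∈ I, a ∈ E ∧ R a ⊆ S ∧ Disjoint (Q a) S := fun a ha => mem_filter.mp (hIF ha)
  have hnbr : ∀ a ∈ I, ∀ b ∈ S, G.Adj a b → b ∈ R a := fun a ha b hb hab => by
    by_contra hbR
    refine disjoint_left.mp (hmemF a ha).2.2 (mem_union_left _ (mem_sdiff.mpr ⟨?_, hbR⟩)) hb
    exact mem_nbr.mpr ⟨hSB hb, hab⟩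
  have hsub : I.biUnion R ⊆ S := biUnion_subset.mpr fun a ha => (hmemF a ha).2.1
  refine hasSparseInduced_of_bipartite (A := I) (B := I.biUnion R) (card_pos.mp hIpos) ?_
    (hEB.mono (hIF.trans hFE) (hsub.trans hSB)) (fun a ha a' ha' h => hI a ha a' ha' ⟨h.ne, Or.inl h⟩)
    ?_ (fun a ha => ?_) (fun a ha a' ha' hne b hb b' hb' hbne h1 h2 h3 h4 => ?_)
  · have h1 : #(I.biUnion R) ≤ #L := card_le_card (biUnion_subset.mpr fun a ha =>
      (hR a (hmemF a ha).1).trans (nbr_subset _ _))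
    refine h1.trans (Nat.le_of_mul_le_mul_right (hcard.trans (hS.trans ?_))
      (by positivity : 0 < 4 * (2 * ((k + 1) * d)) ^ k * (d + k ^ 2 * t + 1)))
    calc 4 * (2 * ((k + 1) * d)) ^ k * #F
        ≤ 4 * (2 * ((k + 1) * d)) ^ k * (#I * (d + k ^ 2 * t + 1)) := Nat.mul_le_mul_left _ hFI
      _ = _ := by ring
  · have key : ∀ b ∈ I.biUnion R, ∀ b' ∈ I.biUnion R, G.Adj b b' → ¬ f b < f b' := by
      intro b hb b' hb' hadj hlt
      obtain ⟨a, ha, hba⟩ := mem_biUnion.mp hb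
      refine disjoint_left.mp (hmemF a ha).2.2 (mem_union_right _ (mem_biUnion.mpr
        ⟨b, hba, mem_filter.mpr ⟨hSB (hsub hb'), hadj, hlt⟩⟩)) (hsub hb')
    intro b hb b' hb' hadj
    rcases lt_trichotomy (f b) (f b') with h | h | h
    · exact key b hb b' hb' hadj h
    · exact hadj.ne (hfinj (hSB (hsub hb)) (hSB (hsub hb')) h)
    · exact key b' hb' b hb hadj.symm h
  · rw [← hk a (hmemF a ha).1]
    exact card_le_card fun b hb => mem_nbr.mpr
      ⟨mem_biUnion.mpr ⟨a, ha, hb⟩, (mem_nbr.mp (hR a (hmemF a ha).1 hb)).2⟩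
  · refine hI a ha a' ha' ⟨hne, Or.inr (one_lt_card.mpr ⟨b, ?_, b', ?_, hbne⟩)⟩
    · exact mem_inter.mpr ⟨hnbr a ha b (hsub hb) h1, hnbr a' ha' b (hsub hb) h3⟩
    · exact mem_inter.mpr ⟨hnbr a ha b' (hsub hb') h2, hnbr a' ha' b' (hsub hb') h4⟩

end Star

section Extension

variable {V : Type*} {G : SimpleGraph V} {k P : ℕ} {Z : Finset V} {F : Finset V → Prop}

/-- The elements of `Z` by which `S` can be extended within the family `F`. -/
def link (Z : Finset V) (F : Finset V → Prop) (S : Finset V) : Finset V :=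
  Z.filter fun b => b ∉ S ∧ F (insert b S)

/-- Tuples in `Z` built up one entry at a time within the family `F`. -/
def extTuples (Z : Finset V) (F : Finset V → Prop) : (j : ℕ) → Finset (Fin j → V)
  | 0 => univ
  | j + 1 => (extTuples Z F j).biUnion fun τ =>
      (link Z F (univ.image τ)).image fun b => (Fin.cons b τ : Fin (j + 1) → V)

lemma image_cons {j : ℕ} (b : V) (τ : Fin j → V) :
    univ.image (Fin.cons b τ : Fin (j + 1) → V) = insert b (univ.image τ) := by
  ext x
  simp [Fin.exists_fin_succ, eq_comm]

lemma sum_extTuples_succ (j : ℕ) (g : Finset V → ℕ) :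
    ∑ τ ∈ extTuples Z F (j + 1), g (univ.image τ) =
      ∑ τ ∈ extTuples Z F j, ∑ b ∈ link Z F (univ.image τ), g (insert b (univ.image τ)) := by
  rw [extTuples, sum_biUnion]
  · refine sum_congr rfl fun τ _ => ?_
    rw [sum_image fun b _ b' _ h => (Fin.cons_injective2 h).1]
    simp only [image_cons]
  · intro τ _ τ' _ hne
    refine disjoint_left.mpr fun x hx hx' => hne ?_
    obtain ⟨b, -, rfl⟩ := mem_image.mp hx
    obtain ⟨b', -, h⟩ := mem_image.mp hx'
    exact (Fin.cons_injective2 h).2.symm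

lemma card_extTuples_succ (j : ℕ) :
    #(extTuples Z F (j + 1)) = ∑ τ ∈ extTuples Z F j, #(link Z F (univ.image τ)) := by
  have := sum_extTuples_succ (Z := Z) (F := F) j fun _ => 1
  simpa using this

lemma extTuples_spec (h0 : F ∅) {j : ℕ} {τ : Fin j → V} (hτ : τ ∈ extTuples Z F j) :
    Function.Injective τ ∧ univ.image τ ⊆ Z ∧ F (univ.image τ) := by
  induction j with
  | zero => exact ⟨fun i => i.elim0, by simp, by simpa using h0⟩
  | succ j ih =>
    obtain ⟨σ, hσ, h⟩ := mem_biUnion.mp hτ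
    obtain ⟨b, hb, rfl⟩ := mem_image.mp h
    obtain ⟨h1, h2, h3⟩ := ih hσ
    obtain ⟨hbZ, hbS, hbF⟩ := mem_filter.mp hb
    rw [image_cons]
    refine ⟨Fin.cons_injective_iff.mpr ⟨by simpa using hbS, h1⟩, insert_subset hbZ h2, hbF⟩

/-- In a graph in which every `k`-set of the link contains an edge of `G` or a pair extending
within the family, there are many extending pairs. -/
lemma sq_card_link_le {S : Finset V} (h : ∀ R ⊆ link Z F S, #R = k →
      ∃ b ∈ R, ∃ b' ∈ R, b ≠ b' ∧ (G.Adj b b' ∨ F (insert b' (insert b S)))) :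
    #(link Z F S) ^ 2 ≤ k * (∑ b ∈ link Z F S, #(link Z F (insert b S)) + adjCount G Z Z +
      #(link Z F S)) := by
  set ℓ := link Z F S with hℓ
  let H : SimpleGraph V :=
    { Adj := fun b b' => b ≠ b' ∧ (G.Adj b b' ∨ F (insert b' (insert b S)))
      symm := ⟨fun b b' h => ⟨h.1.symm, h.2.imp (fun h => h.symm) fun h => by
        rwa [insert_comm]⟩⟩
      loopless := ⟨fun _ h => h.1 rfl⟩ }
  obtain ⟨I, hIℓ, hI, hcard⟩ := exists_independent_card H ℓ
  have hIk : #I ≤ k := by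
    by_contra! hlt
    obtain ⟨R, hR, hRk⟩ := exists_subset_card_eq hlt.le
    obtain ⟨b, hb, b', hb', hne, hadj⟩ := h R (hR.trans hIℓ) hRk
    exact hI b (hR hb) b' (hR hb') ⟨hne, hadj⟩
  have hdeg : ∀ b ∈ ℓ, #(nbr H b ℓ) ≤ #(link Z F (insert b S)) + #(nbr G b Z) := by
    intro b hb
    refine (card_le_card fun b' hb' => ?_).trans (card_union_le _ _)
    obtain ⟨hb'ℓ, hne, hadj⟩ := mem_nbr.mp hb'
    obtain ⟨hb'Z, hb'S, -⟩ := mem_filter.mp hb'ℓ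
    rcases hadj with hadj | hadj
    · exact mem_union_right _ (mem_nbr.mpr ⟨hb'Z, hadj⟩)
    · refine mem_union_left _ (mem_filter.mpr ⟨hb'Z, ?_, hadj⟩)
      simp only [mem_insert, not_or]
      exact ⟨hne.symm, hb'S⟩
  have hH : adjCount H ℓ ℓ ≤ ∑ b ∈ ℓ, #(link Z F (insert b S)) + adjCount G Z Z := by
    refine (sum_le_sum hdeg).trans ?_
    rw [sum_add_distrib]
    exact Nat.add_le_add_left (sum_le_sum_of_subset (filter_subset _ _)) _
  exact hcard.trans (Nat.mul_le_mul hIk (Nat.add_le_add_right hH _))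

lemma sq_card_extTuples_le {j : ℕ} (h0 : F ∅) (hj : j + 2 ≤ P)
    (h : ∀ S ⊆ Z, F S → #S + 2 ≤ P → ∀ R ⊆ link Z F S, #R = k →
      ∃ b ∈ R, ∃ b' ∈ R, b ≠ b' ∧ (G.Adj b b' ∨ F (insert b' (insert b S)))) :
    #(extTuples Z F (j + 1)) ^ 2 ≤ #(extTuples Z F j) * (k * (#(extTuples Z F (j + 2)) +
      adjCount G Z Z * #(extTuples Z F j) + #(extTuples Z F (j + 1)))) := by
  have h1 : #(extTuples Z F (j + 1)) ^ 2 ≤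
      #(extTuples Z F j) * ∑ τ ∈ extTuples Z F j, #(link Z F (univ.image τ)) ^ 2 := by
    rw [card_extTuples_succ]
    exact sq_sum_le_card_mul_sum_sq
  refine h1.trans (Nat.mul_le_mul_left _ ?_)
  calc ∑ τ ∈ extTuples Z F j, #(link Z F (univ.image τ)) ^ 2
      ≤ ∑ τ ∈ extTuples Z F j, k * (∑ b ∈ link Z F (univ.image τ),
          #(link Z F (insert b (univ.image τ))) + adjCount G Z Z + #(link Z F (univ.image τ))) := by
        refine sum_le_sum fun τ hτ => sq_card_link_le ?_
        obtain ⟨hinj, hZ, hF⟩ := extTuples_spec h0 hτ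
        refine h _ hZ hF ?_
        rw [card_image_of_injective _ hinj, card_univ, Fintype.card_fin]
        exact hj
    _ = _ := by
        rw [← mul_sum, sum_add_distrib, sum_add_distrib, sum_const, smul_eq_mul,
          ← card_extTuples_succ,
          ← sum_extTuples_succ (Z := Z) (F := F) j fun S => #(link Z F S),
          ← card_extTuples_succ]
        ring

lemma growth_step {a b c k z E K : ℝ} (hk : 1 ≤ k) (hK : 1 ≤ K) (ha : 0 < a)
    (hab : z * a ≤ K * b) (hsq : b ^ 2 ≤ a * (k * (c + E * a + b))) (hE0 : 0 ≤ E) (hz : 0 < z)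
    (hE : 8 * k ^ 2 * K ^ 2 * E ≤ z ^ 2) (hzK : 4 * k * K ≤ z) : z * b ≤ 2 * k * K * c := by
  have hb : 0 < b := by
    have : 0 < K * b := lt_of_lt_of_le (by positivity) hab
    exact pos_of_mul_pos_right this (by linarith)
  have h1 : 4 * k * a ≤ b := by
    have : K * (4 * k * a) ≤ K * b := by nlinarith
    exact le_of_mul_le_mul_left this (by linarith)
  have h2 : 4 * k * (E * a ^ 2) ≤ b ^ 2 := by
    have h3 : (z * a) ^ 2 ≤ (K * b) ^ 2 := by gcongr
    have h4 : K ^ 2 * (4 * k * (E * a ^ 2)) ≤ K ^ 2 * b ^ 2 := by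
      have : 4 * k * K ^ 2 * E ≤ z ^ 2 := by
        refine le_trans ?_ hE
        have : k * (K ^ 2 * E) ≤ k ^ 2 * (K ^ 2 * E) := by
          gcongr; nlinarith
        nlinarith [mul_nonneg (by linarith : (0 : ℝ) ≤ k) (mul_nonneg (sq_nonneg K) hE0)]
      nlinarith [mul_le_mul_of_nonneg_right this (sq_nonneg a)]
    exact le_of_mul_le_mul_left h4 (by positivity)
  have h3 : b ^ 2 ≤ 2 * k * a * c := by nlinarith [mul_le_mul_of_nonneg_right h1 hb.le]
  have h4 : b * (z * b) ≤ b * (2 * k * K * c) := by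
    have hc : 0 ≤ c := by
      have : 0 < 2 * k * a * c := lt_of_lt_of_le (by positivity) h3
      exact (pos_of_mul_pos_right this (by positivity)).le
    calc b * (z * b) = z * b ^ 2 := by ring
      _ ≤ z * (2 * k * a * c) := by gcongr
      _ = 2 * k * c * (z * a) := by ring
      _ ≤ 2 * k * c * (K * b) := by gcongr
      _ = _ := by ring
  exact le_of_mul_le_mul_left h4 hb

lemma pow_card_le_extTuples (hk : 0 < k) (h0 : F ∅) (h1 : ∀ b ∈ Z, F {b})
    (h : ∀ S ⊆ Z, F S → #S + 2 ≤ P → ∀ R ⊆ link Z F S, #R = k →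
      ∃ b ∈ R, ∃ b' ∈ R, b ≠ b' ∧ (G.Adj b b' ∨ F (insert b' (insert b S))))
    (hZ : 4 * k * (2 * k) ^ P ≤ #Z) (hE : 8 * k ^ 2 * (2 * k) ^ (2 * P) * adjCount G Z Z ≤ #Z ^ 2) :
    #Z ^ P ≤ (2 * k) ^ P ^ 2 * #(extTuples Z F P) := by
  have hkr : (1 : ℝ) ≤ k := by exact_mod_cast hk
  have h2k : (1 : ℝ) ≤ 2 * k := by linarith
  have hzr : 4 * k * (2 * k : ℝ) ^ P ≤ #Z := by exact_mod_cast hZ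
  have hEr : 8 * (k : ℝ) ^ 2 * (2 * k) ^ (2 * P) * adjCount G Z Z ≤ (#Z : ℝ) ^ 2 := by
    exact_mod_cast hE
  have hzpos : (0 : ℝ) < #Z := lt_of_lt_of_le (by positivity) hzr
  have hstep : ∀ j < P, 0 < (#(extTuples Z F j) : ℝ) ∧
      (#Z : ℝ) * #(extTuples Z F j) ≤ (2 * k) ^ j * #(extTuples Z F (j + 1)) := by
    intro j
    induction j with
    | zero =>
      intro _
      have hlink : link Z F ∅ = Z := by
        ext b
        simp only [link, mem_filter, notMem_empty, not_false_eq_true, true_and,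
          insert_empty_eq, and_iff_left_iff_imp]
        exact h1 b
      have e0 : #(extTuples Z F 0) = 1 := by simp [extTuples]
      have e1 : #(extTuples Z F 1) = #Z := by
        rw [card_extTuples_succ, extTuples]
        simp [hlink]
      rw [e0, zero_add, e1]
      simp
    | succ j ih =>
      intro hj
      obtain ⟨ha, hab⟩ := ih (by omega)
      have hpowj : (2 * k : ℝ) ^ j ≤ (2 * k) ^ P := pow_le_pow_right₀ h2k (by omega)
      have hb : (0 : ℝ) < #(extTuples Z F (j + 1)) := by
        have : (0 : ℝ) < (2 * k) ^ j * #(extTuples Z F (j + 1)) :=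
          lt_of_lt_of_le (by positivity) hab
        exact pos_of_mul_pos_right this (by positivity)
      refine ⟨hb, ?_⟩
      have hsq := sq_card_extTuples_le (j := j) h0 (by omega : j + 2 ≤ P) h
      have hsqr : (#(extTuples Z F (j + 1)) : ℝ) ^ 2 ≤ #(extTuples Z F j) *
          (k * (#(extTuples Z F (j + 2)) + adjCount G Z Z * #(extTuples Z F j) +
            #(extTuples Z F (j + 1)))) := by exact_mod_cast hsq
      have := growth_step hkr (one_le_pow₀ h2k) ha hab hsqr (Nat.cast_nonneg _) hzpos
        (le_trans (by rw [← pow_mul, mul_comm j]; gcongr; linarith) hEr)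
        (le_trans (by gcongr) hzr)
      calc (#Z : ℝ) * #(extTuples Z F (j + 1)) ≤ 2 * k * (2 * k) ^ j * #(extTuples Z F (j + 2)) :=
            this
        _ = _ := by rw [pow_succ]; ring
  have hall : ∀ j ≤ P, (#Z : ℝ) ^ j ≤ (2 * k) ^ (P * j) * #(extTuples Z F j) := by
    intro j
    induction j with
    | zero => intro _; simp [extTuples]
    | succ j ih =>
      intro hj
      obtain ⟨-, hab⟩ := hstep j (by omega)
      have hpowj : (2 * k : ℝ) ^ j ≤ (2 * k) ^ P := pow_le_pow_right₀ h2k (by omega)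
      calc (#Z : ℝ) ^ (j + 1) = #Z ^ j * #Z := pow_succ _ _
        _ ≤ (2 * k) ^ (P * j) * #(extTuples Z F j) * #Z := by gcongr; exact ih (by omega)
        _ = (2 * k) ^ (P * j) * (#Z * #(extTuples Z F j)) := by ring
        _ ≤ (2 * k) ^ (P * j) * ((2 * k) ^ j * #(extTuples Z F (j + 1))) := by gcongr
        _ ≤ (2 * k) ^ (P * j) * ((2 * k) ^ P * #(extTuples Z F (j + 1))) := by gcongr
        _ = _ := by rw [mul_add, pow_add, mul_one]; ring
  have := hall P le_rfl
  rw [← sq] at this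
  exact_mod_cast this

end Extension

section Unbalanced

variable {V : Type*} {G : SimpleGraph V} {k d s P L : ℕ} {A B : Finset V} {T : ℕ → ℕ}

/-- The vertices of `A` adjacent to all of `S`. -/
def common (G : SimpleGraph V) (A S : Finset V) : Finset V :=
  A.filter fun a => ∀ b ∈ S, G.Adj a b

/-- `S` has at least `T #S` common neighbours in `A`. -/
def Heavy (G : SimpleGraph V) (A : Finset V) (T : ℕ → ℕ) (S : Finset V) : Prop :=
  T #S ≤ #(common G A S)

lemma mem_common {S : Finset V} {a : V} : a ∈ common G A S ↔ a ∈ A ∧ ∀ b ∈ S, G.Adj a b :=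
  mem_filter

lemma common_insert (S : Finset V) (b : V) :
    common G A (insert b S) = (common G A S).filter fun a => G.Adj a b := by
  ext a
  simp only [mem_common, mem_filter, forall_mem_insert]
  tauto

/-- The common neighbours of `S` seeing `k` independent heavy extensions of `S`, no two of which
extend `S` heavily together. -/
def exceptional (G : SimpleGraph V) (A B : Finset V) (T : ℕ → ℕ) (k : ℕ) (S : Finset V) : Finset V :=
  (common G A S).filter fun a => ∃ R ⊆ nbr G a (link B (Heavy G A T) S), #R = k ∧
    ∀ b ∈ R, ∀ b' ∈ R, b ≠ b' → ¬ G.Adj b b' ∧ ¬ Heavy G A T (insert b' (insert b S))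

lemma card_link_mul_le (hdeg : ∀ a ∈ A, #(nbr G a B) ≤ d) (S : Finset V) :
    #(link B (Heavy G A T) S) * T (#S + 1) ≤ d * #(common G A S) := by
  set Λ := link B (Heavy G A T) S with hΛ
  calc #Λ * T (#S + 1) ≤ ∑ b ∈ Λ, #(nbr G b (common G A S)) := by
        rw [← smul_eq_mul, ← sum_const]
        refine sum_le_sum fun b hb => ?_
        obtain ⟨-, hbS, hh⟩ := mem_filter.mp hb
        unfold Heavy at hh
        rw [card_insert_of_notMem hbS, common_insert] at hh
        refine hh.trans (card_le_card fun a ha => ?_)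
        rw [mem_filter] at ha
        exact mem_nbr.mpr ⟨ha.1, ha.2.symm⟩
    _ = adjCount G Λ (common G A S) := rfl
    _ = adjCount G (common G A S) Λ := adjCount_comm _ _
    _ ≤ ∑ a ∈ common G A S, d := sum_le_sum fun a ha =>
        (card_le_card (nbr_mono a (filter_subset _ _))).trans (hdeg a (mem_common.mp ha).1)
    _ = _ := by rw [sum_const, smul_eq_mul, mul_comm]

lemma hasSparseInduced_of_exceptional {S : Finset V} (hd : 0 < d) (hAB : Disjoint A B)
    (hsp : ∀ S : Finset V, adjCount G S S ≤ d * #S) (hdeg : ∀ a ∈ A, #(nbr G a B) ≤ d)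
    (hT : 4 * (2 * ((k + 1) * d)) ^ k * (d + k ^ 2 * T (#S + 2) + 1) * d ^ (P + 2) ≤ T (#S + 1))
    (hpos : 0 < #(common G A S))
    (hexc : #(common G A S) ≤ #(exceptional G A B T k S) * d ^ (P + 1)) :
    HasSparseInduced G k := by
  set E := exceptional G A B T k S with hE
  have hEA : E ⊆ common G A S := filter_subset _ _
  have hEpos : 0 < #E := by
    rcases Nat.eq_zero_or_pos #E with h | h
    · rw [h, zero_mul] at hexc; omega
    · exact h
  have hR : ∀ a ∈ E, ∃ R ⊆ nbr G a (link B (Heavy G A T) S), #R = k ∧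
      ∀ b ∈ R, ∀ b' ∈ R, b ≠ b' → ¬ G.Adj b b' ∧ ¬ Heavy G A T (insert b' (insert b S)) :=
    fun a ha => (mem_filter.mp ha).2
  choose! R hRsub hRk hRpair using hR
  have hEinA : ∀ a ∈ E, a ∈ A := fun a ha => (mem_common.mp (hEA ha)).1
  refine hasSparseInduced_of_stars (E := E) (B := B) (L := link B (Heavy G A T) S) (R := R)
    (t := T (#S + 2)) hd (hAB.mono_left hEinA) (card_pos.mp hEpos) (filter_subset _ _) hsp
    (fun a ha => hdeg a (hEinA a ha)) hRsub hRk (fun a ha b hb b' hb' h =>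
      (hRpair a ha b hb b' hb' h.ne).1 h) (fun a ha b hb b' hb' hne => ?_) ?_
  · have h1 := (hRpair a ha b hb b' hb' hne).2
    have hbS := (mem_filter.mp (nbr_subset _ _ (hRsub a ha hb))).2.1
    have hb'S := (mem_filter.mp (nbr_subset _ _ (hRsub a ha hb'))).2.1
    unfold Heavy at h1
    rw [card_insert_of_notMem (by simp [hne.symm, hb'S]), card_insert_of_notMem hbS, not_le] at h1
    refine le_trans (card_le_card fun a' ha' => ?_) h1.le
    rw [mem_filter] at ha'
    rw [common_insert, common_insert, mem_filter, mem_filter]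
    exact ⟨⟨hEA ha'.1, ha'.2.1⟩, ha'.2.2⟩
  · set w := 4 * (2 * ((k + 1) * d)) ^ k * (d + k ^ 2 * T (#S + 2) + 1) with hw
    refine Nat.le_of_mul_le_mul_right ?_ (pow_pos hd (P + 2))
    calc #(link B (Heavy G A T) S) * w * d ^ (P + 2)
        = #(link B (Heavy G A T) S) * (w * d ^ (P + 2)) := by ring
      _ ≤ #(link B (Heavy G A T) S) * T (#S + 1) := Nat.mul_le_mul_left _ hT
      _ ≤ d * #(common G A S) := card_link_mul_le hdeg S
      _ ≤ d * (#E * d ^ (P + 1)) := Nat.mul_le_mul_left _ hexc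
      _ = _ := by rw [pow_succ d (P + 1)]; ring

/-- The subsets of `B` of size at most `P - 2`. -/
def smallSubsets (P : ℕ) (B : Finset V) : Finset (Finset V) :=
  B.powerset.filter fun S => #S + 2 ≤ P

lemma card_smallSubsets_le {Z : Finset V} (hd : 0 < d) (hZ : #Z ≤ d) :
    #(smallSubsets P Z) ≤ P * d ^ P := by
  have h1 : smallSubsets P Z ⊆ (range P).biUnion fun j => powersetCard j Z := by
    intro S hS
    obtain ⟨hSZ, hSP⟩ := mem_filter.mp hS
    exact mem_biUnion.mpr ⟨#S, mem_range.mpr (by omega),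
      mem_powersetCard.mpr ⟨mem_powerset.mp hSZ, rfl⟩⟩
  refine (card_le_card h1).trans ((card_biUnion_le_card_mul _ _ (d ^ P) fun j hj => ?_).trans
    (by rw [card_range]))
  rw [card_powersetCard]
  calc (#Z).choose j ≤ #Z ^ j := Nat.choose_le_pow _ _
    _ ≤ d ^ j := Nat.pow_le_pow_left hZ _
    _ ≤ d ^ P := Nat.pow_le_pow_right hd (mem_range.mp hj).le

lemma sum_common_le (hd : 0 < d) (hdeg : ∀ a ∈ A, #(nbr G a B) ≤ d) :
    ∑ S ∈ smallSubsets P B, #(common G A S) ≤ #A * (P * d ^ P) := by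
  simp only [common, card_filter]
  rw [sum_comm, ← smul_eq_mul, ← sum_const]
  refine sum_le_sum fun a ha => ?_
  rw [← card_filter]
  refine (card_le_card fun S hS => ?_).trans (card_smallSubsets_le hd (hdeg a ha))
  obtain ⟨hS1, hS2⟩ := mem_filter.mp hS
  obtain ⟨hS3, hS4⟩ := mem_filter.mp hS1
  refine mem_filter.mpr ⟨mem_powerset.mpr fun b hb => ?_, hS4⟩
  exact mem_nbr.mpr ⟨mem_powerset.mp hS3 hb, hS2 b hb⟩

/-- If exceptional sets are small, some vertex of `A` sees only heavy vertices and is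
exceptional for none of its small heavy sets. -/
lemma exists_typical (hd : 4 * P < d) (hdeg : ∀ a ∈ A, #(nbr G a B) ≤ d)
    (hBA : 4 * (#B * T 1) ≤ #A) (hA : A.Nonempty)
    (hexc : ∀ S ⊆ B, #S + 2 ≤ P → Heavy G A T S →
      #(exceptional G A B T k S) * d ^ (P + 1) ≤ #(common G A S)) :
    ∃ a ∈ A, (∀ b ∈ nbr G a B, Heavy G A T {b}) ∧
      ∀ S ⊆ B, #S + 2 ≤ P → Heavy G A T S → a ∉ exceptional G A B T k S := by
  by_contra! hbad
  set X := (B.filter fun b => ¬ Heavy G A T {b}).biUnion fun b => common G A {b} with hX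
  set Y := ((smallSubsets P B).filter fun S => Heavy G A T S).biUnion
    fun S => exceptional G A B T k S with hY
  have hcover : A ⊆ X ∪ Y := by
    intro a ha
    by_cases h : ∀ b ∈ nbr G a B, Heavy G A T {b}
    · obtain ⟨S, hSB, hSP, hS, haS⟩ := hbad a ha h
      exact mem_union_right _ (mem_biUnion.mpr ⟨S, mem_filter.mpr
        ⟨mem_filter.mpr ⟨mem_powerset.mpr hSB, hSP⟩, hS⟩, haS⟩)
    · push Not at h
      obtain ⟨b, hb, hbh⟩ := h
      rw [mem_nbr] at hb
      refine mem_union_left _ (mem_biUnion.mpr ⟨b, mem_filter.mpr ⟨hb.1, hbh⟩, ?_⟩)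
      exact mem_common.mpr ⟨ha, by simpa using hb.2⟩
  have hXle : #X ≤ #B * T 1 := by
    refine (card_biUnion_le_card_mul _ _ (T 1) fun b hb => ?_).trans
      (Nat.mul_le_mul_right _ (card_filter_le _ _))
    have := (mem_filter.mp hb).2
    unfold Heavy at this
    rw [card_singleton] at this
    omega
  have hYle : #Y * d ^ (P + 1) ≤ #A * (P * d ^ P) := by
    calc #Y * d ^ (P + 1) ≤ (∑ S ∈ (smallSubsets P B).filter fun S => Heavy G A T S,
          #(exceptional G A B T k S)) * d ^ (P + 1) := Nat.mul_le_mul_right _ card_biUnion_le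
      _ ≤ ∑ S ∈ (smallSubsets P B).filter fun S => Heavy G A T S, #(common G A S) := by
          rw [sum_mul]
          refine sum_le_sum fun S hS => ?_
          obtain ⟨hS1, hS2⟩ := mem_filter.mp hS
          obtain ⟨hS3, hS4⟩ := mem_filter.mp hS1
          exact hexc S (mem_powerset.mp hS3) hS4 hS2
      _ ≤ ∑ S ∈ smallSubsets P B, #(common G A S) := sum_le_sum_of_subset (filter_subset _ _)
      _ ≤ _ := sum_common_le (by omega) hdeg
  have hYd : #Y * d ≤ #A * P := by
    refine Nat.le_of_mul_le_mul_right ?_ (pow_pos (by omega : 0 < d) P)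
    calc #Y * d * d ^ P = #Y * d ^ (P + 1) := by ring
      _ ≤ _ := hYle.trans (le_of_eq (by ring))
  have hAXY : #A ≤ #X + #Y := (card_le_card hcover).trans (card_union_le _ _)
  have hApos := hA.card_pos
  have h1 : 3 * #A ≤ 4 * #Y := by omega
  nlinarith

/-- The family of heavy independent sets. -/
def HeavyIndep (G : SimpleGraph V) (A : Finset V) (T : ℕ → ℕ) (S : Finset V) : Prop :=
  Heavy G A T S ∧ ∀ b ∈ S, ∀ b' ∈ S, ¬ G.Adj b b'

lemma HeavyIndep.exists_extending_pair {S Z R : Finset V} {a : V} (ha : a ∈ A)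
    (hZ : Z = nbr G a B) (hSZ : S ⊆ Z) (hexc : a ∉ exceptional G A B T k S)
    (hR : R ⊆ link Z (HeavyIndep G A T) S) (hRk : #R = k) :
    ∃ b ∈ R, ∃ b' ∈ R, b ≠ b' ∧
      (G.Adj b b' ∨ HeavyIndep G A T (insert b' (insert b S))) := by
  by_contra! hno
  refine hexc (mem_filter.mpr ⟨mem_common.mpr ⟨ha, fun b hb => ?_⟩, R, fun b hb => ?_, hRk,
    fun b hb b' hb' hne => ⟨(hno b hb b' hb' hne).1, fun hh => (hno b hb b' hb' hne).2 ⟨hh, ?_⟩⟩⟩)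
  · have := hSZ hb
    rw [hZ, mem_nbr] at this
    exact this.2
  · obtain ⟨hbZ, hbS, hbH⟩ := mem_filter.mp (hR hb)
    rw [hZ, mem_nbr] at hbZ
    exact mem_nbr.mpr ⟨mem_filter.mpr ⟨hbZ.1, hbS, hbH.1⟩, hbZ.2⟩
  · have h1 := (mem_filter.mp (hR hb)).2.2.2
    have h2 := (mem_filter.mp (hR hb')).2.2.2
    have h3 := (hno b hb b' hb' hne).1
    intro x hx y hy hxy
    simp only [mem_insert] at hx hy h1 h2
    rcases hx with rfl | rfl | hx <;> rcases hy with rfl | rfl | hy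
    · exact hxy.ne rfl
    · exact h3 hxy.symm
    · exact h2 _ (Or.inl rfl) _ (Or.inr hy) hxy
    · exact h3 hxy
    · exact hxy.ne rfl
    · exact h1 _ (Or.inl rfl) _ (Or.inr hy) hxy
    · exact h2 _ (Or.inr hx) _ (Or.inl rfl) hxy
    · exact h1 _ (Or.inr hx) _ (Or.inl rfl) hxy
    · exact h1 _ (Or.inr hx) _ (Or.inr hy) hxy

lemma IsDesign.hasSparseInduced_of_unbalanced {inc : Fin L → Finset (Fin P)} {z : ℕ}
    (hD : IsDesign k inc) (hk : 0 < k) (hs : 0 < s) (hP : 0 < P) (hK : BicliqueFree G s)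
    (hd : 4 * P < d) (hAB : Disjoint A B) (hA : A.Nonempty)
    (hsp : ∀ S : Finset V, adjCount G S S ≤ d * #S) (hdeg : ∀ a ∈ A, #(nbr G a B) ≤ d)
    (hlow : ∀ a ∈ A, z ≤ #(nbr G a B))
    (hLS : ∀ Z : Finset V, z ≤ #Z →
      8 * k ^ 2 * (2 * k) ^ (2 * P) * adjCount G Z Z ≤ #Z ^ 2)
    (hz : 4 * k * (2 * k) ^ P ≤ z) (hz' : (2 * k) ^ P ^ 2 * (L * P * s) < z)
    (hT : ∀ j, j + 2 ≤ P →
      4 * (2 * ((k + 1) * d)) ^ k * (d + k ^ 2 * T (j + 2) + 1) * d ^ (P + 2) ≤ T (j + 1))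
    (hTpos : ∀ j, 0 < T j) (hTP : 4 * s * L * (2 * s) ^ L * (2 * s) ^ P ≤ T P)
    (hT0 : T 0 ≤ #A) (hBA : 4 * (#B * T 1) ≤ #A) : HasSparseInduced G k := by
  by_contra hnot
  obtain ⟨a, ha, hab, hexc⟩ := exists_typical (k := k) hd hdeg hBA hA fun S hSB hSP hS => by
    by_contra! hlt
    exact hnot (hasSparseInduced_of_exceptional (by omega) hAB hsp hdeg (hT _ hSP)
      (lt_of_lt_of_le (hTpos _) hS) hlt.le)
  set Z := nbr G a B with hZ
  have hzZ : z ≤ #Z := hlow a ha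
  have h0 : HeavyIndep G A T ∅ := by
    refine ⟨?_, by simp⟩
    unfold Heavy common
    simpa using hT0
  have hmany := pow_card_le_extTuples (G := G) (P := P) (Z := Z) (F := HeavyIndep G A T) hk h0
    (fun b hb => ⟨hab b hb, by simp⟩)
    (fun S hSZ hS hSP R hR hRk => HeavyIndep.exists_extending_pair ha hZ hSZ
      (hexc S (hSZ.trans (nbr_subset _ _)) hSP hS.1) hR hRk)
    (hz.trans hzZ) (hLS Z hzZ)
  refine hnot (hD.hasSparseInduced_of_tuples hK hs Z A (M := T P)
    (extTuples Z (HeavyIndep G A T) P) (fun τ hτ q => ?_) (fun τ hτ p q hpq => ?_)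
    (fun τ hτ l => ?_) hTP ?_)
  · exact (extTuples_spec h0 hτ).2.1 (mem_image_of_mem _ (mem_univ _))
  · obtain ⟨hinj, -, -, hind⟩ := extTuples_spec h0 hτ
    exact ⟨hinj.ne hpq, hind _ (mem_image_of_mem _ (mem_univ _)) _
      (mem_image_of_mem _ (mem_univ _))⟩
  · obtain ⟨hinj, -, hheavy, -⟩ := extTuples_spec h0 hτ
    unfold Heavy at hheavy
    rw [card_image_of_injective _ hinj, card_univ, Fintype.card_fin] at hheavy
    refine hheavy.trans (card_le_card fun y hy => ?_)
    rw [mem_common] at hy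
    refine mem_filter.mpr ⟨hy.1, fun p _ => (hy.2 _ (mem_image_of_mem _ (mem_univ _))).symm, by simp⟩
  · refine lt_of_mul_lt_mul_left (a := (2 * k) ^ P ^ 2) (lt_of_lt_of_le ?_ hmany) (Nat.zero_le _)
    obtain ⟨P', rfl⟩ : ∃ P', P = P' + 1 := ⟨P - 1, by omega⟩
    calc (2 * k) ^ (P' + 1) ^ 2 * (L * (P' + 1) * s * #Z ^ (P' + 1 - 1))
        = (2 * k) ^ (P' + 1) ^ 2 * (L * (P' + 1) * s) * #Z ^ P' := by
          rw [Nat.add_sub_cancel]; ring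
      _ < #Z * #Z ^ P' := Nat.mul_lt_mul_of_pos_right (hz'.trans_le hzZ) (pow_pos (by omega) _)
      _ = #Z ^ (P' + 1) := by ring

end Unbalanced

section Main

variable {V : Type*} {G : SimpleGraph V} {k s P L N : ℕ}

lemma adjCount_union_le (X X' Y : Finset V) :
    adjCount G (X ∪ X') Y ≤ adjCount G X Y + adjCount G X' Y := by
  unfold adjCount
  have := sum_union_inter (s₁ := X) (s₂ := X') (f := fun x => #(nbr G x Y))
  omega

/-- Few edges leave `X` towards `B` when every vertex of `X` has many neighbours in `B`. -/
lemma adjCount_of_high_le {X B : Finset V} {D : ℕ}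
    (hsp : ∀ S : Finset V, adjCount G S S ≤ D * #S) (hX : ∀ x ∈ X, 2 * D ≤ #(nbr G x B)) :
    adjCount G X B ≤ 2 * (D * #B) := by
  have h1 : #X * (2 * D) ≤ adjCount G X B := by
    rw [← smul_eq_mul, ← sum_const]
    exact sum_le_sum hX
  have h2 : adjCount G X B ≤ D * (#X + #B) :=
    (adjCount_mono subset_union_left subset_union_right).trans
      ((hsp (X ∪ B)).trans (Nat.mul_le_mul_left _ (card_union_le _ _)))
  nlinarith

/-- The exponent step between consecutive heaviness thresholds. -/
def stepExp (k P L N : ℕ) : ℕ := (N + 3) * (k + P + 3) + L + 2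

/-- The exponent separating low from high degrees. -/
def degExp (k P L N : ℕ) : ℕ := stepExp k P L N * (P + 1) + N + 3

/-- How large `s` has to be in `IsDesign.hasSparseInduced_of_normalised`. -/
def mainConst (k P L N : ℕ) : ℕ :=
  localConst P L + levelConst k (degExp k P L N) + 4 * (2 * (k + 1)) ^ k + (k ^ 2 + 2) +
    4 * L * 2 ^ (L + P) + 8 * k ^ 2 * (2 * k) ^ (2 * P) + 4 * k * (2 * k) ^ P +
    ((2 * k) ^ P ^ 2 * (L * P) + 1) + 8000 + 4 * P

lemma threshold_step {d : ℕ} (hs1 : 4 * (2 * (k + 1)) ^ k ≤ s) (hs2 : k ^ 2 + 2 ≤ s)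
    (hd : d ≤ s ^ (N + 3)) {j : ℕ} (hj : j + 2 ≤ P) :
    4 * (2 * ((k + 1) * d)) ^ k * (d + k ^ 2 * s ^ (stepExp k P L N * (P + 1 - (j + 2))) + 1) *
      d ^ (P + 2) ≤ s ^ (stepExp k P L N * (P + 1 - (j + 1))) := by
  set M := stepExp k P L N with hM
  set T := s ^ (M * (P + 1 - (j + 2))) with hT
  have hs : 0 < s := by omega
  have hTpos : 1 ≤ T := Nat.one_le_iff_ne_zero.mpr (pow_pos hs _).ne'
  have hX : 1 ≤ s ^ (N + 3) := Nat.one_le_iff_ne_zero.mpr (pow_pos hs _).ne'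
  have e1 : M * (P + 1 - (j + 1)) = M * (P + 1 - (j + 2)) + M := by
    rw [show P + 1 - (j + 1) = P + 1 - (j + 2) + 1 by omega]; ring
  have h1 : d + k ^ 2 * T + 1 ≤ s * s ^ (N + 3) * T := by
    calc d + k ^ 2 * T + 1 ≤ s ^ (N + 3) * T + k ^ 2 * (s ^ (N + 3) * T) + s ^ (N + 3) * T := by
          have h2 : s ^ (N + 3) ≤ s ^ (N + 3) * T := Nat.le_mul_of_pos_right _ hTpos
          have h3 : k ^ 2 * T ≤ k ^ 2 * (s ^ (N + 3) * T) :=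
            Nat.mul_le_mul_left _ (Nat.le_mul_of_pos_left _ hX)
          omega
      _ = (k ^ 2 + 2) * (s ^ (N + 3) * T) := by ring
      _ ≤ s * (s ^ (N + 3) * T) := Nat.mul_le_mul_right _ hs2
      _ = _ := by ring
  calc 4 * (2 * ((k + 1) * d)) ^ k * (d + k ^ 2 * T + 1) * d ^ (P + 2)
      = 4 * (2 * (k + 1)) ^ k * d ^ k * (d + k ^ 2 * T + 1) * d ^ (P + 2) := by
        rw [← mul_assoc 2, mul_pow]; ring
    _ ≤ s * (s ^ (N + 3)) ^ k * (s * s ^ (N + 3) * T) * (s ^ (N + 3)) ^ (P + 2) := by gcongr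
    _ = T * s ^ ((N + 3) * (k + P + 3) + 2) := by ring
    _ ≤ T * s ^ M := by
        refine Nat.mul_le_mul_left _ (Nat.pow_le_pow_right hs ?_)
        rw [hM, stepExp]; omega
    _ = _ := by rw [e1, pow_add]

set_option maxHeartbeats 1000000 in
lemma IsDesign.hasSparseInduced_of_normalised [Fintype V] [Nonempty V]
    {inc : Fin L → Finset (Fin P)} {D : ℕ}
    (hDes : IsDesign k inc) (hk : 0 < k) (hP : 2 ≤ P) (hK : BicliqueFree G s)
    (hN : localExp 7 P L + 6 ≤ N) (hs : mainConst k P L N ≤ s) (hDlow : s ^ N ≤ D)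
    (hDhigh : D ≤ s ^ (N + 2)) (hsp : ∀ S : Finset V, adjCount G S S ≤ D * #S)
    (hdense : D * Fintype.card V ≤ 2 * adjCount G univ univ) : HasSparseInduced G k := by
  by_contra hnot
  set n := Fintype.card V with hn
  have hnpos : 0 < n := Fintype.card_pos
  unfold mainConst at hs
  set M := stepExp k P L N with hM
  set N₁ := degExp k P L N with hN₁
  set m := s ^ localExp 7 P L with hm
  have hs0 : 0 < s := by omega
  have hDpos : 0 < D := lt_of_lt_of_le (pow_pos hs0 _) hDlow
  have hLS : ∀ A B : Finset V, m ≤ #A → m ≤ #B → s ^ 7 * adjCount G A B ≤ #A * #B := by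
    intro A B hA hB
    by_contra! hlt
    exact hnot (hDes.hasSparseInduced_of_dense hP hK 7 (by omega) hA hB hlt.le)
  set A₀ := lowDegree G (s ^ N₁) with hA₀
  have hnotlow : 4 * adjCount G A₀ A₀ < D * n := by
    by_contra! hle
    refine hnot (hasSparseInduced_of_lowDegree hk (by rw [hN₁, degExp]; omega) (pow_pos hs0 _)
      (by omega) hsp hLS ?_ hle)
    rw [← pow_add]
    exact (Nat.pow_le_pow_right hs0 (by omega)).trans hDlow
  set B := univ \ A₀ with hB
  have hBdeg : ∀ b ∈ B, s ^ N₁ ≤ #(nbr G b univ) := fun b hb => by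
    have := (mem_sdiff.mp hb).2
    simpa [hA₀, lowDegree] using this
  have hBn : #B * s ^ N₁ ≤ D * n := by
    calc #B * s ^ N₁ ≤ ∑ b ∈ B, #(nbr G b univ) := by
          rw [← smul_eq_mul, ← sum_const]; exact sum_le_sum hBdeg
      _ ≤ adjCount G univ univ := sum_le_sum_of_subset (subset_univ _)
      _ ≤ _ := hsp univ
  have hBsmall : 8000 * (s ^ (M * P) * #B) ≤ n := by
    refine Nat.le_of_mul_le_mul_right ?_ (pow_pos hs0 (N + 2))
    calc 8000 * (s ^ (M * P) * #B) * s ^ (N + 2) ≤ s * (s ^ (M * P) * #B) * s ^ (N + 2) :=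
          Nat.mul_le_mul_right _ (Nat.mul_le_mul_right _ (by omega))
      _ = #B * s ^ (M * P + N + 3) := by ring
      _ ≤ #B * s ^ N₁ := by
          refine Nat.mul_le_mul_left _ (Nat.pow_le_pow_right hs0 ?_)
          rw [hN₁, degExp, mul_add, ← hM]; omega
      _ ≤ D * n := hBn
      _ ≤ n * s ^ (N + 2) := by rw [mul_comm]; exact Nat.mul_le_mul_left _ hDhigh
  have hB80 : 8000 * #B ≤ n :=
    (Nat.mul_le_mul_left _ (Nat.le_mul_of_pos_left _ (pow_pos hs0 _))).trans hBsmall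
  have hcross : D * n ≤ 10 * adjCount G A₀ B := by
    have e0 : (univ : Finset V) = A₀ ∪ B := by rw [hB]; simp
    have e1 : adjCount G univ univ ≤ adjCount G A₀ A₀ + 2 * adjCount G A₀ B + adjCount G B B := by
      have f1 := adjCount_union_le (G := G) A₀ B univ
      have f2 := adjCount_union_le (G := G) A₀ B A₀
      have f3 := adjCount_union_le (G := G) A₀ B B
      rw [← e0] at f1 f2 f3
      rw [adjCount_comm A₀ univ, adjCount_comm B univ] at f1
      rw [adjCount_comm B A₀] at f2
      omega
    have e2 := hsp B
    have e3 : D * (8000 * #B) ≤ D * n := Nat.mul_le_mul_left _ hB80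
    have e4 : D * (8000 * #B) = 8000 * (D * #B) := by ring
    omega
  set d := 100 * D with hd
  set z := s ^ (N - 1) with hz
  have hsz : s * z ≤ D := by
    refine le_trans (le_of_eq ?_) hDlow
    rw [hz, ← pow_succ', Nat.sub_add_cancel (by omega)]
  set Ahi := A₀.filter fun a => d < #(nbr G a B) with hAhi
  set Alo := A₀.filter fun a => #(nbr G a B) < z with hAlo
  set A := A₀.filter fun a => z ≤ #(nbr G a B) ∧ #(nbr G a B) ≤ d with hA
  have hedges : adjCount G A₀ B ≤ adjCount G Ahi B + adjCount G Alo B + adjCount G A B := by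
    refine le_trans (adjCount_mono (fun a ha => ?_) subset_rfl)
      ((adjCount_union_le _ _ _).trans (Nat.add_le_add_right (adjCount_union_le Ahi Alo B) _))
    simp only [hAhi, hAlo, hA, mem_union, mem_filter]
    rcases lt_or_ge d #(nbr G a B) with h | h
    · exact Or.inl (Or.inl ⟨ha, h⟩)
    · rcases lt_or_ge #(nbr G a B) z with h' | h'
      · exact Or.inl (Or.inr ⟨ha, h'⟩)
      · exact Or.inr ⟨ha, h', h⟩
  have hhi : adjCount G Ahi B ≤ 2 * (D * #B) :=
    adjCount_of_high_le hsp fun x hx => by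
      have := (mem_filter.mp hx).2
      omega
  have hlo : adjCount G Alo B ≤ n * z := by
    calc adjCount G Alo B ≤ ∑ a ∈ Alo, z := sum_le_sum fun a ha => (mem_filter.mp ha).2.le
      _ = #Alo * z := by rw [sum_const, smul_eq_mul]
      _ ≤ n * z := Nat.mul_le_mul_right _ (card_le_univ _)
  have hAe : adjCount G A B ≤ #A * d := by
    rw [← smul_eq_mul, ← sum_const]
    exact sum_le_sum fun a ha => (mem_filter.mp ha).2.2
  have hAn : n ≤ 2000 * #A := by
    have e1 : 40 * (n * z) ≤ D * n := by
      calc 40 * (n * z) ≤ s * (n * z) := Nat.mul_le_mul_right _ (by omega)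
        _ = s * z * n := by ring
        _ ≤ _ := Nat.mul_le_mul_right _ hsz
    have e2 : D * (8000 * #B) ≤ D * n := Nat.mul_le_mul_left _ hB80
    have e3 : D * (8000 * #B) = 8000 * (D * #B) := by ring
    have e4 : #A * d = 100 * (D * #A) := by rw [hd]; ring
    have e5 : D * n ≤ D * (2000 * #A) := by
      have : D * (2000 * #A) = 2000 * (D * #A) := by ring
      omega
    exact Nat.le_of_mul_le_mul_left e5 hDpos
  have hBne : B.Nonempty := by
    rw [nonempty_iff_ne_empty]
    intro h
    rw [h] at hcross
    have : adjCount G A₀ ∅ = 0 := by simp [adjCount, nbr]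
    rw [this] at hcross
    have : 0 < D * n := Nat.mul_pos hDpos hnpos
    omega
  obtain ⟨b, hb⟩ := hBne
  have hnbig : s ^ N₁ ≤ n := (hBdeg b hb).trans (card_le_univ _)
  have hsD : s ≤ D := (Nat.le_mul_of_pos_right _ (pow_pos hs0 _)).trans hsz
  have hz1 : s * s ≤ z := by
    rw [hz, ← sq]
    exact Nat.pow_le_pow_right hs0 (by unfold localExp at hN; omega)
  have hsz' : s ≤ z := (Nat.le_mul_of_pos_left _ hs0).trans hz1
  refine hnot (hDes.hasSparseInduced_of_unbalanced (A := A) (B := B) (d := d) (z := z) (s := s)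
    (T := fun j => s ^ (M * (P + 1 - j))) hk hs0 (by omega) hK (by omega)
    (disjoint_sdiff.mono_left (filter_subset _ _)) (card_pos.mp (by omega)) ?_
    (fun a ha => (mem_filter.mp ha).2.2) (fun a ha => (mem_filter.mp ha).2.1) ?_
    ((by omega : 4 * k * (2 * k) ^ P ≤ s).trans hsz') ?_ ?_ (fun j => pow_pos hs0 _) ?_ ?_ ?_)
  · intro S
    exact (hsp S).trans (Nat.mul_le_mul_right _ (by omega))
  · intro Z hZ
    have hmz : m ≤ z := Nat.pow_le_pow_right hs0 (by omega)
    rw [sq #Z]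
    refine le_trans (Nat.mul_le_mul_right _ ?_) (hLS Z Z (hmz.trans hZ) (hmz.trans hZ))
    exact (by omega : _ ≤ s).trans (Nat.le_self_pow (by norm_num) _)
  · refine lt_of_lt_of_le ?_ hz1
    calc (2 * k) ^ P ^ 2 * (L * P * s) = (2 * k) ^ P ^ 2 * (L * P) * s := by ring
      _ < s * s := Nat.mul_lt_mul_of_pos_right (by omega) hs0
  · intro j hj
    refine threshold_step (by omega) (by omega) ?_ hj
    calc d ≤ s * s ^ (N + 2) := Nat.mul_le_mul (by omega) hDhigh
      _ = s ^ (N + 3) := by ring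
  · have e1 : P + 1 - P = 1 := by omega
    simp only [e1, mul_one]
    calc 4 * s * L * (2 * s) ^ L * (2 * s) ^ P = 4 * L * 2 ^ (L + P) * s ^ (L + P + 1) := by
          rw [mul_pow, mul_pow]; ring
      _ ≤ s * s ^ (L + P + 1) := Nat.mul_le_mul_right _ (by omega)
      _ = s ^ (L + P + 2) := by ring
      _ ≤ s ^ M := by
          refine Nat.pow_le_pow_right hs0 ?_
          rw [hM, stepExp]
          nlinarith
  · simp only [Nat.sub_zero]
    refine Nat.le_of_mul_le_mul_left (le_trans ?_ hAn) (by norm_num : 0 < 2000)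
    refine le_trans ?_ hnbig
    calc 2000 * s ^ (M * (P + 1)) ≤ s * s ^ (M * (P + 1)) := Nat.mul_le_mul_right _ (by omega)
      _ = s ^ (M * (P + 1) + 1) := by ring
      _ ≤ s ^ N₁ := Nat.pow_le_pow_right hs0 (by rw [hN₁, degExp, ← hM]; omega)
  · simp only [Nat.add_sub_cancel]
    have : #B * s ^ (M * P) = s ^ (M * P) * #B := mul_comm _ _
    omega

end Main

section Transfer

variable {V W : Type*} {G : SimpleGraph V} {k s : ℕ}

lemma BicliqueFree.mono {t : ℕ} (hK : BicliqueFree G s) (hst : s ≤ t) : BicliqueFree G t := by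
  intro A B hA hB hAB
  obtain ⟨A', hA', hA's⟩ := exists_subset_card_eq (hst.trans hA.ge)
  obtain ⟨B', hB', hB's⟩ := exists_subset_card_eq (hst.trans hB.ge)
  exact hK A' B' hA's hB's fun a ha b hb => hAB a (hA' ha) b (hB' hb)

lemma adjCount_comap (f : W ↪ V) (X Y : Finset W) :
    adjCount (G.comap f) X Y = adjCount G (X.map f) (Y.map f) := by
  unfold adjCount
  rw [sum_map]
  refine sum_congr rfl fun x _ => ?_
  rw [← card_map f]
  congr 1
  ext y
  simp only [mem_map, mem_nbr, SimpleGraph.comap_adj]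
  constructor
  · rintro ⟨w, ⟨hw, h⟩, rfl⟩
    exact ⟨⟨w, hw, rfl⟩, h⟩
  · rintro ⟨⟨w, hw, rfl⟩, h⟩
    exact ⟨w, ⟨hw, h⟩, rfl⟩

lemma BicliqueFree.comap (hK : BicliqueFree G s) (f : W ↪ V) : BicliqueFree (G.comap f) s := by
  intro A B hA hB hAB
  refine hK (A.map f) (B.map f) (by rw [card_map, hA]) (by rw [card_map, hB]) ?_
  intro a ha b hb
  obtain ⟨a', ha', rfl⟩ := mem_map.mp ha
  obtain ⟨b', hb', rfl⟩ := mem_map.mp hb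
  exact hAB a' ha' b' hb'

lemma HasSparseInduced.of_comap {f : W ↪ V} (h : HasSparseInduced (G.comap f) k) :
    HasSparseInduced G k := by
  obtain ⟨A, hA, hC4, hcard⟩ := h
  refine ⟨A.map f, hA.map, ?_, by rwa [card_map, ← adjCount_comap]⟩
  intro a ha b hb c hc d hd hac hbd h1 h2 h3
  obtain ⟨a', ha', rfl⟩ := mem_map.mp ha
  obtain ⟨b', hb', rfl⟩ := mem_map.mp hb
  obtain ⟨c', hc', rfl⟩ := mem_map.mp hc
  obtain ⟨d', hd', rfl⟩ := mem_map.mp hd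
  exact hC4 a' ha' b' hb' c' hc' d' hd' (fun h => hac (h ▸ rfl)) (fun h => hbd (h ▸ rfl)) h1 h2 h3

lemma adjCount_univ_eq [Fintype V] (G : SimpleGraph V) :
    adjCount G univ univ = 2 * G.edgeSet.ncard := by
  have h1 : adjCount G univ univ = ∑ v, G.degree v := by
    refine sum_congr rfl fun v _ => ?_
    rw [← G.card_neighborFinset_eq_degree]
    congr 1
    ext w
    simp
  rw [h1, G.sum_degrees_eq_twice_card_edges, ← G.coe_edgeFinset, Set.ncard_coe_finset]

lemma bicliqueFree_of_not_hasKssSubgraph (h : ¬ HasKssSubgraph G s) : BicliqueFree G s := by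
  intro A B hA hB hAB
  refine h ?_
  let eA := A.equivFinOfCardEq hA
  let eB := B.equivFinOfCardEq hB
  refine ⟨⟨Sum.elim (fun i => (eA.symm i : V)) fun i => (eB.symm i : V), ?_⟩, ?_⟩
  · rintro (i | i) (j | j) hij
    · simp at hij
    · exact hAB _ (eA.symm i).2 _ (eB.symm j).2
    · exact (hAB _ (eA.symm j).2 _ (eB.symm i).2).symm
    · simp at hij
  · rintro (i | i) (j | j) hij
    · exact congrArg _ (eA.symm.injective (Subtype.ext hij))
    · exact absurd hij (hAB _ (eA.symm i).2 _ (eB.symm j).2).ne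
    · exact absurd hij (hAB _ (eA.symm j).2 _ (eB.symm i).2).ne'
    · exact congrArg _ (eB.symm.injective (Subtype.ext hij))

lemma HasSparseInduced.exists_induce (h : HasSparseInduced G k) :
    ∃ A : Finset V, C4Free (G.induce (A : Set V)) ∧ avgDeg (G.induce (A : Set V)) ≥ (k : ℝ) := by
  obtain ⟨A, hA, hC4, hcard⟩ := h
  refine ⟨A, ?_, ?_⟩
  · rintro ⟨a, b, c, d, -, hac, -, -, hbd, -, h1, h2, h3, h4⟩
    exact hC4 a a.2 b b.2 c c.2 d d.2 (fun h => hac (Subtype.ext h)) (fun h => hbd (Subtype.ext h))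
      h1 h2 h3 h4
  · have h1 := adjCount_univ_eq (G.induce (A : Set V))
    have h2 := adjCount_comap (G := G) (Function.Embedding.subtype fun x => x ∈ (A : Set V))
      univ univ
    have h3 : (univ : Finset (A : Set V)).map
        (Function.Embedding.subtype fun x => x ∈ (A : Set V)) = A := by
      ext x; simp
    rw [h3] at h2
    have h4 : adjCount (G.induce (A : Set V)) univ univ = adjCount G A A := h2
    have h5 : (k : ℝ) * #A ≤ 2 * (G.induce (A : Set V)).edgeSet.ncard := by
      rw [← h4, h1] at hcard
      exact_mod_cast hcard
    have hApos : (0 : ℝ) < #A := by exact_mod_cast hA.card_pos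
    unfold avgDeg
    rw [ge_iff_le, le_div_iff₀ (by simpa using hA.card_pos)]
    simpa using h5

/-- A set of largest density. -/
lemma exists_densest [Fintype V] [Nonempty V] (G : SimpleGraph V) :
    ∃ W : Finset V, W.Nonempty ∧ ∀ S : Finset V,
      (adjCount G S S : ℝ) ≤ (adjCount G W W : ℝ) / #W * #S := by
  obtain ⟨W, hW, hmax⟩ := exists_max_image (univ.filter fun S : Finset V => S.Nonempty)
    (fun S => (adjCount G S S : ℝ) / #S) ⟨univ, by simp⟩
  refine ⟨W, (mem_filter.mp hW).2, fun S => ?_⟩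
  rcases S.eq_empty_or_nonempty with rfl | hS
  · simp [adjCount]
  · have hpos : (0 : ℝ) < #S := by exact_mod_cast hS.card_pos
    rw [← div_le_iff₀ hpos]
    exact hmax S (by simp [hS])

/-- The integer `N`-th root of `D`, large enough, pins `D` down up to a factor `t`. -/
lemma exists_root {N D : ℕ} (hN : 0 < N) (hs : 2 ^ N ≤ s) (hD : s ^ N ≤ D) :
    ∃ t, s ≤ t ∧ t ^ N ≤ D ∧ D ≤ t ^ (N + 2) := by
  set t := Nat.findGreatest (fun t => t ^ N ≤ D) D with ht
  have hsD : s ≤ D := (Nat.le_self_pow hN.ne' s).trans hD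
  have hst : s ≤ t := Nat.le_findGreatest hsD hD
  have hs0 : 0 < s := (pow_pos (by norm_num) N).trans_le hs
  have htD : t ^ N ≤ D := Nat.findGreatest_spec (P := fun t => t ^ N ≤ D) hsD hD
  refine ⟨t, hst, htD, ?_⟩
  have hlt : D < (t + 1) ^ N := by
    by_contra! h
    have h1 : t + 1 ≤ t := Nat.le_findGreatest ((Nat.le_self_pow hN.ne' _).trans h) h
    omega
  calc D ≤ (t + 1) ^ N := hlt.le
    _ ≤ (2 * t) ^ N := Nat.pow_le_pow_left (by omega) _
    _ = 2 ^ N * t ^ N := mul_pow _ _ _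
    _ ≤ t * t ^ N := Nat.mul_le_mul_right _ (hs.trans hst)
    _ ≤ t * (t * t ^ N) := Nat.mul_le_mul_left _ (Nat.le_mul_of_pos_left _ (by omega))
    _ = t ^ (N + 2) := by ring

lemma IsDesign.hasSparseInduced_of_dense_graph [Fintype V] [Nonempty V] {P L N : ℕ}
    {inc : Fin L → Finset (Fin P)} (hDes : IsDesign k inc) (hk : 0 < k) (hP : 2 ≤ P)
    (hK : BicliqueFree G s) (hN : localExp 7 P L + 6 ≤ N)
    (hs : mainConst k P L N + 2 ^ N ≤ s) (hG : s ^ N * Fintype.card V ≤ adjCount G univ univ) :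
    HasSparseInduced G k := by
  obtain ⟨W, hW, hmax⟩ := exists_densest G
  set ρ : ℝ := (adjCount G W W : ℝ) / #W with hρ
  have hWpos : (0 : ℝ) < #W := by exact_mod_cast hW.card_pos
  have hs0 : 0 < s := (pow_pos (by norm_num : 0 < 2) N).trans_le (by omega)
  have hρs : (s : ℝ) ^ N ≤ ρ := by
    have h1 : (s : ℝ) ^ N * Fintype.card V ≤ adjCount G univ univ := by exact_mod_cast hG
    have h2 := h1.trans (hmax univ)
    rw [card_univ] at h2
    exact le_of_mul_le_mul_right h2 (by exact_mod_cast Fintype.card_pos)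
  have hs1 : (1 : ℝ) ≤ s := by exact_mod_cast hs0
  have hρ1 : 1 ≤ ρ := (one_le_pow₀ hs1).trans hρs
  set D := ⌈ρ⌉₊ with hD
  have hDρ : (D : ℝ) ≤ 2 * ρ := by
    have := (Nat.ceil_lt_add_one (by linarith : 0 ≤ ρ)).le
    linarith
  have hsD : s ^ N ≤ D := by
    have := hρs.trans (Nat.le_ceil ρ)
    exact_mod_cast this
  obtain ⟨t, hst, htD, hDt⟩ := exists_root (by omega : 0 < N) (by omega : 2 ^ N ≤ s) hsD
  have : Nonempty {x // x ∈ W} := hW.to_subtype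
  refine HasSparseInduced.of_comap (f := Function.Embedding.subtype fun x => x ∈ W)
    (hDes.hasSparseInduced_of_normalised hk hP ((hK.mono hst).comap _) hN
      (le_self_add.trans (hs.trans hst)) htD hDt
      (fun S => ?_) ?_)
  · have h1 := hmax (S.map (Function.Embedding.subtype fun x => x ∈ W))
    rw [← adjCount_comap, card_map] at h1
    have h2 : (adjCount (G.comap (Function.Embedding.subtype fun x => x ∈ W)) S S : ℝ) ≤ D * #S :=
      h1.trans (mul_le_mul_of_nonneg_right (Nat.le_ceil ρ) (Nat.cast_nonneg _))
    exact_mod_cast h2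
  · have h3 : (univ : Finset {x // x ∈ W}).map (Function.Embedding.subtype fun x => x ∈ W) = W := by
      ext x; simp
    rw [adjCount_comap, h3, Fintype.card_coe]
    have h4 : (D : ℝ) * #W ≤ 2 * adjCount G W W := by
      calc (D : ℝ) * #W ≤ 2 * ρ * #W := by gcongr
        _ = 2 * adjCount G W W := by rw [hρ]; field_simp
    exact_mod_cast h4

lemma localExp_le {P L : ℕ} (hk : 2 ≤ k) (hP : P ≤ 2 * k ^ 2) (hL : L ≤ 4 * k ^ 2) :
    localExp 7 P L + 6 ≤ 5000 * k ^ 4 := by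
  have h1 : P ^ 2 ≤ (2 * k ^ 2) ^ 2 := Nat.pow_le_pow_left hP 2
  have h2 : (2 * k ^ 2) ^ 2 = 4 * k ^ 4 := by ring
  have h3 : k ^ 2 ≤ k ^ 4 := Nat.pow_le_pow_right (by omega) (by norm_num)
  have h4 : 1 ≤ k ^ 2 := Nat.one_le_pow _ _ (by omega)
  unfold localExp
  omega

end Transfer

end InducedC4Free

end

/-- For every `k ≥ 2` and all sufficiently large `s`, every graph with
average degree at least `s ^ (5000 k⁴)` contains `K_{s,s}` as a subgraph or an induced
subgraph without `C₄` and with average degree at least `k`. -/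
theorem stmt1 :
    ∀ k : ℕ, 2 ≤ k → ∃ s₀ : ℕ, ∀ s : ℕ, s₀ ≤ s →
      ∀ (V : Type) [Fintype V] (G : SimpleGraph V),
        avgDeg G ≥ (s : ℝ) ^ (5000 * k ^ 4) →
        HasKssSubgraph G s ∨
          ∃ A : Finset V, C4Free (G.induce (A : Set V)) ∧
            avgDeg (G.induce (A : Set V)) ≥ (k : ℝ) := by
  intro k hk
  obtain ⟨P, L, inc, hDes, hP, hP', hL⟩ := InducedC4Free.exists_design k hk
  refine ⟨InducedC4Free.mainConst k P L (5000 * k ^ 4) + 2 ^ (5000 * k ^ 4),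
    fun s hs V _ G hG => or_iff_not_imp_left.mpr fun hK => ?_⟩
  have hs0 : 0 < s := (pow_pos (by norm_num : 0 < 2) (5000 * k ^ 4)).trans_le (by omega)
  have hspos : (0 : ℝ) < (s : ℝ) ^ (5000 * k ^ 4) := by positivity
  have hne : Nonempty V := by
    by_contra h
    rw [not_nonempty_iff] at h
    simp only [avgDeg, Fintype.card_eq_zero, Nat.cast_zero, div_zero] at hG
    linarith
  refine (hDes.hasSparseInduced_of_dense_graph (by omega) hP
    (InducedC4Free.bicliqueFree_of_not_hasKssSubgraph hK) (InducedC4Free.localExp_le hk hP' hL) hs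
    ?_).exists_induce
  rw [InducedC4Free.adjCount_univ_eq]
  have hcard : (0 : ℝ) < Fintype.card V := by exact_mod_cast Fintype.card_pos
  have h1 := (le_div_iff₀ hcard).mp hG
  exact_mod_cast h1
end

section
/- Let G be a graph on n vertices and let s ≥ 1 be an integer. If the number of vertices x of G with degree d(x) ≥ n^{1 − 1/(100s)} is at least √n, then G has a set S of at least n^{1/3} − 1 vertices such that every s-element subset S' ⊆ S has a common neighbourhood of size at least n^{0.9}, i.e. |⋂_{x∈S'} N(x)| ≥ n^{0.9}. -/
open Finset

section DependentRandomChoice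

variable {V : Type*} [Fintype V]

open Classical in
/-- The common neighbourhood of a finite set of vertices, as a finset. -/
noncomputable def commonNbhd (G : SimpleGraph V) (Q : Finset V) : Finset V :=
  {v | ∀ x ∈ Q, G.Adj x v}

lemma mem_commonNbhd {G : SimpleGraph V} {Q : Finset V} {v : V} :
    v ∈ commonNbhd G Q ↔ ∀ x ∈ Q, G.Adj x v := by
  simp [commonNbhd]

lemma ncard_iInter_neighborSet (G : SimpleGraph V) (Q : Finset V) :
    (⋂ x ∈ (Q : Set V), G.neighborSet x).ncard = (commonNbhd G Q).card := by
  rw [← Set.ncard_coe_finset]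
  congr 1
  ext v
  simp [mem_commonNbhd]

lemma card_commonNbhd_singleton (G : SimpleGraph V) (x : V) :
    (commonNbhd G {x}).card = deg G x := by
  rw [← ncard_iInter_neighborSet, deg]
  simp

open Classical in
/-- The number of `t`-tuples of common neighbours of `Q`. -/
lemma card_tuples_commonNbhd (G : SimpleGraph V) (Q : Finset V) (t : ℕ) :
    #{T : Fin t → V | ∀ x ∈ Q, ∀ i, G.Adj x (T i)} = (commonNbhd G Q).card ^ t := by
  have h : ({T : Fin t → V | ∀ x ∈ Q, ∀ i, G.Adj x (T i)} : Finset (Fin t → V)) =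
      Fintype.piFinset fun _ => commonNbhd G Q := by
    ext T
    simp only [mem_filter_univ, Fintype.mem_piFinset, mem_commonNbhd]
    exact ⟨fun h i x hx => h x hx i, fun h x hx i => h i x hx⟩
  rw [h, Fintype.card_piFinset_const]

/-- If a finite set `X` contains at most `b` sets of a family of nonempty sets, then deleting at
most `b` elements of `X` leaves a set containing none of them. -/
lemma exists_subset_avoiding {α : Type*} [DecidableEq α] [Nonempty α] (X : Finset α)
    (B : Finset (Finset α)) (hB : ∀ Q ∈ B, Q.Nonempty) :
    ∃ S ⊆ X, #X ≤ #S + #{Q ∈ B | Q ⊆ X} ∧ ∀ Q ∈ B, ¬ Q ⊆ S := by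
  choose! f hf using hB
  refine ⟨X \ {Q ∈ B | Q ⊆ X}.image f, sdiff_subset, ?_, fun Q hQ hQS => ?_⟩
  · have h₁ := le_card_sdiff ({Q ∈ B | Q ⊆ X}.image f) X
    have h₂ : #({Q ∈ B | Q ⊆ X}.image f) ≤ #{Q ∈ B | Q ⊆ X} := card_image_le
    omega
  · have h := mem_sdiff.1 (hQS (hf Q hQ))
    exact h.2 (mem_image_of_mem f (mem_filter.2 ⟨hQ, hQS.trans sdiff_subset⟩))

open Classical in
/-- The averaging step of dependent random choice: some `t`-tuple has a common neighbourhood in `A`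
which is large compared with the number of members of `B` it contains. -/
lemma exists_large_avoiding [Nonempty V] (G : SimpleGraph V) (A : Finset V)
    (B : Finset (Finset V)) (hB : ∀ Q ∈ B, Q.Nonempty) (t : ℕ) (r : ℝ)
    (h : (Fintype.card V : ℝ) ^ t * r ≤
      ∑ x ∈ A, (deg G x : ℝ) ^ t - ∑ Q ∈ B, (#(commonNbhd G Q) : ℝ) ^ t) :
    ∃ S : Finset V, r ≤ #S ∧ ∀ Q ∈ B, ¬ Q ⊆ S := by
  let X : (Fin t → V) → Finset V := fun T => {x ∈ A | ∀ i, G.Adj x (T i)}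
  have hX : ∑ T, #(X T) = ∑ x ∈ A, deg G x ^ t := by
    have hcount := sum_card_bipartiteAbove_eq_sum_card_bipartiteBelow
      (s := A) (t := (univ : Finset (Fin t → V))) (fun x T => ∀ i, G.Adj x (T i))
    simp only [bipartiteAbove, bipartiteBelow] at hcount
    rw [← hcount]
    refine sum_congr rfl fun x _ => ?_
    rw [← card_commonNbhd_singleton, ← card_tuples_commonNbhd]
    simp
  have hBad : ∑ T, #{Q ∈ B | Q ⊆ X T} ≤ ∑ Q ∈ B, #(commonNbhd G Q) ^ t := by
    have hcount := sum_card_bipartiteAbove_eq_sum_card_bipartiteBelow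
      (s := B) (t := (univ : Finset (Fin t → V))) (fun Q T => Q ⊆ X T)
    simp only [bipartiteAbove, bipartiteBelow] at hcount
    rw [← hcount]
    refine sum_le_sum fun Q _ => ?_
    rw [← card_tuples_commonNbhd]
    refine card_le_card fun T hT => ?_
    simp only [mem_filter_univ] at hT ⊢
    exact fun x hx => (mem_filter.1 (hT hx)).2
  have hX' : ∑ T, (#(X T) : ℝ) = ∑ x ∈ A, (deg G x : ℝ) ^ t := by exact_mod_cast hX
  have hBad' : ∑ T, (#{Q ∈ B | Q ⊆ X T} : ℝ) ≤ ∑ Q ∈ B, (#(commonNbhd G Q) : ℝ) ^ t := by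
    exact_mod_cast hBad
  obtain ⟨T, -, hT⟩ : ∃ T ∈ (univ : Finset (Fin t → V)),
      r ≤ (#(X T) : ℝ) - #{Q ∈ B | Q ⊆ X T} := by
    refine exists_le_of_sum_le univ_nonempty ?_
    rw [sum_sub_distrib, sum_const, nsmul_eq_mul, card_univ, Fintype.card_fun, Fintype.card_fin,
      Nat.cast_pow]
    linarith
  obtain ⟨S, -, hS, hS'⟩ := exists_subset_avoiding (X T) B hB
  refine ⟨S, ?_, hS'⟩
  have : (#(X T) : ℝ) ≤ #S + #{Q ∈ B | Q ⊆ X T} := by exact_mod_cast hS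
  linarith

end DependentRandomChoice

/-- Dependent random choice: if at least `√n` vertices of an `n`-vertex
graph have degree at least `n ^ (1 - 1/(100s))`, then there is a set `S` of at least
`n^(1/3) - 1` vertices all of whose `s`-subsets have common neighbourhood of size at
least `n^(0.9)`. -/
theorem stmt3 :
    ∀ (V : Type) [Fintype V] (G : SimpleGraph V) (s : ℕ), 1 ≤ s →
      ((Set.ncard {x : V |
          ((Fintype.card V : ℝ) ^ ((1 : ℝ) - 1 / (100 * (s : ℝ))) ≤ (deg G x : ℝ))} : ℝ)
        ≥ Real.sqrt (Fintype.card V)) →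
      ∃ S : Finset V, (S.card : ℝ) ≥ (Fintype.card V : ℝ) ^ ((1 : ℝ) / 3) - 1 ∧
        ∀ S' : Finset V, S' ⊆ S → S'.card = s →
          ((⋂ x ∈ (S' : Set V), G.neighborSet x).ncard : ℝ)
            ≥ (Fintype.card V : ℝ) ^ ((0.9 : ℝ)) := by
  intro V _ G s hs hA
  classical
  rcases isEmpty_or_nonempty V with hV | hV
  · refine ⟨∅, by simp, fun S' hS' hcard => ?_⟩
    rw [subset_empty.1 hS', card_empty] at hcard
    omega
  set n := (Fintype.card V : ℝ) with hn
  have hn1 : 1 ≤ n := by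
    rw [hn]
    exact_mod_cast Fintype.card_pos
  have hn0 : 0 < n := by linarith
  have hs0 : (0 : ℝ) < s := by exact_mod_cast hs
  let A : Finset V := {x | n ^ ((1 : ℝ) - 1 / (100 * (s : ℝ))) ≤ (deg G x : ℝ)}
  let B : Finset (Finset V) :=
    {Q ∈ powersetCard s univ | (#(commonNbhd G Q) : ℝ) < n ^ (0.9 : ℝ)}
  have hB : ∀ Q ∈ B, #Q = s ∧ (#(commonNbhd G Q) : ℝ) < n ^ (0.9 : ℝ) := fun Q hQ =>
    ⟨(mem_powersetCard.1 (mem_filter.1 hQ).1).2, (mem_filter.1 hQ).2⟩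
  have hAcard : n ^ (1 / 2 : ℝ) ≤ #A := by
    rw [← Real.sqrt_eq_rpow, ← Set.ncard_coe_finset]
    simpa [A] using hA
  have hBcard : (#B : ℝ) ≤ n ^ s := by
    have h : #B ≤ Fintype.card V ^ s :=
      (card_filter_le _ _).trans (by
        rw [card_powersetCard, card_univ]
        exact Nat.choose_le_pow _ _)
    rw [hn]
    exact_mod_cast h
  have hdeg : n ^ (16 * s) * n ^ (1 / 3 : ℝ) ≤ ∑ x ∈ A, (deg G x : ℝ) ^ (16 * s) := by
    have hx : ∀ x ∈ A, n ^ (16 * s - 0.16 : ℝ) ≤ (deg G x : ℝ) ^ (16 * s) := fun x hx => by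
      refine le_trans (le_of_eq ?_)
        (pow_le_pow_left₀ (by positivity) (mem_filter.1 hx).2 (16 * s))
      rw [← Real.rpow_mul_natCast hn0.le]
      congr 1
      push_cast
      field_simp
      ring
    calc n ^ (16 * s) * n ^ (1 / 3 : ℝ)
        ≤ n ^ (1 / 2 : ℝ) * n ^ (16 * s - 0.16 : ℝ) := by
          rw [← Real.rpow_natCast, ← Real.rpow_add hn0, ← Real.rpow_add hn0]
          refine Real.rpow_le_rpow_of_exponent_le hn1 ?_
          push_cast
          norm_num
          linarith
      _ ≤ #A * n ^ (16 * s - 0.16 : ℝ) := by gcongr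
      _ ≤ ∑ x ∈ A, (deg G x : ℝ) ^ (16 * s) := by
          rw [← nsmul_eq_mul]
          exact card_nsmul_le_sum _ _ _ hx
  have hbad : ∑ Q ∈ B, (#(commonNbhd G Q) : ℝ) ^ (16 * s) ≤ n ^ (16 * s) := by
    have hQ : ∀ Q ∈ B, (#(commonNbhd G Q) : ℝ) ^ (16 * s) ≤ (n ^ (0.9 : ℝ)) ^ (16 * s) :=
      fun Q hQ => pow_le_pow_left₀ (by positivity) (hB Q hQ).2.le _
    calc ∑ Q ∈ B, (#(commonNbhd G Q) : ℝ) ^ (16 * s)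
        ≤ #B * (n ^ (0.9 : ℝ)) ^ (16 * s) := by
          rw [← nsmul_eq_mul]
          exact sum_le_card_nsmul _ _ _ hQ
      _ ≤ n ^ s * (n ^ (0.9 : ℝ)) ^ (16 * s) := by gcongr
      _ ≤ n ^ (16 * s) := by
          rw [← Real.rpow_mul_natCast hn0.le, ← Real.rpow_natCast, ← Real.rpow_natCast,
            ← Real.rpow_add hn0]
          refine Real.rpow_le_rpow_of_exponent_le hn1 ?_
          push_cast
          linarith
  obtain ⟨S, hS, hSB⟩ := exists_large_avoiding G A B
    (fun Q hQ => card_pos.1 (by rw [(hB Q hQ).1]; omega)) (16 * s) (n ^ (1 / 3 : ℝ) - 1)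
    (by rw [← hn]; linarith)
  refine ⟨S, hS, fun S' hS' hcard => ?_⟩
  rw [ncard_iInter_neighborSet]
  by_contra! hlt
  exact hSB S' (mem_filter.2 ⟨mem_powersetCard.2 ⟨subset_univ _, hcard⟩, hlt⟩) hS'
end
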